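/- Let m ≥ 1, θ > 1, and let f : ℝ^m → ℝ be locally Lipschitz continuous and bounded from below. Define λ* := sup{ λ ∈ ℝ : the ergodic problem (EP)_λ admits a C² subsolution }. Then λ* is finite (in particular λ* ≥ inf_{ℝ^m} f), and the ergodic problem (EP)_{λ*} admits a C² solution. -/

import Mathlib

open Filter

noncomputable def lap {m : ℕ} (φ : EuclideanSpace ℝ (Fin m) → ℝ)
    (y : EuclideanSpace ℝ (Fin m)) : ℝ :=
  ∑ i : Fin m, iteratedFDeriv ℝ 2 φ y ![EuclideanSpace.single i 1, EuclideanSpace.single i 1]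

def IsSubsolution {m : ℕ} (θ : ℝ) (f : EuclideanSpace ℝ (Fin m) → ℝ) (lam : ℝ)
    (φ : EuclideanSpace ℝ (Fin m) → ℝ) : Prop :=
  ContDiff ℝ 2 φ ∧
    ∀ y, -(1/2) * lap φ y + (1/θ) * ‖gradient φ y‖ ^ θ ≤ f y - lam

def IsSupersolution {m : ℕ} (θ : ℝ) (f : EuclideanSpace ℝ (Fin m) → ℝ) (lam : ℝ)
    (φ : EuclideanSpace ℝ (Fin m) → ℝ) : Prop :=
  ContDiff ℝ 2 φ ∧
    ∀ y, -(1/2) * lap φ y + (1/θ) * ‖gradient φ y‖ ^ θ ≥ f y - lam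

def IsSolution {m : ℕ} (θ : ℝ) (f : EuclideanSpace ℝ (Fin m) → ℝ) (lam : ℝ)
    (φ : EuclideanSpace ℝ (Fin m) → ℝ) : Prop :=
  ContDiff ℝ 2 φ ∧
    ∀ y, -(1/2) * lap φ y + (1/θ) * ‖gradient φ y‖ ^ θ = f y - lam

noncomputable def lambdaStar {m : ℕ} (θ : ℝ) (f : EuclideanSpace ℝ (Fin m) → ℝ) : ℝ :=
  sSup {lam : ℝ | ∃ φ, IsSubsolution θ f lam φ}

def H0 {m : ℕ} (f : EuclideanSpace ℝ (Fin m) → ℝ) (α f₀ : ℝ) : Prop :=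
  LocallyLipschitz f ∧ BddBelow (Set.range f) ∧
    ∀ y, DifferentiableAt ℝ f y →
      (1 ≤ α → ‖gradient f y‖ ≤ f₀ * (1 + ‖y‖ ^ (α - 1))) ∧
      (α < 1 → ‖gradient f y‖ ≤ f₀)

def H1 {m : ℕ} (f : EuclideanSpace ℝ (Fin m) → ℝ) (α f₀ : ℝ) : Prop :=
  ∀ y, f₀⁻¹ * (‖y‖ ^ α + 1) ≤ f y ∧ f y ≤ f₀ * (‖y‖ ^ α + 1)

def MemPhi {m : ℕ} (γ : ℝ) (v : EuclideanSpace ℝ (Fin m) → ℝ) : Prop :=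
  ContDiff ℝ 2 v ∧ ∃ c > 1, ∀ y, c⁻¹ * ‖y‖ ^ γ - c ≤ v y ∧ v y ≤ c * (1 + ‖y‖ ^ γ)

def Coercive {m : ℕ} (f : EuclideanSpace ℝ (Fin m) → ℝ) : Prop :=
  Tendsto f (cocompact (EuclideanSpace ℝ (Fin m))) atTop




open Filter Topology
namespace EP

abbrev Eu (m : ℕ) := EuclideanSpace ℝ (Fin m)

noncomputable def ev {m : ℕ} (i : Fin m) : Eu m := EuclideanSpace.single i (1 : ℝ)

lemma norm_ev {m : ℕ} (i : Fin m) : ‖ev i‖ = 1 := by simp [ev]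

noncomputable def pd {m : ℕ} (i : Fin m) (φ : Eu m → ℝ) (x : Eu m) : ℝ := fderiv ℝ φ x (ev i)

lemma norm_grad {m : ℕ} (φ : Eu m → ℝ) (y : Eu m) : ‖gradient φ y‖ = ‖fderiv ℝ φ y‖ := by
  simp [gradient]

lemma clm_norm_sq {m : ℕ} (L : Eu m →L[ℝ] ℝ) : ‖L‖ ^ 2 = ∑ i, (L (ev i)) ^ 2 := by
  have h1 : ‖L‖ = ‖(InnerProductSpace.toDual ℝ (Eu m)).symm L‖ := by simp
  rw [h1, EuclideanSpace.norm_sq_eq]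
  refine Finset.sum_congr rfl fun i _ => ?_
  have h2 : L (ev i) = inner ℝ ((InnerProductSpace.toDual ℝ (Eu m)).symm L) (ev i) := by simp
  rw [h2, ev, EuclideanSpace.inner_single_right]
  simp

lemma clm_apply_ev_le {m : ℕ} (L : Eu m →L[ℝ] ℝ) (i : Fin m) : |L (ev i)| ≤ ‖L‖ := by
  have := L.le_opNorm (ev i)
  rwa [norm_ev, mul_one, Real.norm_eq_abs] at this

lemma lap_eq {m : ℕ} (φ : Eu m → ℝ) (y : Eu m) :
    lap φ y = ∑ i, fderiv ℝ (fderiv ℝ φ) y (ev i) (ev i) := by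
  unfold lap
  refine Finset.sum_congr rfl fun i _ => ?_
  rw [iteratedFDeriv_two_apply]
  rfl

lemma pd_differentiableAt {m : ℕ} {φ : Eu m → ℝ} {x : Eu m} (h : ContDiffAt ℝ 2 φ x) (i : Fin m) :
    DifferentiableAt ℝ (pd i φ) x := by
  have h1 : DifferentiableAt ℝ (fderiv ℝ φ) x :=
    (h.fderiv_right (m := 1) (by norm_num)).differentiableAt (by norm_num)
  exact h1.clm_apply (differentiableAt_const _)

lemma pd_pd {m : ℕ} {φ : Eu m → ℝ} {x : Eu m} (h : ContDiffAt ℝ 2 φ x) (i j : Fin m) :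
    pd i (pd j φ) x = fderiv ℝ (fderiv ℝ φ) x (ev i) (ev j) := by
  have h1 : DifferentiableAt ℝ (fderiv ℝ φ) x :=
    (h.fderiv_right (m := 1) (by norm_num)).differentiableAt (by norm_num)
  unfold pd
  rw [fderiv_clm_apply h1 (differentiableAt_const _)]
  simp

lemma lap_eq_pd {m : ℕ} {φ : Eu m → ℝ} {x : Eu m} (h : ContDiffAt ℝ 2 φ x) :
    lap φ x = ∑ i, pd i (pd i φ) x := by
  rw [lap_eq]
  exact Finset.sum_congr rfl fun i _ => (pd_pd h i i).symm

lemma pd_congr {m : ℕ} {φ ψ : Eu m → ℝ} {x : Eu m} (h : φ =ᶠ[𝓝 x] ψ) (i : Fin m) :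
    pd i φ =ᶠ[𝓝 x] pd i ψ := by
  filter_upwards [h.fderiv (𝕜 := ℝ)] with y hy
  simp [pd, hy]

lemma lap_congr {m : ℕ} {φ ψ : Eu m → ℝ} {x : Eu m} (h : φ =ᶠ[𝓝 x] ψ) : lap φ x = lap ψ x := by
  rw [lap_eq, lap_eq, (h.fderiv (𝕜 := ℝ)).fderiv_eq]

lemma ev_cd {m : ℕ} {φ : Eu m → ℝ} {x : Eu m} (h : ContDiffAt ℝ 2 φ x) :
    ∀ᶠ y in 𝓝 x, DifferentiableAt ℝ φ y := by
  filter_upwards [h.eventually (by norm_num)] with y hy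
  exact hy.differentiableAt (by norm_num)

lemma pd_mul {m : ℕ} {φ ψ : Eu m → ℝ} {x : Eu m} (h : DifferentiableAt ℝ φ x)
    (h' : DifferentiableAt ℝ ψ x) (i : Fin m) :
    pd i (fun y => φ y * ψ y) x = φ x * pd i ψ x + ψ x * pd i φ x := by
  unfold pd
  rw [fderiv_fun_mul h h']
  simp

lemma pd_add {m : ℕ} {φ ψ : Eu m → ℝ} {x : Eu m} (h : DifferentiableAt ℝ φ x)
    (h' : DifferentiableAt ℝ ψ x) (i : Fin m) :
    pd i (fun y => φ y + ψ y) x = pd i φ x + pd i ψ x := by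
  unfold pd
  rw [fderiv_fun_add h h']
  simp

lemma pd_sub {m : ℕ} {φ ψ : Eu m → ℝ} {x : Eu m} (h : DifferentiableAt ℝ φ x)
    (h' : DifferentiableAt ℝ ψ x) (i : Fin m) :
    pd i (fun y => φ y - ψ y) x = pd i φ x - pd i ψ x := by
  unfold pd
  rw [fderiv_fun_sub h h']
  simp

lemma pd_sum {m : ℕ} {ι : Type*} {s : Finset ι} {φ : ι → Eu m → ℝ} {x : Eu m}
    (h : ∀ k ∈ s, DifferentiableAt ℝ (φ k) x) (i : Fin m) :
    pd i (fun y => ∑ k ∈ s, φ k y) x = ∑ k ∈ s, pd i (φ k) x := by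
  unfold pd
  rw [fderiv_fun_sum h]
  simp

lemma pd_comp {m : ℕ} {φ : Eu m → ℝ} {g : ℝ → ℝ} {x : Eu m} {g' : ℝ} (h : DifferentiableAt ℝ φ x)
    (hg : HasDerivAt g g' (φ x)) (i : Fin m) :
    pd i (fun y => g (φ y)) x = g' * pd i φ x := by
  unfold pd
  have := (hg.comp_hasFDerivAt x h.hasFDerivAt).fderiv
  rw [show (fun y => g (φ y)) = g ∘ φ from rfl, this]
  simp

lemma lap_add {m : ℕ} {φ ψ : Eu m → ℝ} {x : Eu m} (h : ContDiffAt ℝ 2 φ x)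
    (h' : ContDiffAt ℝ 2 ψ x) : lap (fun y => φ y + ψ y) x = lap φ x + lap ψ x := by
  rw [lap_eq_pd h, lap_eq_pd h', lap_eq_pd (h.add h'), ← Finset.sum_add_distrib]
  refine Finset.sum_congr rfl fun i _ => ?_
  rw [← pd_add (pd_differentiableAt h i) (pd_differentiableAt h' i)]
  refine (pd_congr ?_ i).eq_of_nhds
  filter_upwards [ev_cd h, ev_cd h'] with y hy hy'
  exact pd_add hy hy' i

lemma lap_sub {m : ℕ} {φ ψ : Eu m → ℝ} {x : Eu m} (h : ContDiffAt ℝ 2 φ x)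
    (h' : ContDiffAt ℝ 2 ψ x) : lap (fun y => φ y - ψ y) x = lap φ x - lap ψ x := by
  rw [lap_eq_pd h, lap_eq_pd h', lap_eq_pd (h.sub h'), ← Finset.sum_sub_distrib]
  refine Finset.sum_congr rfl fun i _ => ?_
  rw [← pd_sub (pd_differentiableAt h i) (pd_differentiableAt h' i)]
  refine (pd_congr ?_ i).eq_of_nhds
  filter_upwards [ev_cd h, ev_cd h'] with y hy hy'
  exact pd_sub hy hy' i

lemma lap_const {m : ℕ} (c : ℝ) (x : Eu m) : lap (fun _ : Eu m => c) x = 0 := by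
  rw [lap_eq]
  simp

lemma lap_mul {m : ℕ} {φ ψ : Eu m → ℝ} {x : Eu m} (h : ContDiffAt ℝ 2 φ x)
    (h' : ContDiffAt ℝ 2 ψ x) :
    lap (fun y => φ y * ψ y) x
      = φ x * lap ψ x + ψ x * lap φ x + 2 * ∑ i, pd i φ x * pd i ψ x := by
  rw [lap_eq_pd h, lap_eq_pd h', lap_eq_pd (h.mul h'), Finset.mul_sum, Finset.mul_sum,
    Finset.mul_sum, ← Finset.sum_add_distrib, ← Finset.sum_add_distrib]
  refine Finset.sum_congr rfl fun i _ => ?_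
  have h0 : pd i (fun y => φ y * ψ y) =ᶠ[𝓝 x] fun y => φ y * pd i ψ y + ψ y * pd i φ y := by
    filter_upwards [ev_cd h, ev_cd h'] with y hy hy'
    exact pd_mul hy hy' i
  have d1 := h.differentiableAt (by norm_num)
  have d2 := h'.differentiableAt (by norm_num)
  rw [(pd_congr h0 i).eq_of_nhds, pd_add (φ := fun y => φ y * pd i ψ y)
    (ψ := fun y => ψ y * pd i φ y) (d1.mul (pd_differentiableAt h' i))
    (d2.mul (pd_differentiableAt h i)), pd_mul d1 (pd_differentiableAt h' i),
    pd_mul d2 (pd_differentiableAt h i)]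
  ring

lemma lap_comp {m : ℕ} {φ : Eu m → ℝ} {g g' : ℝ → ℝ} {x : Eu m} {g'' : ℝ}
    (h : ContDiffAt ℝ 2 φ x) (hc : ContDiffAt ℝ 2 g (φ x))
    (hg : ∀ᶠ t in 𝓝 (φ x), HasDerivAt g (g' t) t)
    (hg' : HasDerivAt g' g'' (φ x)) :
    lap (fun y => g (φ y)) x = g' (φ x) * lap φ x + g'' * ∑ i, (pd i φ x) ^ 2 := by
  have hcd : ContDiffAt ℝ 2 (fun y => g (φ y)) x := hc.comp x h
  rw [lap_eq_pd h, lap_eq_pd hcd, Finset.mul_sum, Finset.mul_sum, ← Finset.sum_add_distrib]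
  refine Finset.sum_congr rfl fun i _ => ?_
  have d1 := h.differentiableAt (by norm_num)
  have h0 : pd i (fun y => g (φ y)) =ᶠ[𝓝 x] fun y => g' (φ y) * pd i φ y := by
    filter_upwards [ev_cd h, d1.continuousAt.eventually hg] with y hy hy'
    exact pd_comp hy hy' i
  rw [(pd_congr h0 i).eq_of_nhds, pd_mul (φ := fun y => g' (φ y)) (hg'.differentiableAt.comp x d1) (pd_differentiableAt h i),
    pd_comp d1 hg' i]
  ring

/-- second order condition at a local maximum -/
lemma lap_nonpos {m : ℕ} {φ : Eu m → ℝ} {x : Eu m} (h : ContDiffAt ℝ 2 φ x)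
    (hmax : IsLocalMax φ x) : lap φ x ≤ 0 := by
  rw [lap_eq_pd h]
  refine Finset.sum_nonpos fun i _ => ?_
  by_contra hpos
  push Not at hpos
  set g : ℝ → ℝ := fun t => φ (x + t • ev i) with hg
  have hl : ContinuousAt (fun t : ℝ => x + t • ev i) 0 := by fun_prop
  have hl' : Tendsto (fun t : ℝ => x + t • ev i) (𝓝 0) (𝓝 x) := by
    have := hl.tendsto; simpa using this
  have hline : ∀ t : ℝ, HasDerivAt (fun t : ℝ => x + t • ev i) (ev i) t := by
    intro t
    have := ((hasDerivAt_id t).smul_const (ev i)).const_add x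
    simpa using this
  have hd : ∀ᶠ t in 𝓝 (0 : ℝ), HasDerivAt g (pd i φ (x + t • ev i)) t := by
    filter_upwards [hl'.eventually (ev_cd h)] with t ht
    exact ht.hasFDerivAt.comp_hasDerivAt t (hline t)
  have hd1 : deriv g =ᶠ[𝓝 0] fun t => pd i φ (x + t • ev i) := by
    filter_upwards [hd] with t ht using ht.deriv
  have hdd : deriv (deriv g) 0 = pd i (pd i φ) x := by
    rw [hd1.deriv_eq]
    have h2 : DifferentiableAt ℝ (pd i φ) (x + (0 : ℝ) • ev i) := by
      simpa using pd_differentiableAt h i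
    have := (h2.hasFDerivAt.comp_hasDerivAt (0 : ℝ) (hline 0)).deriv
    simp only [zero_smul, add_zero] at this
    exact this
  have hm : IsLocalMax g 0 := by
    have h1 : ∀ᶠ y in 𝓝 x, φ y ≤ φ x := hmax
    have : ∀ᶠ t in 𝓝 (0 : ℝ), g t ≤ g 0 := by
      filter_upwards [hl'.eventually h1] with t ht
      simpa [hg] using ht
    exact this
  have hmin : IsLocalMin g 0 := by
    refine isLocalMin_of_deriv_deriv_pos (by rw [hdd]; exact hpos) hm.deriv_eq_zero ?_
    exact hd.self_of_nhds.continuousAt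
  have hconst : g =ᶠ[𝓝 0] fun _ => g 0 := by
    have a : ∀ᶠ t in 𝓝 (0 : ℝ), g t ≤ g 0 := hm
    have b : ∀ᶠ t in 𝓝 (0 : ℝ), g 0 ≤ g t := hmin
    filter_upwards [a, b] with t h1 h2 using le_antisymm h1 h2
  have : deriv (deriv g) 0 = 0 := by
    rw [(hconst.deriv).deriv_eq]
    simp
  rw [hdd] at this
  exact hpos.ne' this

lemma fderiv_zero_of_max {m : ℕ} {φ : Eu m → ℝ} {x : Eu m} (hmax : IsLocalMax φ x) :
    fderiv ℝ φ x = 0 := hmax.fderiv_eq_zero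

lemma cont_lap {m : ℕ} {φ : Eu m → ℝ} (h : ContDiff ℝ 2 φ) : Continuous (lap φ) := by
  have h1 : ContDiff ℝ 1 (fderiv ℝ φ) := h.fderiv_right (by norm_num)
  have h2 : Continuous (fderiv ℝ (fderiv ℝ φ)) := h1.continuous_fderiv (by norm_num)
  have : lap φ = fun y => ∑ i, fderiv ℝ (fderiv ℝ φ) y (ev i) (ev i) := funext (lap_eq φ)
  rw [this]
  fun_prop

lemma pd_contDiff {m : ℕ} {φ : Eu m → ℝ} (h : ContDiff ℝ 2 φ) (i : Fin m) :
    ContDiff ℝ 1 (pd i φ) := by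
  have h1 : ContDiff ℝ 1 (fderiv ℝ φ) := h.fderiv_right (by norm_num)
  exact h1.clm_apply contDiff_const

/-- the function `|x|^2` -/
lemma pd_normsq {m : ℕ} (c x : Eu m) (i : Fin m) :
    pd i (fun y => ‖y - c‖ ^ 2) x = 2 * (x i - c i) := by
  unfold pd
  have h : HasFDerivAt (fun y : Eu m => ‖y - c‖ ^ 2) _ x :=
    ((hasFDerivAt_id x).sub_const c).norm_sq
  rw [h.fderiv]
  simp [ev, EuclideanSpace.inner_single_right]

lemma contDiff_normsq {m : ℕ} (c : Eu m) {n : WithTop ℕ∞} :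
    ContDiff ℝ n (fun y : Eu m => ‖y - c‖ ^ 2) :=
  (contDiff_id.sub contDiff_const).norm_sq ℝ

lemma lap_normsq {m : ℕ} (c x : Eu m) : lap (fun y => ‖y - c‖ ^ 2) x = 2 * m := by
  rw [lap_eq_pd (contDiff_normsq c).contDiffAt]
  have : ∀ i : Fin m, pd i (pd i (fun y => ‖y - c‖ ^ 2)) x = 2 := by
    intro i
    have h0 : pd i (fun y => ‖y - c‖ ^ 2) = fun x : Eu m => 2 * (x i - c i) :=
      funext fun x => pd_normsq c x i
    rw [h0]
    unfold pd
    have h : HasFDerivAt (fun x : Eu m => 2 * (x i - c i))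
        ((2 : ℝ) • (EuclideanSpace.proj i : Eu m →L[ℝ] ℝ)) x :=
      (((EuclideanSpace.proj i : Eu m →L[ℝ] ℝ).hasFDerivAt).sub_const (c i)).const_mul 2
    rw [h.fderiv]
    simp [ev]
  simp [this, mul_comm]

lemma sum_pd_normsq {m : ℕ} (c x : Eu m) :
    ∑ i, (pd i (fun y => ‖y - c‖ ^ 2) x) ^ 2 = 4 * ‖x - c‖ ^ 2 := by
  rw [EuclideanSpace.norm_sq_eq, Finset.mul_sum]
  refine Finset.sum_congr rfl fun i _ => ?_
  rw [pd_normsq]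
  simp
  ring

end EP

open Filter Topology MeasureTheory
namespace EP

set_option linter.unusedSectionVars false
section kernels
variable {m : ℕ} {F : Type*} [NormedAddCommGroup F] [NormedSpace ℝ F]

structure Ker (κ : Eu m → F) : Prop where
  cont : Continuous κ
  supp : ∀ z, 1 < ‖z‖ → κ z = 0

lemma Ker.hcs {κ : Eu m → F} (h : Ker κ) : HasCompactSupport κ := by
  refine HasCompactSupport.intro (isCompact_closedBall (0 : Eu m) 1) fun z hz => h.supp z ?_
  simpa using hz

lemma Ker.integrable {κ : Eu m → F} (h : Ker κ) : Integrable κ :=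
  h.cont.integrable_of_hasCompactSupport h.hcs

lemma Ker.integrable_smul {κ : Eu m → F} (h : Ker κ) {q : Eu m → ℝ} (hq : Continuous q)
    (s : ℝ) (x : Eu m) : Integrable (fun z => q (x + s • z) • κ z) := by
  refine Continuous.integrable_of_hasCompactSupport ?_ ?_
  · have := h.cont
    fun_prop
  · exact h.hcs.smul_left

lemma Ker.fderiv {κ : Eu m → F} (h : Ker κ) (h1 : ContDiff ℝ 1 κ) : Ker (fderiv ℝ κ) := by
  refine ⟨h1.continuous_fderiv (by norm_num), fun z hz => ?_⟩
  have : κ =ᶠ[𝓝 z] fun _ => 0 := by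
    have ho : IsOpen {w : Eu m | 1 < ‖w‖} := isOpen_lt continuous_const continuous_norm
    filter_upwards [ho.mem_nhds hz] with w hw using h.supp w hw
  rw [this.fderiv_eq]
  simp

noncomputable def P (κ : Eu m → F) (s : ℝ) (q : Eu m → ℝ) (x : Eu m) : F :=
  ∫ z, q (x + s • z) • κ z

noncomputable def nrm (κ : Eu m → F) : ℝ := ∫ z, ‖κ z‖

lemma nrm_nonneg (κ : Eu m → F) : 0 ≤ nrm κ := integral_nonneg fun _ => norm_nonneg _

lemma P_norm_le {κ : Eu m → F} (h : Ker κ) {s M : ℝ} {q : Eu m → ℝ} {x : Eu m}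
    (hM : ∀ z, ‖z‖ ≤ 1 → |q (x + s • z)| ≤ M) : ‖P κ s q x‖ ≤ M * nrm κ := by
  unfold P nrm
  rw [← integral_const_mul]
  refine norm_integral_le_of_norm_le (h.integrable.norm.const_mul M) (Eventually.of_forall ?_)
  intro z
  rw [norm_smul, Real.norm_eq_abs]
  by_cases hz : ‖z‖ ≤ 1
  · gcongr
    exact hM z hz
  · rw [h.supp z (not_le.1 hz)]
    simp

lemma P_eq_set {κ : Eu m → F} (h : Ker κ) (s : ℝ) (q : Eu m → ℝ) (x : Eu m) :
    P κ s q x = ∫ z in Metric.closedBall (0 : Eu m) 1, q (x + s • z) • κ z := by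
  unfold P
  rw [setIntegral_eq_integral_of_forall_compl_eq_zero]
  intro z hz
  rw [h.supp z (by simpa using hz), smul_zero]

lemma P_cont {κ : Eu m → F} (h : Ker κ) {q : Eu m → ℝ} (hq : Continuous q) :
    Continuous (fun p : ℝ × Eu m => P κ p.1 q p.2) := by
  have : (fun p : ℝ × Eu m => P κ p.1 q p.2) =
      fun p : ℝ × Eu m => ∫ z in Metric.closedBall (0 : Eu m) 1, q (p.2 + p.1 • z) • κ z :=
    funext fun p => P_eq_set h _ _ _
  rw [this]
  have hc := h.cont
  refine continuous_parametric_integral_of_continuous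
    (f := fun (p : ℝ × Eu m) z => q (p.2 + p.1 • z) • κ z) ?_ (isCompact_closedBall _ _)
  unfold Function.uncurry
  fun_prop

lemma P_sub {κ : Eu m → F} (h : Ker κ) {q q' : Eu m → ℝ} (hq : Continuous q) (hq' : Continuous q')
    (s : ℝ) (x : Eu m) : P κ s (fun y => q y - q' y) x = P κ s q x - P κ s q' x := by
  unfold P
  rw [← integral_sub (h.integrable_smul hq s x) (h.integrable_smul hq' s x)]
  simp [sub_smul]

lemma P_mean0 {κ : Eu m → F} (h : Ker κ) (h0 : ∫ z, κ z = 0) {q : Eu m → ℝ} (hq : Continuous q)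
    (s : ℝ) (x : Eu m) : P κ s q x = P κ s (fun y => q y - q x) x := by
  rw [P_sub h hq continuous_const]
  have : P κ s (fun _ => q x) x = 0 := by
    unfold P
    rw [integral_smul, h0, smul_zero]
  rw [this, sub_zero]

lemma P_zero (κ : Eu m → F) (q : Eu m → ℝ) (x : Eu m) : P κ 0 q x = q x • ∫ z, κ z := by
  unfold P
  simp [integral_smul]

lemma P_subst (κ : Eu m → F) {s : ℝ} (hs : 0 < s) (q : Eu m → ℝ) (x : Eu m) :
    P κ s q x = (s ^ m)⁻¹ • ∫ t, q t • κ (s⁻¹ • (t - x)) := by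
  have h1 : ∫ t, q t • κ (s⁻¹ • (t - x)) = ∫ y, q (x + y) • κ (s⁻¹ • y) := by
    rw [← integral_add_left_eq_self _ x]
    simp
  have h2 := Measure.integral_comp_smul (volume : Measure (Eu m))
    (fun y => q (x + y) • κ (s⁻¹ • y)) s
  rw [h1]
  unfold P
  simp only [finrank_euclideanSpace, Fintype.card_fin] at h2
  rw [abs_of_pos (by positivity)] at h2
  rw [← h2]
  simp only [smul_smul, inv_mul_cancel₀ hs.ne', one_smul]

lemma P_hasFDerivAt [CompleteSpace F] {κ : Eu m → F} (h : Ker κ) (h1 : ContDiff ℝ 1 κ)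
    {q : Eu m → ℝ} (hq : Continuous q)
    {s : ℝ} (hs : 0 < s) (x : Eu m) :
    HasFDerivAt (P κ s q) (-(s⁻¹) • P (fderiv ℝ κ) s q x) x := by
  set g : Eu m → F := fun w => κ (-(s⁻¹) • w) with hg
  have hgc : ContDiff ℝ 1 g := h1.comp (contDiff_id.const_smul (-(s⁻¹)))
  have hgs : HasCompactSupport g := by
    have := h.hcs.comp_homeomorph (Homeomorph.smulOfNeZero (α := Eu m) (-(s⁻¹)) (by
      simpa using hs.ne'))
    exact this
  have hgd : ∀ w, fderiv ℝ g w = -(s⁻¹) • fderiv ℝ κ (-(s⁻¹) • w) := by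
    intro w
    have e := ((h1.differentiable (by norm_num) (-(s⁻¹) • w)).hasFDerivAt.comp w
      ((hasFDerivAt_id w).const_smul (-(s⁻¹)))).fderiv
    have e2 : fderiv ℝ g w = fderiv ℝ κ (-s⁻¹ • w) ∘SL (-s⁻¹ • ContinuousLinearMap.id ℝ (Eu m)) := e
    rw [e2]
    ext v
    simp
  have key := hgs.hasFDerivAt_convolution_right (ContinuousLinearMap.lsmul ℝ ℝ)
    (μ := (volume : Measure (Eu m))) hq.locallyIntegrable hgc x
  have e1 : P κ s q = fun x => (s ^ m)⁻¹ • (convolution q g (ContinuousLinearMap.lsmul ℝ ℝ) volume) x := by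
    funext y
    rw [P_subst κ hs]
    unfold convolution
    congr 2
    funext t
    simp only [ContinuousLinearMap.lsmul_apply, hg]
    congr 2
    rw [neg_smul, ← smul_neg, neg_sub]
  rw [e1]
  refine (key.const_smul _).congr_fderiv ?_
  rw [P_subst _ hs]
  unfold convolution
  rw [smul_comm (-s⁻¹)]
  congr 1
  rw [← integral_smul]
  congr 1
  funext t
  rw [hgd]
  have e9 : -(s⁻¹) • (x - t) = s⁻¹ • (t - x) := by rw [neg_smul, ← smul_neg, neg_sub]
  rw [e9]
  ext v
  change q t • (-(s⁻¹) • fderiv ℝ κ (s⁻¹ • (t - x)) v) = _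
  rw [smul_comm]
  rfl

lemma integral_fderiv_zero [CompleteSpace F] {κ : Eu m → F} (h : Ker κ) (h1 : ContDiff ℝ 1 κ) :
    ∫ z, fderiv ℝ κ z = 0 := by
  have a := P_hasFDerivAt h h1 (q := fun _ => 1) continuous_const one_pos 0
  have e : P κ 1 (fun _ => 1) = fun _ => ∫ z, κ z := by
    funext x
    simp [P]
  rw [e] at a
  have := a.unique (hasFDerivAt_const _ _)
  simpa [P] using this

lemma P_ibp {κ : Eu m → ℝ} (h : Ker κ) (h1 : ContDiff ℝ 1 κ) {v : Eu m → ℝ} (hv : ContDiff ℝ 1 v)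
    (s : ℝ) (x e : Eu m) :
    P (fun z => fderiv ℝ κ z e) s v x = -s * P κ s (fun y => fderiv ℝ v y e) x := by
  have hvd : Continuous (fderiv ℝ v) := hv.continuous_fderiv (by norm_num)
  have hκd := (h.fderiv h1)
  have hd : ∀ z, HasFDerivAt (fun z => v (x + s • z)) (s • fderiv ℝ v (x + s • z)) z := by
    intro z
    have e1 : HasFDerivAt (fun z : Eu m => x + s • z) (s • ContinuousLinearMap.id ℝ (Eu m)) z :=
      ((hasFDerivAt_id z).const_smul s).const_add x
    refine ((hv.differentiable (by norm_num) (x + s • z)).hasFDerivAt.comp z e1).congr_fderiv ?_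
    ext w
    simp
  have hk : Ker (fun z => fderiv ℝ κ z e) :=
    ⟨hκd.cont.clm_apply continuous_const, fun z hz => by simp [hκd.supp z hz]⟩
  have := integral_mul_fderiv_eq_neg_fderiv_mul_of_integrable (μ := (volume : Measure (Eu m)))
    (f := fun z => v (x + s • z)) (g := κ) (v := e) ?_ ?_ ?_ ?_ ?_
  · unfold P
    simp only [smul_eq_mul]
    rw [this, ← integral_const_mul, ← integral_neg]
    congr 1
    funext z
    rw [(hd z).fderiv]
    simp
    ring
  · have : Integrable (fun z => (fun y => s * fderiv ℝ v y e) (x + s • z) • κ z) :=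
      h.integrable_smul (q := fun y => s * fderiv ℝ v y e) (by fun_prop) s x
    refine this.congr (Eventually.of_forall fun z => ?_)
    simp [(hd z).fderiv]
  · exact hk.integrable_smul hv.continuous s x
  · exact h.integrable_smul hv.continuous s x
  · exact fun z _ => (hd z).differentiableAt
  · exact fun z _ => h1.differentiable (by norm_num) z

lemma P_hasDerivAt_s {κ : Eu m → ℝ} (h : Ker κ) (h1 : ContDiff ℝ 1 κ)
    {q : Eu m → ℝ} (hq : Continuous q)
    {s : ℝ} (hs : 0 < s) (x : Eu m) :
    HasDerivAt (fun s => P κ s q x)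
      (s⁻¹ * P (fun z => -(m * κ z + fderiv ℝ κ z z)) s q x) s := by
  set I : ℝ → ℝ := fun s => ∫ t, q t * κ (s⁻¹ • (t - x)) with hI
  have hκd := (h.fderiv h1)
  have hcd := hκd.cont
  set I' : ℝ → Eu m → ℝ := fun s t => q t * (fderiv ℝ κ (s⁻¹ • (t - x)) (-(s⁻¹) • (s⁻¹ • (t - x))))
    with hI'
  obtain ⟨C, hC⟩ := hκd.hcs.exists_bound_of_continuous hκd.cont
  have hC0 : 0 ≤ C := (norm_nonneg _).trans (hC 0)
  obtain ⟨M, hM⟩ := (isCompact_closedBall x (2 * s)).exists_bound_of_continuousOn hq.continuousOn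
  have hM0 : 0 ≤ M := (norm_nonneg _).trans (hM x (by simp; positivity))
  have hscale : ∀ s' : ℝ, 0 < s' → ∀ t, s' < ‖t - x‖ → 1 < ‖s'⁻¹ • (t - x)‖ := by
    intro s' hs' t ht
    rw [norm_smul, norm_inv, Real.norm_eq_abs, abs_of_pos hs', ← div_eq_inv_mul, lt_div_iff₀ hs']
    simpa using ht
  have hIntg : ∀ {ψ : Eu m → ℝ}, Ker ψ → ∀ s' : ℝ, 0 < s' →
      Integrable (fun t => q t * ψ (s'⁻¹ • (t - x))) := by
    intro ψ hψ s' hs'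
    have := hψ.cont
    refine Continuous.integrable_of_hasCompactSupport (by fun_prop) ?_
    refine HasCompactSupport.intro (isCompact_closedBall x s') fun t ht => ?_
    rw [hψ.supp _ (hscale s' hs' t (by simpa [dist_eq_norm] using ht)), mul_zero]
  have hK' : Ker (fun z => fderiv ℝ κ z (-(s⁻¹) • z)) :=
    ⟨hκd.cont.clm_apply (by fun_prop), fun z hz => by simp [hκd.supp z hz]⟩
  have key : HasDerivAt I (∫ t, I' s t) s := by
    have hball : Metric.ball s (s / 2) ∈ 𝓝 s := Metric.ball_mem_nhds _ (by positivity)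
    refine (hasDerivAt_integral_of_dominated_loc_of_deriv_le (μ := (volume : Measure (Eu m)))
      (F := fun s t => q t * κ (s⁻¹ • (t - x))) (F' := I')
      (bound := (Metric.closedBall x (2 * s)).indicator fun _ => M * (C * (2 / s))) hball
      ?_ (hIntg h s hs) (hIntg hK' s hs).aestronglyMeasurable ?_ ?_ ?_).2
    · filter_upwards [lt_mem_nhds hs] with s' hs' using (hIntg h s' hs').aestronglyMeasurable
    · refine Eventually.of_forall fun t s' hs' => ?_
      rw [Metric.mem_ball, Real.dist_eq, abs_lt] at hs'
      have hs0 : s / 2 < s' := by linarith [hs'.1]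
      have hs0' : 0 < s' := by linarith
      have hs2 : s' < 2 * s := by linarith [hs'.2]
      by_cases ht : t ∈ Metric.closedBall x (2 * s)
      · rw [Set.indicator_of_mem ht]
        simp only [hI']
        rw [norm_mul]
        refine mul_le_mul (hM t ht) ?_ (norm_nonneg _) hM0
        by_cases hz : 1 < ‖s'⁻¹ • (t - x)‖
        · rw [hκd.supp _ hz]
          simp
          positivity
        · refine (ContinuousLinearMap.le_opNorm _ _).trans ?_
          refine mul_le_mul (hC _) ?_ (norm_nonneg _) hC0
          rw [norm_smul, norm_neg, norm_inv, Real.norm_eq_abs, abs_of_pos hs0']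
          have : s'⁻¹ ≤ 2 / s := by
            rw [inv_le_comm₀ hs0' (by positivity)]
            simpa using hs0.le
          calc s'⁻¹ * ‖s'⁻¹ • (t - x)‖ ≤ (2 / s) * 1 := by
                gcongr
                exact not_lt.1 hz
            _ = 2 / s := mul_one _
      · rw [Set.indicator_of_notMem ht]
        have : 1 < ‖s'⁻¹ • (t - x)‖ := by
          refine hscale s' hs0' t ?_
          rw [Metric.mem_closedBall, dist_eq_norm, not_le] at ht
          linarith
        simp [hI', hκd.supp _ this]
    · exact (integrableOn_const (isCompact_closedBall x (2 * s)).measure_ne_top).integrable_indicator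
        measurableSet_closedBall
    · refine Eventually.of_forall fun t s' hs' => ?_
      rw [Metric.mem_ball, Real.dist_eq, abs_lt] at hs'
      have hs0' : s' ≠ 0 := by
        have : 0 < s' := by linarith [hs'.1]
        exact this.ne'
      have d1 : HasDerivAt (fun s : ℝ => s⁻¹ • (t - x)) (-(s'⁻¹) • (s'⁻¹ • (t - x))) s' := by
        refine ((hasDerivAt_inv hs0').smul_const (t - x)).congr_deriv ?_
        rw [smul_smul]
        congr 1
        field_simp
      exact ((h1.differentiable (by norm_num) _).hasFDerivAt.comp_hasDerivAt s' d1).const_mul (q t)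
  have e1 : (fun s => P κ s q x) =ᶠ[𝓝 s] fun s => (s ^ m)⁻¹ * I s := by
    filter_upwards [lt_mem_nhds hs] with s' hs'
    rw [P_subst κ hs']
    simp [hI]
  refine HasDerivAt.congr_of_eventuallyEq ?_ e1
  have hsm : s ^ m ≠ 0 := by positivity
  refine (((hasDerivAt_pow m s).inv hsm).mul key).congr_deriv ?_
  have hk1 := h.integrable_smul hq s x
  have hk3 : Ker (fun z => fderiv ℝ κ z z) :=
    ⟨hκd.cont.clm_apply continuous_id, fun z hz => by simp [hκd.supp z hz]⟩
  have hk2 := hk3.integrable_smul hq s x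
  have e2 : (s ^ m)⁻¹ * I s = P κ s q x := by
    rw [P_subst κ hs]
    simp [hI]
  have e3 : (s ^ m)⁻¹ * ∫ t, I' s t = -(s⁻¹) * P (fun z => fderiv ℝ κ z z) s q x := by
    rw [P_subst _ hs, smul_eq_mul, mul_left_comm]
    congr 1
    rw [← integral_const_mul]
    congr 1
    funext t
    simp only [hI', ContinuousLinearMap.map_smul, smul_eq_mul]
    ring
  have e4 : P (fun z => -(m * κ z + fderiv ℝ κ z z)) s q x
      = -(m * P κ s q x + P (fun z => fderiv ℝ κ z z) s q x) := by
    unfold P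
    rw [← integral_const_mul, ← integral_add (hk1.const_mul _) hk2, ← integral_neg]
    congr 1
    funext z
    simp only [smul_eq_mul]
    ring
  have e5 : (fun x : ℝ => x ^ m)⁻¹ s = (s ^ m)⁻¹ := rfl
  rw [e5, e3, e4, ← e2]
  rcases m with _ | k
  · simp
  · field_simp
    push_cast
    ring_nf
    try simp
    try ring

end kernels
end EP

open Filter Topology MeasureTheory
namespace EP
set_option linter.unusedSectionVars false

section ops
variable {m : ℕ} {F : Type*} [NormedAddCommGroup F] [NormedSpace ℝ F]

lemma dom_int {f : ℝ → F} (hf : ContinuousOn f (Set.Ioi 0)) {R C e : ℝ} (hR : 0 < R)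
    (he : -1 < e) (hb : ∀ s ∈ Set.Ioc 0 R, ‖f s‖ ≤ C * s ^ e) :
    IntervalIntegrable f volume 0 R ∧ ‖∫ s in (0:ℝ)..R, f s‖ ≤ C * (R ^ (e + 1) / (e + 1)) := by
  have hbi : IntervalIntegrable (fun s : ℝ => C * s ^ e) volume 0 R :=
    (intervalIntegral.intervalIntegrable_rpow' he).const_mul C
  have hm : AEStronglyMeasurable f (volume.restrict (Set.uIoc 0 R)) := by
    rw [Set.uIoc_of_le hR.le]
    exact (hf.mono fun s hs => hs.1).aestronglyMeasurable measurableSet_Ioc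
  refine ⟨hbi.mono_fun hm ?_, ?_⟩
  · rw [Set.uIoc_of_le hR.le]
    refine (ae_restrict_iff' measurableSet_Ioc).2 (Eventually.of_forall fun s hs => ?_)
    exact (hb s hs).trans (le_abs_self _)
  · refine (intervalIntegral.norm_integral_le_of_norm_le hR.le
      (Eventually.of_forall hb) hbi).trans (le_of_eq ?_)
    rw [intervalIntegral.integral_const_mul, integral_rpow (Or.inl he),
      Real.zero_rpow (by linarith)]
    simp

noncomputable def A (w : ℝ → ℝ) (κ : Eu m → F) (R : ℝ) (q : Eu m → ℝ) (x : Eu m) : F :=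
  ∫ s in (0:ℝ)..R, w s • P κ s q x

lemma P_cont_s {κ : Eu m → F} (h : Ker κ) {q : Eu m → ℝ} (hq : Continuous q) (x : Eu m) :
    Continuous (fun s => P κ s q x) :=
  (P_cont h hq).comp (continuous_id.prodMk continuous_const)

lemma wP_cont {w : ℝ → ℝ} (hw : ContinuousOn w (Set.Ioi 0)) {κ : Eu m → F} (h : Ker κ)
    {q : Eu m → ℝ} (hq : Continuous q) (x : Eu m) :
    ContinuousOn (fun s => w s • P κ s q x) (Set.Ioi 0) :=
  hw.smul (P_cont_s h hq x).continuousOn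

lemma A_fderiv [CompleteSpace F] {w : ℝ → ℝ} (hw : ContinuousOn w (Set.Ioi 0)) {κ : Eu m → F}
    (h : Ker κ) (h1 : ContDiff ℝ 1 κ) {q : Eu m → ℝ} (hq : Continuous q) {R : ℝ} (hR : 0 < R)
    (x : Eu m) {C0 e0 C e : ℝ} (he0 : -1 < e0) (he : -1 < e)
    (h0 : ∀ s ∈ Set.Ioc 0 R, ‖w s • P κ s q x‖ ≤ C0 * s ^ e0)
    (hd : ∀ y ∈ Metric.ball x 1, ∀ s ∈ Set.Ioc 0 R,
      ‖(-(s⁻¹ * w s)) • P (fderiv ℝ κ) s q y‖ ≤ C * s ^ e) :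
    HasFDerivAt (A w κ R q) (A (fun s => -(s⁻¹ * w s)) (fderiv ℝ κ) R q x) x := by
  have hw' : ContinuousOn (fun s => -(s⁻¹ * w s)) (Set.Ioi 0) :=
    ((continuousOn_id.inv₀ fun s hs => (ne_of_gt hs)).mul hw).neg
  refine intervalIntegral.hasFDerivAt_integral_of_dominated_of_fderiv_le
    (F := fun y s => w s • P κ s q y) (F' := fun y s => (-(s⁻¹ * w s)) • P (fderiv ℝ κ) s q y)
    (bound := fun s => C * s ^ e) (Metric.ball_mem_nhds x one_pos) ?_ ?_ ?_ ?_ ?_ ?_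
  · refine Eventually.of_forall fun y => ?_
    rw [Set.uIoc_of_le hR.le]
    exact ((wP_cont hw h hq y).mono fun s hs => hs.1).aestronglyMeasurable measurableSet_Ioc
  · exact (dom_int (wP_cont hw h hq x) hR he0 h0).1
  · exact (dom_int (wP_cont hw' (h.fderiv h1) hq x) hR he
      (hd x (Metric.mem_ball_self one_pos))).1.aestronglyMeasurable_restrict_uIoc
  · refine Eventually.of_forall fun s hs y hy => ?_
    rw [Set.uIoc_of_le hR.le] at hs
    exact hd y hy s hs
  · exact (intervalIntegral.intervalIntegrable_rpow' he).const_mul C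
  · refine Eventually.of_forall fun s hs y hy => ?_
    rw [Set.uIoc_of_le hR.le] at hs
    refine ((P_hasFDerivAt h h1 hq hs.1 y).const_smul (w s)).congr_fderiv ?_
    rw [smul_smul]
    congr 1
    ring

/-- local Hölder-1/2 -/
def LH (q : Eu m → ℝ) : Prop :=
  ∀ r : ℝ, ∃ C, 0 ≤ C ∧ ∀ x y, ‖x‖ ≤ r → ‖y‖ ≤ r → |q x - q y| ≤ C * ‖x - y‖ ^ (1/2 : ℝ)

lemma LH.continuous {q : Eu m → ℝ} (h : LH q) : Continuous q := by
  rw [continuous_iff_continuousAt]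
  intro x
  obtain ⟨C, hC, hh⟩ := h (‖x‖ + 1)
  rw [ContinuousAt, tendsto_iff_norm_sub_tendsto_zero]
  have : Tendsto (fun y => C * ‖y - x‖ ^ (1/2 : ℝ)) (𝓝 x) (𝓝 0) := by
    have : Continuous (fun y => C * ‖y - x‖ ^ (1/2 : ℝ)) :=
      continuous_const.mul ((continuous_id.sub continuous_const).norm.rpow_const
        fun _ => Or.inr (by norm_num))
    have h2 := this.tendsto x
    simpa using h2
  refine squeeze_zero' (Eventually.of_forall fun _ => norm_nonneg _) ?_ this
  filter_upwards [Metric.ball_mem_nhds x one_pos] with y hy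
  refine hh y x ?_ (by linarith)
  have := norm_le_norm_add_norm_sub' y x
  rw [Metric.mem_ball, dist_eq_norm] at hy
  linarith

lemma P_bd0 {κ : Eu m → F} (h : Ker κ) {s R M : ℝ} (hs : s ∈ Set.Ioc 0 R) {q : Eu m → ℝ}
    {x : Eu m} (hM : ∀ z ∈ Metric.closedBall x R, |q z| ≤ M) : ‖P κ s q x‖ ≤ M * nrm κ := by
  refine P_norm_le h fun z hz => hM _ ?_
  simp only [Metric.mem_closedBall, dist_self_add_left, norm_smul, Real.norm_eq_abs, abs_of_pos hs.1]
  nlinarith [hs.1, hs.2, norm_nonneg z]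

lemma P_bdH {κ : Eu m → F} (h : Ker κ) (hz0 : ∫ z, κ z = 0) {s R M : ℝ} (hs : s ∈ Set.Ioc 0 R)
    (hM0 : 0 ≤ M) {q : Eu m → ℝ} (hq : Continuous q)
    {x : Eu m} (hM : ∀ z ∈ Metric.closedBall x R, |q z - q x| ≤ M * ‖z - x‖ ^ (1/2 : ℝ)) :
    ‖P κ s q x‖ ≤ M * s ^ (1/2 : ℝ) * nrm κ := by
  rw [P_mean0 h hz0 hq]
  refine P_norm_le h fun z hz => ?_
  have e : ‖s • z‖ ≤ s := by
    rw [norm_smul, Real.norm_eq_abs, abs_of_pos hs.1]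
    nlinarith [hs.1, hs.2, norm_nonneg z]
  refine (hM _ ?_).trans ?_
  · simp only [Metric.mem_closedBall, dist_self_add_left]
    exact e.trans hs.2
  · rw [add_sub_cancel_left]
    gcongr

lemma b_bound {b : ℝ → ℝ} (hb : Continuous b) (R : ℝ) :
    ∃ B, 0 ≤ B ∧ ∀ s ∈ Set.Ioc 0 R, |b s| ≤ B := by
  obtain ⟨B, hB⟩ := (isCompact_Icc (a := (0:ℝ)) (b := R)).exists_bound_of_continuousOn hb.continuousOn
  exact ⟨max B 0, le_max_right _ _, fun s hs => (hB s ⟨hs.1.le, hs.2⟩).trans (le_max_left _ _)⟩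

lemma q_bound {q : Eu m → ℝ} (hq : Continuous q) (x : Eu m) (R : ℝ) :
    ∃ M, 0 ≤ M ∧ ∀ z ∈ Metric.closedBall x R, |q z| ≤ M := by
  obtain ⟨M, hM⟩ := (isCompact_closedBall x R).exists_bound_of_continuousOn hq.continuousOn
  exact ⟨max M 0, le_max_right _ _, fun s hs => (hM s hs).trans (le_max_left _ _)⟩

lemma A_bd1 {b : ℝ → ℝ} (hb : Continuous b) {κ : Eu m → F} (h : Ker κ) {R B M : ℝ} (hR : 0 < R)
    (hB : ∀ s ∈ Set.Ioc 0 R, |b s| ≤ B) {q : Eu m → ℝ} (hq : Continuous q) {x : Eu m}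
    (hM0 : 0 ≤ M) (hM : ∀ z ∈ Metric.closedBall x R, |q z| ≤ M) :
    ‖A b κ R q x‖ ≤ B * (M * nrm κ) * R := by
  have hB0 : 0 ≤ B := (abs_nonneg _).trans (hB R ⟨hR, le_rfl⟩)
  have := (dom_int (wP_cont hb.continuousOn h hq x) hR (e := 0) (C := B * (M * nrm κ)) (by norm_num)
    fun s hs => by
      rw [norm_smul, Real.rpow_zero, mul_one]
      exact mul_le_mul (hB s hs) (P_bd0 h hs hM) (norm_nonneg _) hB0).2
  unfold A
  simpa using this

lemma A_int1 {b : ℝ → ℝ} (hb : Continuous b) {κ : Eu m → F} (h : Ker κ) {R : ℝ}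
    {q : Eu m → ℝ} (hq : Continuous q) (x : Eu m) :
    IntervalIntegrable (fun s => b s • P κ s q x) volume 0 R :=
  (hb.smul (P_cont_s h hq x)).intervalIntegrable _ _

/-- Level 0 derivative. -/
lemma A_fderiv0 [CompleteSpace F] {b : ℝ → ℝ} (hb : Continuous b) {κ : Eu m → F}
    (h : Ker κ) (h1 : ContDiff ℝ 1 κ) {q : Eu m → ℝ} (hq : Continuous q) {R : ℝ} (hR : 0 < R)
    (x : Eu m) : HasFDerivAt (A (fun s => s * b s) κ R q) (A (fun s => -b s) (fderiv ℝ κ) R q x) x := by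
  obtain ⟨B, hB0, hB⟩ := b_bound hb R
  obtain ⟨B', hB0', hB'⟩ := b_bound (b := fun s => s * b s) (by fun_prop) R
  obtain ⟨M, hM0, hM⟩ := q_bound hq x (R + 1)
  have hn := nrm_nonneg κ
  have key := A_fderiv (w := fun s => s * b s) (by fun_prop) h h1 hq hR x (C0 := B' * (M * nrm κ))
    (e0 := 0)
    (C := B * (M * nrm (fderiv ℝ κ))) (e := 0) (by norm_num) (by norm_num) ?_ ?_
  · refine key.congr_fderiv ?_
    unfold A
    refine intervalIntegral.integral_congr_ae (Eventually.of_forall fun s hs => ?_)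
    rw [Set.uIoc_of_le hR.le] at hs
    simp only
    rw [← mul_assoc, inv_mul_cancel₀ hs.1.ne', one_mul]
  · intro s hs
    rw [norm_smul, Real.rpow_zero, mul_one]
    refine mul_le_mul (hB' s hs) (P_bd0 h hs fun z hz => hM z ?_) (norm_nonneg _) hB0'
    exact Metric.closedBall_subset_closedBall (by linarith) hz
  · intro y hy s hs
    rw [← mul_assoc, inv_mul_cancel₀ hs.1.ne', one_mul, norm_smul, Real.rpow_zero, mul_one, norm_neg]
    refine mul_le_mul (hB s hs) (P_bd0 (h.fderiv h1) hs fun z hz => hM z ?_) (norm_nonneg _) hB0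
    refine Metric.closedBall_subset_closedBall' ?_ hz
    rw [Metric.mem_ball] at hy
    linarith

/-- Level 1 derivative. -/
lemma A_fderiv1 [CompleteSpace F] {b : ℝ → ℝ} (hb : Continuous b) {κ : Eu m → F}
    (h : Ker κ) (h1 : ContDiff ℝ 1 κ) {q : Eu m → ℝ} (hq : LH q) {R : ℝ} (hR : 0 < R)
    (x : Eu m) : HasFDerivAt (A b κ R q) (A (fun s => -(s⁻¹ * b s)) (fderiv ℝ κ) R q x) x := by
  obtain ⟨B, hB0, hB⟩ := b_bound hb R
  obtain ⟨M, hM0, hM⟩ := q_bound hq.continuous x R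
  obtain ⟨Q, hQ0, hQ⟩ := hq (‖x‖ + R + 1)
  refine A_fderiv hb.continuousOn h h1 hq.continuous hR x (C0 := B * (M * nrm κ)) (e0 := 0)
    (C := B * (Q * nrm (fderiv ℝ κ))) (e := -(1/2)) (by norm_num) (by norm_num) ?_ ?_
  · intro s hs
    rw [norm_smul, Real.rpow_zero, mul_one]
    exact mul_le_mul (hB s hs) (P_bd0 h hs hM) (norm_nonneg _) hB0
  · intro y hy s hs
    have e1 : ‖P (fderiv ℝ κ) s q y‖ ≤ Q * s ^ (1/2 : ℝ) * nrm (fderiv ℝ κ) := by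
      refine P_bdH (h.fderiv h1) (integral_fderiv_zero h h1) hs hQ0 hq.continuous fun z hz => ?_
      have a1 := norm_le_norm_add_norm_sub' y x
      have a2 := norm_le_norm_add_norm_sub' z y
      rw [Metric.mem_ball, dist_eq_norm] at hy
      rw [Metric.mem_closedBall, dist_eq_norm] at hz
      exact hQ z y (by linarith) (by linarith)
    have e2 : s ^ (-(1/2) : ℝ) = s⁻¹ * s ^ (1/2 : ℝ) := by
      rw [← Real.rpow_neg_one, ← Real.rpow_add hs.1]
      norm_num
    rw [norm_smul, norm_neg, norm_mul, norm_inv, Real.norm_eq_abs, abs_of_pos hs.1, e2]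
    have hsp := inv_pos.2 hs.1
    calc s⁻¹ * ‖b s‖ * ‖P (fderiv ℝ κ) s q y‖
        ≤ s⁻¹ * B * (Q * s ^ (1/2 : ℝ) * nrm (fderiv ℝ κ)) := by
          gcongr
          exact hB s hs
      _ = _ := by ring

lemma A_bd2 {b : ℝ → ℝ} (hb : Continuous b) {κ : Eu m → F} (h : Ker κ) (hz0 : ∫ z, κ z = 0)
    {R B M : ℝ} (hR : 0 < R)
    (hB : ∀ s ∈ Set.Ioc 0 R, |b s| ≤ B) {q : Eu m → ℝ} (hq : Continuous q) {x : Eu m}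
    (hM0 : 0 ≤ M) (hM : ∀ z ∈ Metric.closedBall x R, |q z - q x| ≤ M * ‖z - x‖ ^ (1/2 : ℝ)) :
    IntervalIntegrable (fun s => (s⁻¹ * b s) • P κ s q x) volume 0 R ∧
    ‖A (fun s => s⁻¹ * b s) κ R q x‖ ≤ B * (M * nrm κ) * (2 * R ^ (1/2 : ℝ)) := by
  have hB0 : 0 ≤ B := (abs_nonneg _).trans (hB R ⟨hR, le_rfl⟩)
  have hw' : ContinuousOn (fun s => (s⁻¹ * b s)) (Set.Ioi 0) :=
    ((continuousOn_id.inv₀ fun s hs => (ne_of_gt hs)).mul hb.continuousOn)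
  have := (dom_int (wP_cont hw' h hq x) hR (e := -(1/2)) (C := B * (M * nrm κ)) (by norm_num)
    fun s hs => by
      have e1 := P_bdH h hz0 hs hM0 hq hM
      have e2 : s ^ (-(1/2) : ℝ) = s⁻¹ * s ^ (1/2 : ℝ) := by
        rw [← Real.rpow_neg_one, ← Real.rpow_add hs.1]
        norm_num
      rw [norm_smul, norm_mul, norm_inv, Real.norm_eq_abs, abs_of_pos hs.1, e2]
      have hsp := inv_pos.2 hs.1
      calc s⁻¹ * ‖b s‖ * ‖P κ s q x‖
          ≤ s⁻¹ * B * (M * s ^ (1/2 : ℝ) * nrm κ) := by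
            gcongr
            exact hB s hs
        _ = _ := by ring)
  refine ⟨this.1, this.2.trans (le_of_eq ?_)⟩
  rw [show (-(1/2) + 1 : ℝ) = 1/2 by norm_num]
  ring

/-- Level 1 Hölder estimate. -/
lemma A_hol1 [CompleteSpace F] {b : ℝ → ℝ} (hb : Continuous b) {κ : Eu m → F} (h : Ker κ)
    (h1 : ContDiff ℝ 1 κ) {R : ℝ} (hR : 0 < R) :
    ∃ C, 0 ≤ C ∧ ∀ (q : Eu m → ℝ), Continuous q → ∀ (c : Eu m) (r M : ℝ), 0 ≤ M →
      (∀ z ∈ Metric.closedBall c (r + R), |q z| ≤ M) →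
      ∀ x ∈ Metric.closedBall c r, ∀ y ∈ Metric.closedBall c r,
        ‖A b κ R q x - A b κ R q y‖ ≤ C * M * ‖x - y‖ ^ (1/2 : ℝ) := by
  obtain ⟨B, hB0, hB⟩ := b_bound hb R
  set k := (2 * nrm κ * nrm (fderiv ℝ κ)) ^ (1/2 : ℝ) with hk
  have n1 := nrm_nonneg κ
  have n2 := nrm_nonneg (fderiv ℝ κ)
  have hk0 : 0 ≤ k := by positivity
  refine ⟨B * k * (2 * R ^ (1/2 : ℝ)), by positivity, fun q hq c r M hM0 hM x hx y hy => ?_⟩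
  have hsub : ∀ z ∈ Metric.closedBall c r, Metric.closedBall z R ⊆ Metric.closedBall c (r + R) := by
    intro z hz
    refine Metric.closedBall_subset_closedBall' ?_
    rw [Metric.mem_closedBall] at hz
    linarith
  have hP : ∀ s ∈ Set.Ioc 0 R, ‖P κ s q x - P κ s q y‖ ≤ M * k * ‖x - y‖ ^ (1/2:ℝ) * s ^ (-(1/2) : ℝ) := by
    intro s hs
    have d1 : ‖P κ s q x - P κ s q y‖ ≤ 2 * M * nrm κ := by
      refine (norm_sub_le _ _).trans ?_
      have a1 := P_bd0 h hs fun z hz => hM z (hsub x hx hz)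
      have a2 := P_bd0 h hs fun z hz => hM z (hsub y hy hz)
      linarith
    have d2 : ‖P κ s q x - P κ s q y‖ ≤ s⁻¹ * (M * nrm (fderiv ℝ κ)) * ‖x - y‖ := by
      refine (convex_closedBall c r).norm_image_sub_le_of_norm_hasFDerivWithin_le
        (f := P κ s q) (f' := fun z => -(s⁻¹) • P (fderiv ℝ κ) s q z)
        (fun z _ => (P_hasFDerivAt h h1 hq hs.1 z).hasFDerivWithinAt) ?_ hy hx
      intro z hz
      rw [norm_smul, norm_neg, norm_inv, Real.norm_eq_abs, abs_of_pos hs.1]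
      have := inv_pos.2 hs.1
      gcongr
      exact P_bd0 (h.fderiv h1) hs fun t ht => hM t (hsub z hz ht)
    have hsp := inv_pos.2 hs.1
    have e0 : (‖P κ s q x - P κ s q y‖ * ‖P κ s q x - P κ s q y‖) ^ (1/2:ℝ)
        = ‖P κ s q x - P κ s q y‖ := by
      rw [← Real.sqrt_eq_rpow, Real.sqrt_mul_self (norm_nonneg _)]
    rw [← e0]
    calc (‖P κ s q x - P κ s q y‖ * ‖P κ s q x - P κ s q y‖) ^ (1/2:ℝ)
        ≤ ((2 * M * nrm κ) * (s⁻¹ * (M * nrm (fderiv ℝ κ)) * ‖x - y‖)) ^ (1/2:ℝ) := by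
          gcongr
      _ = ((M * M) * (2 * nrm κ * nrm (fderiv ℝ κ)) * ‖x - y‖ * s⁻¹) ^ (1/2:ℝ) := by ring_nf
      _ = _ := by
        rw [Real.mul_rpow (by positivity) hsp.le, Real.mul_rpow (by positivity) (norm_nonneg _),
          Real.mul_rpow (by positivity) (by positivity), ← Real.sqrt_eq_rpow (M * M),
          Real.sqrt_mul_self hM0, Real.inv_rpow hs.1.le, Real.rpow_neg hs.1.le]
  have hs : A b κ R q x - A b κ R q y = ∫ s in (0:ℝ)..R, b s • (P κ s q x - P κ s q y) := by
    unfold A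
    rw [← intervalIntegral.integral_sub (A_int1 hb h hq x) (A_int1 hb h hq y)]
    simp only [smul_sub]
  rw [hs]
  have := (dom_int (f := fun s => b s • (P κ s q x - P κ s q y)) (R := R) (e := -(1/2))
    (C := B * (M * k * ‖x - y‖ ^ (1/2:ℝ)))
    (hb.smul ((P_cont_s h hq x).sub (P_cont_s h hq y))).continuousOn hR (by norm_num) ?_).2
  · refine this.trans (le_of_eq ?_)
    rw [show (-(1/2) + 1 : ℝ) = 1/2 by norm_num]
    ring
  · intro s hs
    rw [norm_smul, mul_assoc]
    exact mul_le_mul (hB s hs) (hP s hs) (norm_nonneg _) hB0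

/-- Level 2 Hölder estimate. -/
lemma A_hol2 {b : ℝ → ℝ} (hb : Continuous b) {κ : Eu m → F} (h : Ker κ)
    (hz0 : ∫ z, κ z = 0) {R : ℝ} (hR : 0 < R) :
    ∃ C, 0 ≤ C ∧ ∀ (q : Eu m → ℝ), Continuous q → ∀ (c : Eu m) (r M : ℝ), 0 ≤ M →
      (∀ z ∈ Metric.closedBall c (r + R), ∀ z' ∈ Metric.closedBall c (r + R),
        |q z - q z'| ≤ M * ‖z - z'‖ ^ (1/2 : ℝ)) →
      ∀ x ∈ Metric.closedBall c r, ∀ y ∈ Metric.closedBall c r,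
        ‖A (fun s => s⁻¹ * b s) κ R q x - A (fun s => s⁻¹ * b s) κ R q y‖
          ≤ C * M * ‖x - y‖ ^ (1/4 : ℝ) := by
  obtain ⟨B, hB0, hB⟩ := b_bound hb R
  have n1 := nrm_nonneg κ
  refine ⟨B * (2 * nrm κ) * (4 * R ^ (1/4 : ℝ)), by positivity, fun q hq c r M hM0 hM x hx y hy => ?_⟩
  have hsub : ∀ z ∈ Metric.closedBall c r, Metric.closedBall z R ⊆ Metric.closedBall c (r + R) := by
    intro z hz
    refine Metric.closedBall_subset_closedBall' ?_
    rw [Metric.mem_closedBall] at hz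
    linarith
  have hsub' : ∀ z ∈ Metric.closedBall c r, z ∈ Metric.closedBall c (r + R) := fun z hz =>
    Metric.closedBall_subset_closedBall (by linarith) hz
  have hxH : ∀ z ∈ Metric.closedBall x R, |q z - q x| ≤ M * ‖z - x‖ ^ (1/2 : ℝ) := fun z hz =>
    hM z (hsub x hx hz) x (hsub' x hx)
  have hyH : ∀ z ∈ Metric.closedBall y R, |q z - q y| ≤ M * ‖z - y‖ ^ (1/2 : ℝ) := fun z hz =>
    hM z (hsub y hy hz) y (hsub' y hy)
  have hP : ∀ s ∈ Set.Ioc 0 R, ‖P κ s q x - P κ s q y‖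
      ≤ M * (2 * nrm κ) * ‖x - y‖ ^ (1/4:ℝ) * s ^ (1/4 : ℝ) := by
    intro s hs
    have hs1 := hs.1
    have d1 : ‖P κ s q x - P κ s q y‖ ≤ M * s ^ (1/2:ℝ) * (2 * nrm κ) := by
      refine (norm_sub_le _ _).trans ?_
      have a1 := P_bdH h hz0 hs hM0 hq hxH
      have a2 := P_bdH h hz0 hs hM0 hq hyH
      linarith
    have d2 : ‖P κ s q x - P κ s q y‖ ≤ M * ‖x - y‖ ^ (1/2:ℝ) * (2 * nrm κ) := by
      have e : P κ s q x - P κ s q y = P κ s (fun z => q z - q (z + (y - x))) x := by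
        rw [P_sub h hq (by fun_prop)]
        congr 1
        unfold P
        congr 1
        funext z
        congr 2
        abel
      rw [e]
      refine (P_norm_le h (M := M * ‖x - y‖ ^ (1/2:ℝ)) fun z hz => ?_).trans ?_
      · have hz' : ∀ w : Eu m, w + s • z ∈ Metric.closedBall w R := fun w => by
          simp only [Metric.mem_closedBall, dist_self_add_left, norm_smul, Real.norm_eq_abs,
            abs_of_pos hs.1]
          nlinarith [hs.1, hs.2, norm_nonneg z]
        have e3 : x + s • z + (y - x) = y + s • z := by abel
        rw [e3]
        refine (hM _ (hsub x hx (hz' x)) _ (hsub y hy (hz' y))).trans (le_of_eq ?_)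
        congr 3
        abel
      · gcongr
        linarith
    have e0 : (‖P κ s q x - P κ s q y‖ * ‖P κ s q x - P κ s q y‖) ^ (1/2:ℝ)
        = ‖P κ s q x - P κ s q y‖ := by
      rw [← Real.sqrt_eq_rpow, Real.sqrt_mul_self (norm_nonneg _)]
    rw [← e0]
    calc (‖P κ s q x - P κ s q y‖ * ‖P κ s q x - P κ s q y‖) ^ (1/2:ℝ)
        ≤ ((M * s ^ (1/2:ℝ) * (2 * nrm κ)) * (M * ‖x - y‖ ^ (1/2:ℝ) * (2 * nrm κ))) ^ (1/2:ℝ) := by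
          gcongr
      _ = (((M * (2 * nrm κ)) * (M * (2 * nrm κ))) * ‖x - y‖ ^ (1/2:ℝ) * s ^ (1/2:ℝ)) ^ (1/2:ℝ) := by
        ring_nf
      _ = _ := by
        rw [Real.mul_rpow (by positivity) (by positivity), Real.mul_rpow (by positivity) (by positivity),
          ← Real.sqrt_eq_rpow ((M * (2 * nrm κ)) * (M * (2 * nrm κ))),
          Real.sqrt_mul_self (by positivity), ← Real.rpow_mul hs.1.le, ← Real.rpow_mul (norm_nonneg _)]
        norm_num
  have hw' : ContinuousOn (fun s => (s⁻¹ * b s)) (Set.Ioi 0) :=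
    ((continuousOn_id.inv₀ fun s hs => (ne_of_gt hs)).mul hb.continuousOn)
  have hs : A (fun s => s⁻¹ * b s) κ R q x - A (fun s => s⁻¹ * b s) κ R q y
      = ∫ s in (0:ℝ)..R, (s⁻¹ * b s) • (P κ s q x - P κ s q y) := by
    unfold A
    rw [← intervalIntegral.integral_sub (A_bd2 hb h hz0 hR hB hq hM0 hxH).1
      (A_bd2 hb h hz0 hR hB hq hM0 hyH).1]
    simp only [smul_sub]
  rw [hs]
  have := (dom_int (f := fun s => (s⁻¹ * b s) • (P κ s q x - P κ s q y)) (R := R) (e := -(3/4))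
    (C := B * (M * (2 * nrm κ) * ‖x - y‖ ^ (1/4:ℝ)))
    (hw'.smul ((P_cont_s h hq x).sub (P_cont_s h hq y)).continuousOn) hR (by norm_num) ?_).2
  · refine this.trans (le_of_eq ?_)
    rw [show (-(3/4) + 1 : ℝ) = 1/4 by norm_num]
    ring
  · intro s hs
    have e2 : s ^ (-(3/4) : ℝ) = s⁻¹ * s ^ (1/4 : ℝ) := by
      rw [← Real.rpow_neg_one, ← Real.rpow_add hs.1]
      norm_num
    have hsp := inv_pos.2 hs.1
    rw [norm_smul, norm_mul, norm_inv, Real.norm_eq_abs, abs_of_pos hs.1, e2]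
    calc s⁻¹ * ‖b s‖ * ‖P κ s q x - P κ s q y‖
        ≤ s⁻¹ * B * (M * (2 * nrm κ) * ‖x - y‖ ^ (1/4:ℝ) * s ^ (1/4 : ℝ)) := by
          gcongr
          · exact hB s hs
          · exact hP s hs
      _ = _ := by ring

end ops
end EP

open Filter Topology MeasureTheory
namespace EP
set_option linter.unusedSectionVars false

structure Pair {m : ℕ} (η ρ : Eu m → ℝ) : Prop where
  kη : Ker η
  kρ : Ker ρ
  cη : ContDiff ℝ 2 η
  cρ : ContDiff ℝ 2 ρ
  nonneg : ∀ z, 0 ≤ η z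
  le : ∀ z, η z ≤ ρ z
  one : ∫ z, ρ z = 1
  pos : 0 < ∫ z, η z
  lapη : ∀ z, lap η z = -(m * ρ z + fderiv ℝ ρ z z)

lemma glue_le {t : ℝ} (ht : t ≤ 1) : expNegInvGlue t ≤ 2 * deriv expNegInvGlue t := by
  have h0 : ∀ t, 0 ≤ deriv expNegInvGlue t := fun t => expNegInvGlue.monotone.deriv_nonneg
  rcases le_or_gt t 0 with h | h
  · rw [expNegInvGlue.zero_of_nonpos h]
    linarith [h0 t]
  · have e : expNegInvGlue =ᶠ[𝓝 t] fun t => Real.exp (-t⁻¹) := by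
      filter_upwards [lt_mem_nhds h] with s hs
      simp [expNegInvGlue, not_le.2 hs]
    have hd : HasDerivAt (fun t : ℝ => Real.exp (-t⁻¹)) (Real.exp (-t⁻¹) * (-(-(t^2)⁻¹))) t :=
      ((hasDerivAt_inv h.ne').neg).exp
    rw [e.deriv_eq, hd.deriv, e.eq_of_nhds, neg_neg]
    have h1 : 1 ≤ (t^2)⁻¹ := by
      rw [one_le_inv₀ (by positivity)]
      nlinarith
    nlinarith [Real.exp_pos (-t⁻¹)]

lemma exists_pair (m : ℕ) : ∃ η ρ : Eu m → ℝ, Pair η ρ := by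
  have hsm : ContDiff ℝ 4 expNegInvGlue := expNegInvGlue.contDiff
  have hd1 : ContDiff ℝ 3 (deriv expNegInvGlue) :=
    ((contDiff_succ_iff_deriv (n := 3)).1 hsm).2.2
  set h := expNegInvGlue with hh
  set h' := deriv expNegInvGlue with hh'
  have dh : ∀ t, HasDerivAt h (h' t) t := fun t => (hsm.differentiable (by norm_num) t).hasDerivAt
  have dh' : ∀ t, HasDerivAt h' (deriv h' t) t :=
    fun t => (hd1.differentiable (by norm_num) t).hasDerivAt
  set η0 : Eu m → ℝ := fun z => h (1 - ‖z - 0‖^2) with hη0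
  set ρ0 : Eu m → ℝ := fun z => 2 * h' (1 - ‖z - 0‖^2) with hρ0
  have cη : ContDiff ℝ 2 η0 :=
    (hsm.of_le (by norm_num)).comp (contDiff_const.sub (contDiff_normsq 0))
  have cρ : ContDiff ℝ 2 ρ0 :=
    contDiff_const.mul ((hd1.of_le (by norm_num)).comp (contDiff_const.sub (contDiff_normsq 0)))
  have hneg : ∀ t : ℝ, t < 0 → h t = 0 ∧ h' t = 0 := by
    intro t ht
    refine ⟨expNegInvGlue.zero_of_nonpos ht.le, ?_⟩
    have : expNegInvGlue =ᶠ[𝓝 t] fun _ => 0 := by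
      filter_upwards [gt_mem_nhds ht] with s hs using expNegInvGlue.zero_of_nonpos hs.le
    rw [hh', this.deriv_eq]
    simp
  have hn1 : ∀ z : Eu m, 1 < ‖z‖ → 1 - ‖z - 0‖^2 < 0 := by
    intro z hz
    rw [sub_zero]
    nlinarith
  have kη : Ker η0 := ⟨cη.continuous, fun z hz => (hneg _ (hn1 z hz)).1⟩
  have kρ : Ker ρ0 := ⟨cρ.continuous, fun z hz => by simp only [hρ0]; rw [(hneg _ (hn1 z hz)).2, mul_zero]⟩
  have nn : ∀ z, 0 ≤ η0 z := fun z => expNegInvGlue.nonneg _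
  have le : ∀ z, η0 z ≤ ρ0 z := fun z => glue_le (by nlinarith [sq_nonneg ‖z - 0‖])
  have pos : 0 < ∫ z, η0 z := by
    refine cη.continuous.integral_pos_of_hasCompactSupport_nonneg_nonzero kη.hcs nn (x := 0) ?_
    have := expNegInvGlue.pos_of_pos one_pos
    simp only [hη0, sub_zero, norm_zero]
    rw [hh]
    norm_num
  have pos' : 0 < ∫ z, ρ0 z := pos.trans_le (integral_mono kη.integrable kρ.integrable le)
  set c := (∫ z, ρ0 z)⁻¹ with hc
  have hc0 : 0 < c := inv_pos.2 pos'
  have lap0 : ∀ z, lap η0 z = -(m * ρ0 z + fderiv ℝ ρ0 z z) := by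
    intro z
    have e1 : lap η0 z = -h' (1 - ‖z - 0‖^2) * (2 * m) + deriv h' (1 - ‖z - 0‖^2) * (4 * ‖z - 0‖^2) := by
      have := lap_comp (φ := fun y : Eu m => ‖y - 0‖^2) (g := fun t => h (1 - t))
        (g' := fun t => -h' (1 - t)) (x := z) (g'' := deriv h' (1 - ‖z - 0‖^2))
        (contDiff_normsq 0).contDiffAt ((hsm.of_le (by norm_num)).comp (contDiff_const.sub contDiff_id)).contDiffAt ?_ ?_
      · rw [lap_normsq, sum_pd_normsq] at this
        exact this
      · refine Eventually.of_forall fun t => ?_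
        have := (dh (1 - t)).comp t ((hasDerivAt_id t).const_sub 1)
        simp only [mul_neg, mul_one] at this
        exact this
      · have := ((dh' (1 - ‖z - 0‖^2)).comp (‖z - 0‖^2) ((hasDerivAt_id (‖z - 0‖^2)).const_sub 1)).neg
        simp only [mul_neg, mul_one, neg_neg] at this
        exact this
    have e2 : fderiv ℝ ρ0 z z = 2 * (deriv h' (1 - ‖z - 0‖^2) * (-(2 * ‖z‖^2))) := by
      have d : HasFDerivAt (fun y : Eu m => 1 - ‖y - 0‖^2) (-(2 • innerSL ℝ z)) z := by
        have := (hasStrictFDerivAt_norm_sq z).hasFDerivAt.const_sub 1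
        simpa using this
      have d2 := ((dh' (1 - ‖z - 0‖^2)).comp_hasFDerivAt z d).const_mul 2
      have d3 : fderiv ℝ ρ0 z = _ := d2.fderiv
      rw [d3]
      simp
    rw [e1, e2]
    simp only [hρ0, sub_zero]
    ring
  refine ⟨fun z => c * η0 z, fun z => c * ρ0 z, ⟨⟨by have := kη.cont; fun_prop, fun z hz => by simp [kη.supp z hz]⟩,
    ⟨by have := kρ.cont; fun_prop, fun z hz => by simp [kρ.supp z hz]⟩, contDiff_const.mul cη, contDiff_const.mul cρ,
    fun z => mul_nonneg hc0.le (nn z), fun z => by gcongr; exact le z, ?_, ?_, ?_⟩⟩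
  · rw [integral_const_mul, hc, inv_mul_cancel₀ pos'.ne']
  · rw [integral_const_mul]
    positivity
  · intro z
    have := lap_mul (φ := fun _ => c) (ψ := η0) (x := z) contDiffAt_const cη.contDiffAt
    rw [this, lap_const, lap0, fderiv_const_mul (cρ.differentiable (by norm_num) z)]
    simp [pd]
    ring

section
variable {m : ℕ} {F F' : Type*} [NormedAddCommGroup F] [NormedSpace ℝ F] [CompleteSpace F]
  [NormedAddCommGroup F'] [NormedSpace ℝ F'] [CompleteSpace F']

lemma P_clm (T : F →L[ℝ] F') {κ : Eu m → F} (h : Ker κ) {q : Eu m → ℝ} (hq : Continuous q)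
    (s : ℝ) (x : Eu m) : T (P κ s q x) = P (fun z => T (κ z)) s q x := by
  unfold P
  rw [← T.integral_comp_comm (h.integrable_smul hq s x)]
  simp

lemma A_clm (T : F →L[ℝ] F') {w : ℝ → ℝ} {κ : Eu m → F} (h : Ker κ) {q : Eu m → ℝ}
    (hq : Continuous q) {R : ℝ} {x : Eu m}
    (hi : IntervalIntegrable (fun s => w s • P κ s q x) volume 0 R) :
    T (A w κ R q x) = A w (fun z => T (κ z)) R q x := by
  unfold A
  rw [← T.intervalIntegral_comp_comm hi]
  simp only [map_smul, P_clm T h hq]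

lemma LH_of_C1 {v : Eu m → ℝ} (hv : ContDiff ℝ 1 v) : LH v := by
  intro r
  obtain ⟨C, hC0, hC⟩ : ∃ C, 0 ≤ C ∧ ∀ z ∈ Metric.closedBall (0 : Eu m) r, ‖fderiv ℝ v z‖ ≤ C := by
    obtain ⟨M, hM⟩ := (isCompact_closedBall (0 : Eu m) r).exists_bound_of_continuousOn
      (hv.continuous_fderiv (by norm_num)).continuousOn
    exact ⟨max M 0, le_max_right _ _, fun s hs => (hM s hs).trans (le_max_left _ _)⟩
  refine ⟨C * (2 * |r|) ^ (1/2:ℝ), by positivity, fun x y hx hy => ?_⟩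
  have h1 : |v x - v y| ≤ C * ‖x - y‖ :=
    (convex_closedBall (0 : Eu m) r).norm_image_sub_le_of_norm_fderiv_le
      (fun z _ => hv.differentiable (by norm_num) z) hC (by simpa using hy) (by simpa using hx)
  refine h1.trans ?_
  rw [mul_assoc]
  refine mul_le_mul_of_nonneg_left ?_ hC0
  have h2 : ‖x - y‖ ≤ 2 * |r| := by
    have := norm_sub_le x y
    linarith [le_abs_self r]
  calc ‖x - y‖ = ‖x - y‖ ^ (1/2:ℝ) * ‖x - y‖ ^ (1/2:ℝ) := by
        rw [← Real.rpow_add_of_nonneg (norm_nonneg _) (by norm_num) (by norm_num)]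
        norm_num
    _ ≤ _ := by gcongr

lemma C1_of {u : Eu m → F} {u' : Eu m → Eu m →L[ℝ] F} (h : ∀ x, HasFDerivAt u (u' x) x)
    (hc : Continuous u') : ContDiff ℝ 1 u := by
  rw [contDiff_one_iff_fderiv]
  refine ⟨fun x => (h x).differentiableAt, ?_⟩
  have : fderiv ℝ u = u' := funext fun x => (h x).fderiv
  rwa [this]

lemma C2_of {u : Eu m → F} {u' : Eu m → Eu m →L[ℝ] F} {u'' : Eu m → Eu m →L[ℝ] Eu m →L[ℝ] F}
    (h : ∀ x, HasFDerivAt u (u' x) x)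
    (h' : ∀ x, HasFDerivAt u' (u'' x) x) (hc : Continuous u'') : ContDiff ℝ 2 u := by
  have e : (2 : WithTop ℕ∞) = 1 + 1 := by norm_num
  rw [e, contDiff_succ_iff_fderiv]
  have : fderiv ℝ u = u' := funext fun x => (h x).fderiv
  rw [this]
  exact ⟨fun x => (h x).differentiableAt, by simp, C1_of h' hc⟩

lemma cont_of_hol {u : Eu m → F} {e : ℝ} (he : 0 < e)
    (h : ∀ r : ℝ, ∃ C, ∀ x ∈ Metric.closedBall (0 : Eu m) r, ∀ y ∈ Metric.closedBall (0 : Eu m) r,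
      ‖u x - u y‖ ≤ C * ‖x - y‖ ^ e) : Continuous u := by
  rw [continuous_iff_continuousAt]
  intro x
  obtain ⟨C, hh⟩ := h (‖x‖ + 1)
  rw [ContinuousAt, tendsto_iff_norm_sub_tendsto_zero]
  have : Tendsto (fun y => C * ‖y - x‖ ^ e) (𝓝 x) (𝓝 0) := by
    have : Continuous (fun y => C * ‖y - x‖ ^ e) :=
      continuous_const.mul ((continuous_id.sub continuous_const).norm.rpow_const
        fun _ => Or.inr he.le)
    have h2 := this.tendsto x
    simpa [Real.zero_rpow he.ne'] using h2
  refine squeeze_zero' (Eventually.of_forall fun _ => norm_nonneg _) ?_ this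
  filter_upwards [Metric.ball_mem_nhds x one_pos] with y hy
  refine hh y ?_ x (by simp)
  have := norm_le_norm_add_norm_sub' y x
  rw [Metric.mem_ball, dist_eq_norm] at hy
  rw [mem_closedBall_zero_iff]
  linarith

/-- derivative of the level zero operators: value of the second derivative. -/
lemma A_neg (w : ℝ → ℝ) (κ : Eu m → F) (R : ℝ) (q : Eu m → ℝ) (x : Eu m) :
    A (fun s => -w s) κ R q x = -A w κ R q x := by
  unfold A
  rw [← intervalIntegral.integral_neg]
  simp

lemma A_fderiv1' {b : ℝ → ℝ} (hb : Continuous b) {κ : Eu m → F}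
    (h : Ker κ) (h1 : ContDiff ℝ 2 κ) {q : Eu m → ℝ} (hq : LH q) {R : ℝ} (hR : 0 < R)
    (x : Eu m) : HasFDerivAt (A (fun s => -b s) (fderiv ℝ κ) R q)
      (A (fun s => s⁻¹ * b s) (fderiv ℝ (fderiv ℝ κ)) R q x) x := by
  have hk1 : ContDiff ℝ 1 κ := h1.of_le (by norm_num)
  have hk2 : ContDiff ℝ 1 (fderiv ℝ κ) := h1.fderiv_right (by norm_num)
  have := A_fderiv1 (b := fun s => -b s) (by fun_prop) (h.fderiv hk1) hk2 hq hR x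
  simpa using this

lemma A_C2 {b : ℝ → ℝ} (hb : Continuous b) {κ : Eu m → F}
    (h : Ker κ) (h1 : ContDiff ℝ 2 κ) {q : Eu m → ℝ} (hq : LH q) {R : ℝ} (hR : 0 < R) :
    ContDiff ℝ 2 (A (fun s => s * b s) κ R q) ∧
    (∀ x, fderiv ℝ (A (fun s => s * b s) κ R q) x = A (fun s => -b s) (fderiv ℝ κ) R q x) ∧
    (∀ x, fderiv ℝ (fderiv ℝ (A (fun s => s * b s) κ R q)) x
      = A (fun s => s⁻¹ * b s) (fderiv ℝ (fderiv ℝ κ)) R q x) := by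
  have hk1 : ContDiff ℝ 1 κ := h1.of_le (by norm_num)
  have hk2 : ContDiff ℝ 1 (fderiv ℝ κ) := h1.fderiv_right (by norm_num)
  have d1 := A_fderiv0 hb h hk1 hq.continuous hR
  have d2 := A_fderiv1' hb h h1 hq hR
  have e : fderiv ℝ (A (fun s => s * b s) κ R q) = A (fun s => -b s) (fderiv ℝ κ) R q :=
    funext fun x => (d1 x).fderiv
  refine ⟨C2_of (F := F) d1 d2 ?_, fun x => (d1 x).fderiv, fun x => by rw [e]; exact (d2 x).fderiv⟩
  obtain ⟨C, hC0, hC⟩ := A_hol2 (F := Eu m →L[ℝ] Eu m →L[ℝ] F) hb ((h.fderiv hk1).fderiv hk2)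
    (integral_fderiv_zero (h.fderiv hk1) hk2) hR
  refine cont_of_hol (F := Eu m →L[ℝ] Eu m →L[ℝ] F) (e := 1/4) (by norm_num) fun r => ?_
  obtain ⟨M, hM0, hM⟩ := hq (r + R)
  exact ⟨C * M, hC q hq.continuous 0 r M hM0 fun z hz z' hz' =>
    hM z z' (by simpa using hz) (by simpa using hz')⟩

/-- trace functional -/
noncomputable def tr : (Eu m →L[ℝ] Eu m →L[ℝ] ℝ) →L[ℝ] ℝ :=
  ∑ i : Fin m, (ContinuousLinearMap.apply ℝ ℝ (ev i)) ∘L (ContinuousLinearMap.apply ℝ (Eu m →L[ℝ] ℝ) (ev i))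

lemma lap_tr (φ : Eu m → ℝ) (x : Eu m) : lap φ x = tr (fderiv ℝ (fderiv ℝ φ) x) := by
  rw [lap_eq]
  simp [tr]

noncomputable def bG (R s : ℝ) : ℝ := 2 * (1 - s ^ 2 / R ^ 2)
lemma bG_cont (R : ℝ) : Continuous (bG R) := by unfold bG; fun_prop

noncomputable def GG (η : Eu m → ℝ) (R : ℝ) (q : Eu m → ℝ) : Eu m → ℝ := A (fun s => s * bG R s) η R q
noncomputable def SS (ρ : Eu m → ℝ) (R : ℝ) (q : Eu m → ℝ) : Eu m → ℝ :=
  A (fun s => s * (2 / R ^ 2)) ρ R q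

lemma Pair.ftc {η ρ : Eu m → ℝ} (h : Pair η ρ) {R : ℝ} (hR : 0 < R) {q : Eu m → ℝ} (hq : LH q)
    (x : Eu m) :
    IntervalIntegrable (fun s => (s⁻¹ * bG R s) • P (lap η) s q x) volume 0 R ∧
    A (fun s => s⁻¹ * bG R s) (lap η) R q x = -2 * q x + 2 * SS ρ R q x := by
  have hk1 : ContDiff ℝ 1 η := h.cη.of_le (by norm_num)
  have hk2 : ContDiff ℝ 1 (fderiv ℝ η) := h.cη.fderiv_right (by norm_num)
  have hρ1 : ContDiff ℝ 1 ρ := h.cρ.of_le (by norm_num)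
  have kD := (h.kη.fderiv hk1).fderiv hk2
  have hz : ∫ z, fderiv ℝ (fderiv ℝ η) z = 0 := integral_fderiv_zero (h.kη.fderiv hk1) hk2
  have el : lap η = fun z => tr (fderiv ℝ (fderiv ℝ η) z) := funext fun z => lap_tr η z
  have kL : Ker (lap η) := by
    refine ⟨cont_lap h.cη, fun z hz => ?_⟩
    rw [lap_tr, kD.supp z hz, map_zero]
  have zL : ∫ z, lap η z = 0 := by
    rw [el, ContinuousLinearMap.integral_comp_comm _ kD.integrable, hz, map_zero]
  obtain ⟨B, hB0, hB⟩ := b_bound (bG_cont R) R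
  obtain ⟨M, hM0, hM⟩ := hq (‖x‖ + R)
  have hi := (A_bd2 (bG_cont R) kL zL hR hB hq.continuous (x := x) hM0 fun z hz => by
    have a2 := norm_le_norm_add_norm_sub' z x
    rw [Metric.mem_closedBall, dist_eq_norm] at hz
    exact hM z x (by linarith) (by linarith)).1
  refine ⟨hi, ?_⟩
  have hΦ := P_cont_s h.kρ hq.continuous x
  have hi2 : IntervalIntegrable (fun s => (s * (2 / R^2)) * P ρ s q x) volume 0 R :=
    Continuous.intervalIntegrable (by fun_prop) _ _
  have key := intervalIntegral.integral_eq_sub_of_hasDerivAt_of_le (a := 0) (b := R) hR.le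
    (f := fun s => (1 - s^2/R^2) * P ρ s q x)
    (f' := fun s => (1/2) * ((s⁻¹ * bG R s) • P (lap η) s q x) - (s * (2 / R^2)) * P ρ s q x)
    (by fun_prop) (fun s hs => ?_) ((hi.const_mul _).sub hi2)
  · rw [intervalIntegral.integral_sub (hi.const_mul _) hi2, intervalIntegral.integral_const_mul,
      P_zero, h.one] at key
    have : R^2/R^2 = 1 := div_self (by positivity)
    rw [this] at key
    simp only [sub_self, zero_mul, smul_eq_mul, mul_one] at key
    unfold A SS A
    simp only [smul_eq_mul]
    norm_num at key
    linarith
  · have d1 := P_hasDerivAt_s h.kρ hρ1 hq.continuous hs.1 x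
    have d2 : HasDerivAt (fun s : ℝ => 1 - s^2/R^2) (-(2*s/R^2)) s := by
      have := ((hasDerivAt_pow 2 s).div_const (R^2)).const_sub 1
      simpa using this
    refine (d2.mul d1).congr_deriv ?_
    have e3 : (fun z => -(m * ρ z + fderiv ℝ ρ z z)) = lap η := funext fun z => (h.lapη z).symm
    rw [e3]
    unfold bG
    simp only [smul_eq_mul]
    ring


lemma Pair.lapG {η ρ : Eu m → ℝ} (h : Pair η ρ) {R : ℝ} (hR : 0 < R) {q : Eu m → ℝ} (hq : LH q)
    (x : Eu m) : lap (GG η R q) x = -2 * q x + 2 * SS ρ R q x := by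
  have hk1 : ContDiff ℝ 1 η := h.cη.of_le (by norm_num)
  have hk2 : ContDiff ℝ 1 (fderiv ℝ η) := h.cη.fderiv_right (by norm_num)
  have kD := (h.kη.fderiv hk1).fderiv hk2
  have hz : ∫ z, fderiv ℝ (fderiv ℝ η) z = 0 := integral_fderiv_zero (h.kη.fderiv hk1) hk2
  have el : lap η = fun z => tr (fderiv ℝ (fderiv ℝ η) z) := funext fun z => lap_tr η z
  obtain ⟨B, hB0, hB⟩ := b_bound (bG_cont R) R
  obtain ⟨M, hM0, hM⟩ := hq (‖x‖ + R)
  have hi := (A_bd2 (bG_cont R) kD hz hR hB hq.continuous (x := x) hM0 fun z hz => by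
    have a2 := norm_le_norm_add_norm_sub' z x
    rw [Metric.mem_closedBall, dist_eq_norm] at hz
    exact hM z x (by linarith) (by linarith)).1
  rw [lap_tr, GG, (A_C2 (bG_cont R) h.kη h.cη hq hR).2.2 x, A_clm tr kD hq.continuous hi, ← el]
  exact (h.ftc hR hq x).2

lemma P_lap {η : Eu m → ℝ} (kη : Ker η) (cη : ContDiff ℝ 2 η) {v : Eu m → ℝ} (hv : ContDiff ℝ 2 v)
    (s : ℝ) (x : Eu m) : P (lap η) s v x = s ^ 2 * P η s (lap v) x := by
  have hk1 : ContDiff ℝ 1 η := cη.of_le (by norm_num)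
  have hv1 : ContDiff ℝ 1 v := hv.of_le (by norm_num)
  have kpd : ∀ i, Ker (pd i η) := fun i => by
    refine ⟨(pd_contDiff cη i).continuous, fun z hz => ?_⟩
    simp [pd, (kη.fderiv hk1).supp z hz]
  have kpp : ∀ i, Ker (pd i (pd i η)) := fun i => by
    refine ⟨?_, fun z hz => ?_⟩
    · exact ((pd_contDiff cη i).continuous_fderiv (by norm_num)).clm_apply continuous_const
    · simp [pd, ((kpd i).fderiv (pd_contDiff cη i)).supp z hz]
  have e1 : P (lap η) s v x = ∑ i, P (pd i (pd i η)) s v x := by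
    unfold P
    rw [← integral_finsetSum _ fun i _ => (kpp i).integrable_smul hv.continuous s x]
    congr 1
    funext z
    rw [lap_eq_pd cη.contDiffAt, Finset.smul_sum]
  have e2 : P η s (lap v) x = ∑ i, P η s (pd i (pd i v)) x := by
    have hc : ∀ i, Continuous (pd i (pd i v)) := fun i =>
      ((pd_contDiff hv i).continuous_fderiv (by norm_num)).clm_apply continuous_const
    unfold P
    rw [← integral_finsetSum _ fun i _ => kη.integrable_smul (hc i) s x]
    congr 1
    funext z
    rw [lap_eq_pd hv.contDiffAt, Finset.sum_smul]
  rw [e1, e2, Finset.mul_sum]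
  refine Finset.sum_congr rfl fun i _ => ?_
  have a1 : P (pd i (pd i η)) s v x = -s * P (pd i η) s (pd i v) x :=
    P_ibp (kpd i) (pd_contDiff cη i) hv1 s x (ev i)
  have a2 : P (pd i η) s (pd i v) x = -s * P η s (pd i (pd i v)) x :=
    P_ibp kη hk1 (pd_contDiff hv i) s x (ev i)
  rw [a1, a2]
  ring

lemma Pair.repr {η ρ : Eu m → ℝ} (h : Pair η ρ) {R : ℝ} (hR : 0 < R) {v : Eu m → ℝ}
    (hv : ContDiff ℝ 2 v) (x : Eu m) :
    v x = SS ρ R v x - (1/2) * GG η R (lap v) x := by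
  have h1 := (h.ftc hR (LH_of_C1 (hv.of_le (by norm_num))) x).2
  have h2 : A (fun s => s⁻¹ * bG R s) (lap η) R v x
      = GG η R (lap v) x := by
    unfold GG A
    refine intervalIntegral.integral_congr_ae (Eventually.of_forall fun s hs => ?_)
    rw [Set.uIoc_of_le hR.le] at hs
    simp only [smul_eq_mul]
    rw [P_lap h.kη h.cη hv]
    have := hs.1.ne'
    field_simp
  rw [h2] at h1
  linarith

lemma Pair.Nbound {η ρ : Eu m → ℝ} (h : Pair η ρ) {R : ℝ} (hR : 0 < R) {q : Eu m → ℝ}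
    (hq : Continuous q) {M : ℝ} (hM : ∀ x, |q x| ≤ M) (x : Eu m) :
    |SS ρ R q x - (R^2)⁻¹ * GG η R q x| ≤ (1 - (∫ z, η z) / 2) * M := by
  set β := ∫ z, η z with hβ
  have hP : ∀ s ∈ Set.Ioc 0 R, |P ρ s q x - (1 - s^2/R^2) * P η s q x| ≤ M * (1 - (1 - s^2/R^2) * β) := by
    intro s hs
    set c := 1 - s^2/R^2 with hc
    have hs1 : s^2/R^2 ≤ 1 := by
      rw [div_le_one (by positivity)]
      exact pow_le_pow_left₀ hs.1.le hs.2 2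
    have hc0 : 0 ≤ c := by linarith
    have hc1 : c ≤ 1 := by
      have : 0 ≤ s^2/R^2 := by positivity
      linarith
    have hnn : ∀ z, 0 ≤ ρ z - c * η z := fun z => by nlinarith [h.nonneg z, h.le z]
    have e1 : P ρ s q x - c * P η s q x = ∫ z, q (x + s • z) * (ρ z - c * η z) := by
      unfold P
      rw [← integral_const_mul, ← integral_sub (h.kρ.integrable_smul hq s x)
        ((h.kη.integrable_smul hq s x).const_mul c)]
      congr 1
      funext z
      simp only [smul_eq_mul]
      ring
    have e2 : M * (1 - c * β) = ∫ z, M * (ρ z - c * η z) := by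
      rw [integral_const_mul, integral_sub h.kρ.integrable (h.kη.integrable.const_mul c),
        integral_const_mul, h.one]
    rw [e1, e2, ← Real.norm_eq_abs]
    refine norm_integral_le_of_norm_le
      ((h.kρ.integrable.sub (h.kη.integrable.const_mul c)).const_mul M)
      (Eventually.of_forall fun z => ?_)
    rw [norm_mul, Real.norm_of_nonneg (hnn z)]
    exact mul_le_mul_of_nonneg_right (hM _) (hnn z)
  have c1 := P_cont_s h.kρ hq x
  have c2 := P_cont_s h.kη hq x
  have e : SS ρ R q x - (R^2)⁻¹ * GG η R q x
      = ∫ s in (0:ℝ)..R, (2 * s / R^2) * (P ρ s q x - (1 - s^2/R^2) * P η s q x) := by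
    unfold SS GG A bG
    rw [← intervalIntegral.integral_const_mul, ← intervalIntegral.integral_sub]
    · congr 1
      funext s
      simp only [smul_eq_mul]
      ring
    · exact Continuous.intervalIntegrable (by fun_prop) _ _
    · exact Continuous.intervalIntegrable (by fun_prop) _ _
  rw [e]
  have i1 : ∫ s in (0:ℝ)..R, (2 * s / R^2) * (M * (1 - (1 - s^2/R^2) * β)) = (1 - β / 2) * M := by
    have : ∀ s : ℝ, (2 * s / R^2) * (M * (1 - (1 - s^2/R^2) * β))
        = (2 * M * (1 - β) / R^2) * s + (2 * M * β / R^4) * s^3 := by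
      intro s
      field_simp
      ring
    simp only [this]
    rw [intervalIntegral.integral_add (Continuous.intervalIntegrable (by fun_prop) _ _)
      (Continuous.intervalIntegrable (by fun_prop) _ _), intervalIntegral.integral_const_mul,
      intervalIntegral.integral_const_mul, integral_id, integral_pow]
    field_simp
    norm_num
    ring
  rw [← i1, ← Real.norm_eq_abs]
  refine intervalIntegral.norm_integral_le_of_norm_le hR.le (Eventually.of_forall fun s hs => ?_)
    (Continuous.intervalIntegrable (by fun_prop) _ _)
  have hs1 := hs.1
  rw [norm_mul, Real.norm_of_nonneg (by positivity)]
  exact mul_le_mul_of_nonneg_left (hP s hs) (by positivity)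
end
end EP

open Filter Topology MeasureTheory
namespace EP
set_option linter.unusedSectionVars false

section cmp
variable {m : ℕ}

noncomputable def psi (x : Eu m) : ℝ := √(1 + ‖x - 0‖ ^ 2)

lemma psi_facts (x : Eu m) : ContDiff ℝ 2 (psi (m := m)) ∧ ‖fderiv ℝ psi x‖ ≤ 1 ∧ lap psi x ≤ m ∧
    ‖x‖ ≤ psi x := by
  set g : ℝ → ℝ := fun t => √(1 + t) with hg
  set g' : ℝ → ℝ := fun t => 1 / (2 * √(1 + t)) with hg'
  have hc : ContDiff ℝ 2 (psi (m := m)) := by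
    unfold psi
    refine (contDiff_const.add (contDiff_normsq 0)).sqrt fun y => ?_
    positivity
  set t := ‖x - 0‖^2 with ht
  have ht0 : 0 ≤ t := by positivity
  have hd : ∀ t : ℝ, -1 < t → HasDerivAt g (g' t) t := by
    intro t ht
    exact ((hasDerivAt_id t).const_add 1).sqrt (by simp; linarith)
  have hsq : 0 < √(1 + t) := Real.sqrt_pos.2 (by linarith)
  have hs2 : √(1 + t) ^ 2 = 1 + t := Real.sq_sqrt (by linarith)
  obtain ⟨g'', hg''0, hg''⟩ : ∃ g'', g'' ≤ 0 ∧ HasDerivAt g' g'' t := by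
    have h1 := ((hd t (by linarith)).const_mul 2).inv (by positivity)
    refine ⟨_, ?_, h1.congr_of_eventuallyEq (Eventually.of_forall fun s => ?_)⟩
    · have : 0 ≤ g' t := by positivity
      have h2 : 0 ≤ 2 * g' t / (2 * g t)^2 := by positivity
      have h3 : -(2 * g' t) / (2 * g t)^2 = - (2 * g' t / (2 * g t)^2) := neg_div _ _
      rw [h3]
      linarith
    · simp [hg', hg]
  refine ⟨hc, ?_, ?_, ?_⟩
  · have e : ‖fderiv ℝ (psi (m := m)) x‖^2 ≤ 1 := by
      rw [clm_norm_sq]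
      have : ∀ i, fderiv ℝ (psi (m := m)) x (ev i) = g' t * pd i (fun y : Eu m => ‖y - 0‖^2) x := fun i =>
        pd_comp (φ := fun y : Eu m => ‖y - 0‖^2) (g := g)
          ((contDiff_normsq (n := 2) 0).differentiable (by norm_num) x) (hd t (by linarith)) i
      simp only [this, mul_pow]
      rw [← Finset.mul_sum, sum_pd_normsq, ← ht]
      simp only [hg', div_pow, mul_pow]
      rw [hs2, div_mul_eq_mul_div, div_le_one (by positivity)]
      linarith
    nlinarith [norm_nonneg (fderiv ℝ (psi (m := m)) x)]
  · have := lap_comp (φ := fun y : Eu m => ‖y - 0‖^2) (g := g) (g' := g') (x := x) (g'' := g'')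
      (contDiff_normsq 0).contDiffAt ?_ ?_ hg''
    · rw [lap_normsq, sum_pd_normsq, ← ht] at this
      have e : lap (psi (m := m)) x = g' t * (2 * m) + g'' * (4 * t) := this
      rw [e]
      have h1 : g' t ≤ 1/2 := by
        simp only [hg']
        rw [div_le_div_iff₀ (by positivity) (by norm_num)]
        have : 1 ≤ √(1 + t) := by
          rw [Real.le_sqrt (by norm_num) (by linarith)]
          linarith
        linarith
      have h2 : g'' * (4 * t) ≤ 0 := mul_nonpos_of_nonpos_of_nonneg hg''0 (by linarith)
      have h3 : (0:ℝ) ≤ m := Nat.cast_nonneg m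
      nlinarith
    · refine ContDiffAt.sqrt (contDiffAt_const.add contDiffAt_id) ?_
      have : 0 < 1 + t := by linarith
      exact this.ne'
    · filter_upwards [lt_mem_nhds (show -1 < ‖x - 0‖^2 by linarith)] with s hs using hd s hs
  · unfold psi
    refine Real.le_sqrt_of_sq_le ?_
    rw [sub_zero]
    linarith

lemma comparison {ε Λ D C : ℝ} (hε : 0 < ε) {H : (Eu m →L[ℝ] ℝ) → ℝ}
    (hH : ∀ p p', |H p - H p'| ≤ Λ * ‖p - p'‖) (hΛ : 0 ≤ Λ) {u v : Eu m → ℝ} {g1 g2 : Eu m → ℝ}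
    (hu : ContDiff ℝ 2 u) (hv : ContDiff ℝ 2 v) (hub : ∀ x, |u x| ≤ C) (hvb : ∀ x, |v x| ≤ C)
    (h1 : ∀ x, ε * u x - (1/2) * lap u x + H (fderiv ℝ u x) ≤ g1 x)
    (h2 : ∀ x, g2 x ≤ ε * v x - (1/2) * lap v x + H (fderiv ℝ v x))
    (hD : ∀ x, g1 x - g2 x ≤ D) (x : Eu m) : u x - v x ≤ D / ε := by
  have key : ∀ δ : ℝ, 0 < δ → u x - v x ≤ D / ε + δ * (psi x + (m/2 + Λ) / ε) := by
    intro δ hδ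
    set w : Eu m → ℝ := fun y => (u y - v y) - δ * psi y with hw
    have hpc : ContDiff ℝ 2 (psi (m := m)) := (psi_facts 0).1
    have hcw : Continuous w := by
      have := hu.continuous
      have := hv.continuous
      have := hpc.continuous
      fun_prop
    have hlim : Tendsto w (cocompact (Eu m)) atBot := by
      have h3 : Tendsto (fun y : Eu m => 2 * C + -δ * ‖y‖) (cocompact (Eu m)) atBot := by
        refine tendsto_atBot_add_const_left _ _ ?_
        exact (tendsto_norm_cocompact_atTop (E := Eu m)).const_mul_atTop_of_neg (by linarith)
      refine tendsto_atBot_mono (fun y => ?_) h3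
      have a1 := (abs_le.1 (hub y)).2
      have a2 := (abs_le.1 (hvb y)).1
      have a3 := (psi_facts y).2.2.2
      simp only [hw]
      nlinarith
    obtain ⟨x0, hx0⟩ := hcw.exists_forall_ge hlim
    have hmax : IsLocalMax w x0 := Eventually.of_forall hx0
    have cw : ContDiff ℝ 2 w := (hu.sub hv).sub (contDiff_const.mul hpc)
    have f0 := fderiv_zero_of_max hmax
    have l0 := lap_nonpos cw.contDiffAt hmax
    have ef : fderiv ℝ u x0 - fderiv ℝ v x0 = δ • fderiv ℝ psi x0 := by
      have du := hu.differentiable (by norm_num) x0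
      have dv := hv.differentiable (by norm_num) x0
      have dp := hpc.differentiable (by norm_num) x0
      have : fderiv ℝ w x0 = fderiv ℝ u x0 - fderiv ℝ v x0 - δ • fderiv ℝ psi x0 := by
        simp only [hw]
        rw [fderiv_fun_sub (by fun_prop) (by fun_prop), fderiv_fun_sub du dv, fderiv_const_mul dp]
      rw [f0] at this
      exact (sub_eq_zero.1 this.symm)
    have el : lap w x0 = lap u x0 - lap v x0 - δ * lap psi x0 := by
      simp only [hw]
      rw [lap_sub (hu.sub hv).contDiffAt (contDiff_const.mul hpc).contDiffAt,
        lap_sub hu.contDiffAt hv.contDiffAt,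
        lap_mul contDiffAt_const hpc.contDiffAt, lap_const]
      simp [pd]
    obtain ⟨-, p1, p2, p3⟩ := psi_facts x0
    have hHd : H (fderiv ℝ v x0) - H (fderiv ℝ u x0) ≤ Λ * δ := by
      have := (neg_le_of_abs_le (hH (fderiv ℝ u x0) (fderiv ℝ v x0)))
      rw [ef, norm_smul, Real.norm_eq_abs, abs_of_pos hδ] at this
      have : Λ * (δ * ‖fderiv ℝ (psi (m := m)) x0‖) ≤ Λ * δ := by
        refine mul_le_mul_of_nonneg_left ?_ hΛ
        nlinarith
      linarith
    have hm : ε * (u x0 - v x0) ≤ D + δ * (m/2 + Λ) := by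
      have := h1 x0
      have := h2 x0
      have := hD x0
      nlinarith
    have hm2 : u x0 - v x0 ≤ (D + δ * (m/2 + Λ)) / ε := by
      rw [le_div_iff₀ hε]
      linarith
    have := hx0 x
    simp only [hw] at this
    have p4 : 0 ≤ psi x0 := (norm_nonneg _).trans p3
    have : u x - v x ≤ δ * psi x + (u x0 - v x0) := by nlinarith
    calc u x - v x ≤ δ * psi x + (D + δ * (m/2 + Λ)) / ε := by linarith
      _ = _ := by
        field_simp
        ring
  have hlim : Tendsto (fun δ : ℝ => D / ε + δ * (psi x + (m/2 + Λ) / ε)) (𝓝[>] 0) (𝓝 (D / ε)) := by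
    have : Continuous (fun δ : ℝ => D / ε + δ * (psi x + (m/2 + Λ) / ε)) := by fun_prop
    have := (this.tendsto 0).mono_left (nhdsWithin_le_nhds (s := Set.Ioi 0))
    simpa using this
  refine ge_of_tendsto hlim ?_
  filter_upwards [self_mem_nhdsWithin] with δ hδ using key δ hδ

lemma A_sub {F : Type*} [NormedAddCommGroup F] [NormedSpace ℝ F] {b : ℝ → ℝ} (hb : Continuous b) {κ : Eu m → F} (h : Ker κ) {R : ℝ}
    {q q' : Eu m → ℝ} (hq : Continuous q) (hq' : Continuous q') (x : Eu m) :
    A b κ R (fun y => q y - q' y) x = A b κ R q x - A b κ R q' x := by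
  unfold A
  rw [← intervalIntegral.integral_sub (A_int1 hb h hq x) (A_int1 hb h hq' x)]
  simp only [P_sub h hq hq', smul_sub]

lemma A_LHtype {F : Type*} [NormedAddCommGroup F] [NormedSpace ℝ F] [CompleteSpace F] {b : ℝ → ℝ} (hb : Continuous b) {κ : Eu m → F} (h : Ker κ)
    (h1 : ContDiff ℝ 1 κ) {R : ℝ} (hR : 0 < R) {q : Eu m → ℝ} (hq : Continuous q) (r : ℝ) :
    ∃ C, 0 ≤ C ∧ ∀ x y, ‖x‖ ≤ r → ‖y‖ ≤ r → ‖A b κ R q x - A b κ R q y‖ ≤ C * ‖x - y‖ ^ (1/2:ℝ) := by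
  obtain ⟨C, hC0, hC⟩ := A_hol1 hb h h1 hR
  obtain ⟨M, hM0, hM⟩ := q_bound hq 0 (r + R)
  exact ⟨C * M, by positivity, fun x y hx hy => hC q hq 0 r M hM0 hM x (by simpa using hx) y (by simpa using hy)⟩

lemma A_cont {F : Type*} [NormedAddCommGroup F] [NormedSpace ℝ F] [CompleteSpace F] {b : ℝ → ℝ} (hb : Continuous b) {κ : Eu m → F} (h : Ker κ)
    (h1 : ContDiff ℝ 1 κ) {R : ℝ} (hR : 0 < R) {q : Eu m → ℝ} (hq : Continuous q) :
    Continuous (A b κ R q) := by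
  refine cont_of_hol (e := 1/2) (by norm_num) fun r => ?_
  obtain ⟨C, hC0, hC⟩ := A_LHtype hb h h1 hR hq r
  exact ⟨C, fun x hx y hy => hC x y (by simpa using hx) (by simpa using hy)⟩

open BoundedContinuousFunction in
lemma exists1 {η ρ : Eu m → ℝ} (h : Pair η ρ) {Λ : ℝ} (hΛ : 0 ≤ Λ) {H : (Eu m →L[ℝ] ℝ) → ℝ}
    (hH : ∀ p p', |H p - H p'| ≤ Λ * ‖p - p'‖) :
    ∃ R0, 0 < R0 ∧ ∀ R, 0 < R → R ≤ R0 → ∀ (g : Eu m → ℝ) (Mg : ℝ), LH g → (∀ x, |g x| ≤ Mg) →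
      ∃ u, ContDiff ℝ 2 u ∧ (∃ C, ∀ x, |u x| ≤ C) ∧
        ∀ x, (R^2)⁻¹ * u x - (1/2) * lap u x + H (fderiv ℝ u x) = g x := by
  set β := ∫ z, η z with hβ
  have hβ0 : 0 < β := h.pos
  have hβ1 : β ≤ 1 := h.one ▸ integral_mono h.kη.integrable h.kρ.integrable h.le
  have hk1 : ContDiff ℝ 1 η := h.cη.of_le (by norm_num)
  have hk2 : ContDiff ℝ 1 (fderiv ℝ η) := h.cη.fderiv_right (by norm_num)
  have hρ1 : ContDiff ℝ 1 ρ := h.cρ.of_le (by norm_num)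
  have kD := h.kη.fderiv hk1
  set n := nrm (fderiv ℝ η) with hn
  have hn0 : 0 ≤ n := nrm_nonneg _
  refine ⟨β / (8 * (Λ * n + 1)), by positivity, fun R hR hRR g Mg hg hgb => ?_⟩
  have hR8 : Λ * (2 * n * R) ≤ β / 4 := by
    rw [le_div_iff₀ (by positivity)] at hRR
    have : 0 ≤ Λ * n := by positivity
    nlinarith
  have cb : Continuous (fun s => -bG R s) := (bG_cont R).neg
  have hbB : ∀ s ∈ Set.Ioc 0 R, |-bG R s| ≤ 2 := by
    intro s hs
    have hs1 : s^2/R^2 ≤ 1 := by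
      rw [div_le_one (by positivity)]
      exact pow_le_pow_left₀ hs.1.le hs.2 2
    have : 0 ≤ s^2/R^2 := by positivity
    rw [abs_neg, abs_le]
    unfold bG
    constructor <;> linarith
  set Dq : (Eu m → ℝ) → Eu m → (Eu m →L[ℝ] ℝ) := fun q => A (fun s => -bG R s) (fderiv ℝ η) R q with hDq
  have Dq_b : ∀ q : Eu m → ℝ, Continuous q → ∀ M, 0 ≤ M → (∀ x, |q x| ≤ M) → ∀ x, ‖Dq q x‖ ≤ 2 * n * R * M := by
    intro q hq M hM0 hM x
    have := A_bd1 cb kD hR hbB hq (x := x) hM0 fun z _ => hM z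
    calc ‖Dq q x‖ ≤ _ := this
      _ = _ := by ring
  have csG : Continuous (fun s => s * bG R s) := continuous_id.mul (bG_cont R)
  have csS : Continuous (fun s : ℝ => s * (2 / R^2)) := by fun_prop
  set Φ0 : (Eu m → ℝ) → Eu m → ℝ := fun q x =>
    g x + (SS ρ R q x - (R^2)⁻¹ * GG η R q x) - H (Dq q x) with hΦ0
  have Hc : Continuous H := by
    have : LipschitzWith Λ.toNNReal H := LipschitzWith.of_dist_le_mul fun p p' => by
      rw [Real.dist_eq, dist_eq_norm, Real.coe_toNNReal _ hΛ]
      exact hH p p'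
    exact this.continuous
  have Φc : ∀ q : Eu m → ℝ, Continuous q → Continuous (Φ0 q) := by
    intro q hq
    have c1 : Continuous (SS ρ R q) := A_cont csS h.kρ hρ1 hR hq
    have c2 : Continuous (GG η R q) := A_cont csG h.kη hk1 hR hq
    have c3 : Continuous (Dq q) := A_cont cb kD hk2 hR hq
    have c4 := hg.continuous
    fun_prop
  have Φb : ∀ q : Eu m → ℝ, Continuous q → ∀ M, 0 ≤ M → (∀ x, |q x| ≤ M) → ∀ x,
      ‖Φ0 q x‖ ≤ Mg + (1 - β/2) * M + (|H 0| + Λ * (2 * n * R * M)) := by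
    intro q hq M hM0 hM x
    have a1 := h.Nbound hR hq hM x
    have a2 := Dq_b q hq M hM0 hM x
    have a3 : |H (Dq q x)| ≤ |H 0| + Λ * (2 * n * R * M) := by
      have b1 := hH (Dq q x) 0
      rw [sub_zero] at b1
      have b2 : Λ * ‖Dq q x‖ ≤ Λ * (2 * n * R * M) := by gcongr
      have b3 := abs_sub_abs_le_abs_sub (H (Dq q x)) (H 0)
      linarith
    simp only [hΦ0]
    refine (norm_sub_le _ _).trans (add_le_add ((norm_add_le _ _).trans (add_le_add (hgb x) a1)) a3)
  let Φ : (Eu m →ᵇ ℝ) → (Eu m →ᵇ ℝ) := fun q =>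
    BoundedContinuousFunction.ofNormedAddCommGroup (Φ0 q) (Φc q q.continuous) _
      (Φb q q.continuous ‖q‖ (norm_nonneg _) fun x => q.norm_coe_le_norm x)
  have hcontr : ContractingWith (1 - β/4).toNNReal Φ := by
    refine ⟨?_, LipschitzWith.of_dist_le_mul fun q q' => ?_⟩
    · rw [Real.toNNReal_lt_one]
      linarith
    · rw [Real.coe_toNNReal _ (by linarith), BoundedContinuousFunction.dist_le (by
        have : 0 ≤ 1 - β/4 := by linarith
        positivity)]
      intro x
      have hd : ∀ y, |q y - q' y| ≤ dist q q' := fun y => by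
        have := BoundedContinuousFunction.dist_coe_le_dist (f := q) (g := q') y
        rwa [Real.dist_eq] at this
      have hqc : Continuous (fun y => q y - q' y) := q.continuous.sub q'.continuous
      have a1 := h.Nbound hR hqc hd x
      have a2 := Dq_b _ hqc _ dist_nonneg hd x
      have e1 : SS ρ R (fun y => q y - q' y) x = SS ρ R q x - SS ρ R q' x :=
        A_sub csS h.kρ q.continuous q'.continuous x
      have e2 : GG η R (fun y => q y - q' y) x = GG η R q x - GG η R q' x :=
        A_sub csG h.kη q.continuous q'.continuous x
      have e3 : Dq (fun y => q y - q' y) x = Dq q x - Dq q' x :=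
        A_sub cb kD q.continuous q'.continuous x
      rw [e1, e2] at a1
      rw [e3] at a2
      have a3 := hH (Dq q x) (Dq q' x)
      have a4 : Λ * ‖Dq q x - Dq q' x‖ ≤ Λ * (2 * n * R * dist q q') := by gcongr
      have a5 : Λ * (2 * n * R) * dist q q' ≤ β / 4 * dist q q' := by gcongr
      change |Φ0 q x - Φ0 q' x| ≤ _
      have e4 : Φ0 q x - Φ0 q' x = (SS ρ R q x - SS ρ R q' x - (R^2)⁻¹ * (GG η R q x - GG η R q' x))
          - (H (Dq q x) - H (Dq q' x)) := by
        simp only [hΦ0]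
        ring
      rw [e4]
      refine (abs_sub _ _).trans ?_
      linarith
  set Q := hcontr.fixedPoint Φ with hQ
  have hfix : Φ Q = Q := hcontr.fixedPoint_isFixedPt
  have hfx : ∀ x, Q x = Φ0 Q x := fun x => by
    conv_lhs => rw [← hfix]
    rfl
  have hQL : LH (fun x => Q x) := by
    intro r
    obtain ⟨C1, hC1, h1⟩ := hg r
    obtain ⟨C2, hC2, h2⟩ := A_LHtype csS h.kρ hρ1 hR Q.continuous r
    obtain ⟨C3, hC3, h3⟩ := A_LHtype csG h.kη hk1 hR Q.continuous r
    obtain ⟨C4, hC4, h4⟩ := A_LHtype cb kD hk2 hR Q.continuous r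
    refine ⟨C1 + (C2 + (R^2)⁻¹ * C3) + Λ * C4, by positivity, fun x y hx hy => ?_⟩
    have a1 := h1 x y hx hy
    have a2 : |SS ρ R Q x - SS ρ R Q y| ≤ C2 * ‖x - y‖ ^ (1/2:ℝ) := h2 x y hx hy
    have a3 : |GG η R Q x - GG η R Q y| ≤ C3 * ‖x - y‖ ^ (1/2:ℝ) := h3 x y hx hy
    have a4 : ‖Dq Q x - Dq Q y‖ ≤ C4 * ‖x - y‖ ^ (1/2:ℝ) := h4 x y hx hy
    have a5 := hH (Dq Q x) (Dq Q y)
    have a6 : Λ * ‖Dq Q x - Dq Q y‖ ≤ Λ * (C4 * ‖x - y‖ ^ (1/2:ℝ)) := by gcongr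
    have a7 : (R^2)⁻¹ * |GG η R Q x - GG η R Q y| ≤ (R^2)⁻¹ * (C3 * ‖x - y‖ ^ (1/2:ℝ)) := by gcongr
    show |Q x - Q y| ≤ _
    rw [hfx x, hfx y]
    have e4 : Φ0 Q x - Φ0 Q y = (g x - g y) + ((SS ρ R Q x - SS ρ R Q y) - (R^2)⁻¹ * (GG η R Q x - GG η R Q y))
          - (H (Dq Q x) - H (Dq Q y)) := by
        simp only [hΦ0]
        ring
    rw [e4]
    refine (abs_sub _ _).trans ?_
    have b1 := abs_add_le (g x - g y) ((SS ρ R Q x - SS ρ R Q y) - (R^2)⁻¹ * (GG η R Q x - GG η R Q y))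
    have b2 := abs_sub (SS ρ R Q x - SS ρ R Q y) ((R^2)⁻¹ * (GG η R Q x - GG η R Q y))
    rw [abs_mul (R^2)⁻¹, abs_of_pos (a := (R^2)⁻¹) (by positivity)] at b2
    linarith
  have hC2 := A_C2 (bG_cont R) h.kη h.cη hQL hR
  refine ⟨GG η R Q, hC2.1, ?_, fun x => ?_⟩
  · obtain ⟨B, hB0, hB⟩ := b_bound csG R
    exact ⟨_, fun x => A_bd1 csG h.kη hR hB Q.continuous (norm_nonneg Q)
      fun z _ => Q.norm_coe_le_norm z⟩
  · have e1 := h.lapG hR hQL x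
    have e2 : fderiv ℝ (GG η R Q) x = Dq Q x := hC2.2.1 x
    have e3 := hfx x
    simp only [hΦ0] at e3
    have e4 : lap (GG η R Q) x = -2 * Q x + 2 * SS ρ R Q x := e1
    rw [e4, e2]
    linarith

end cmp
end EP

open Filter Topology MeasureTheory
namespace EP
set_option linter.unusedSectionVars false

section ex
variable {m : ℕ}

lemma LH_of_lip {v : Eu m → ℝ} {L : ℝ} (hL : 0 ≤ L) (hv : ∀ x y, |v x - v y| ≤ L * ‖x - y‖) : LH v := by
  intro r
  refine ⟨L * (2 * |r|) ^ (1/2:ℝ), by positivity, fun x y hx hy => (hv x y).trans ?_⟩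
  rw [mul_assoc]
  refine mul_le_mul_of_nonneg_left ?_ hL
  have h1 : ‖x - y‖ = ‖x - y‖ ^ (1/2:ℝ) * ‖x - y‖ ^ (1/2:ℝ) := by
    rw [← Real.sqrt_eq_rpow]
    exact (Real.mul_self_sqrt (norm_nonneg _)).symm
  have h2 : ‖x - y‖ ≤ 2 * |r| := by
    have := norm_sub_le x y
    have := le_abs_self r
    linarith
  calc ‖x - y‖ = _ := h1
    _ ≤ _ := by gcongr

lemma lap_trans (u : Eu m → ℝ) (h x : Eu m) : lap (fun y => u (y + h)) x = lap u (x + h) := by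
  unfold lap
  simp only [iteratedFDeriv_comp_add_right']

lemma fderiv_trans (u : Eu m → ℝ) (h x : Eu m) :
    fderiv ℝ (fun y => u (y + h)) x = fderiv ℝ u (x + h) := fderiv_comp_add_right h

lemma lip_sol {ε Λ N C : ℝ} (hε : 0 < ε) {H : (Eu m →L[ℝ] ℝ) → ℝ}
    (hH : ∀ p p', |H p - H p'| ≤ Λ * ‖p - p'‖) (hΛ : 0 ≤ Λ) {u g : Eu m → ℝ}
    (hu : ContDiff ℝ 2 u) (hub : ∀ x, |u x| ≤ C)
    (h1 : ∀ x, ε * u x - (1/2) * lap u x + H (fderiv ℝ u x) = g x)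
    (hg : ∀ x y, |g x - g y| ≤ ε * N * ‖x - y‖) (x y : Eu m) : |u x - u y| ≤ N * ‖x - y‖ := by
  have key : ∀ x y, u x - u y ≤ N * ‖x - y‖ := by
    intro x y
    have h2 := comparison (D := ε * N * ‖x - y‖) (v := u) (u := fun z => u (z + (x - y))) hε hH hΛ
      (hu.comp (contDiff_id.add contDiff_const)) hu (fun z => hub _) hub
      (g1 := fun z => g (z + (x - y))) (g2 := g)
      (fun z => by rw [lap_trans, fderiv_trans]; exact (h1 _).le) (fun z => (h1 z).ge)
      (fun z => by
        have := (abs_le.1 (hg (z + (x - y)) z)).2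
        rwa [add_sub_cancel_left] at this) y
    rw [add_sub_cancel, mul_assoc, mul_div_cancel_left₀ _ hε.ne'] at h2
    exact h2
  rw [abs_le]
  have := key x y
  have h3 := key y x
  rw [norm_sub_rev] at h3
  constructor <;> linarith

lemma exists2 {ε Λ L Mg : ℝ} (hε : 0 < ε) (hΛ : 0 ≤ Λ) {H : (Eu m →L[ℝ] ℝ) → ℝ}
    (hH : ∀ p p', |H p - H p'| ≤ Λ * ‖p - p'‖) {g : Eu m → ℝ} (hL : 0 ≤ L)
    (hg : ∀ x y, |g x - g y| ≤ L * ‖x - y‖) (hgb : ∀ x, |g x| ≤ Mg) :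
    ∃ u, ContDiff ℝ 2 u ∧ (∃ C, ∀ x, |u x| ≤ C) ∧ (∀ x y, |u x - u y| ≤ (L/ε) * ‖x - y‖) ∧
        ∀ x, ε * u x - (1/2) * lap u x + H (fderiv ℝ u x) = g x := by
  obtain ⟨η, ρ, h⟩ := exists_pair m
  obtain ⟨R0, hR0, hex⟩ := exists1 h hΛ hH
  obtain ⟨R, hR, hRR, hK⟩ : ∃ R, 0 < R ∧ R ≤ R0 ∧ ε < (R^2)⁻¹ := by
    refine ⟨min R0 (min 1 (1/(2*ε))), by positivity, min_le_left _ _, ?_⟩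
    have a1 : min R0 (min 1 (1/(2*ε))) ≤ 1 := (min_le_right _ _).trans (min_le_left _ _)
    have a2 : min R0 (min 1 (1/(2*ε))) ≤ 1/(2*ε) := (min_le_right _ _).trans (min_le_right _ _)
    have a0 : 0 < min R0 (min 1 (1/(2*ε))) := by positivity
    generalize min R0 (min 1 (1/(2*ε))) = R at *
    rw [lt_inv_comm₀ hε (by positivity)]
    rw [le_div_iff₀ (by positivity)] at a2
    rw [inv_eq_one_div, lt_div_iff₀ hε]
    nlinarith
  set K := (R^2)⁻¹ with hKd
  have hK0 : 0 < K := hε.trans hK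
  set N := L / ε with hN
  have hN0 : 0 ≤ N := by positivity
  have hLN : L = ε * N := by rw [hN]; field_simp
  have hex2 : ∀ v : Eu m → ℝ, (∀ x y, |v x - v y| ≤ N * ‖x - y‖) → (∃ C, ∀ x, |v x| ≤ C) →
      ∃ u, ContDiff ℝ 2 u ∧ (∃ C, ∀ x, |u x| ≤ C) ∧ (∀ x y, |u x - u y| ≤ N * ‖x - y‖) ∧
        ∀ x, K * u x - (1/2) * lap u x + H (fderiv ℝ u x) = g x + (K - ε) * v x := by
    rintro v hv ⟨C, hC⟩
    have hrl : ∀ x y, |(g x + (K - ε) * v x) - (g y + (K - ε) * v y)| ≤ K * N * ‖x - y‖ := by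
      intro x y
      have e : (g x + (K - ε) * v x) - (g y + (K - ε) * v y) = (g x - g y) + (K - ε) * (v x - v y) := by ring
      rw [e]
      have a1 := abs_add_le (g x - g y) ((K - ε) * (v x - v y))
      rw [abs_mul, abs_of_pos (sub_pos.2 hK)] at a1
      have a2 := hg x y
      have a3 := mul_le_mul_of_nonneg_left (hv x y) (sub_pos.2 hK).le
      rw [hLN] at a2
      linarith
    obtain ⟨u, hu, ⟨C', hC'⟩, heq⟩ := hex R hR hRR (fun x => g x + (K - ε) * v x) (Mg + (K - ε) * C)
      (LH_of_lip (by positivity) hrl) (fun x => by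
        have a1 := abs_add_le (g x) ((K - ε) * v x)
        rw [abs_mul, abs_of_pos (sub_pos.2 hK)] at a1
        have a2 := hgb x
        have a3 := mul_le_mul_of_nonneg_left (hC x) (sub_pos.2 hK).le
        linarith)
    exact ⟨u, hu, ⟨C', hC'⟩, lip_sol hK0 hH hΛ hu hC' heq hrl, heq⟩
  let S : Set (BoundedContinuousFunction (Eu m) ℝ) := {v | ∀ x y, |v x - v y| ≤ N * ‖x - y‖}
  have hS : IsClosed S := by
    have : S = ⋂ x, ⋂ y, {v | |v x - v y| ≤ N * ‖x - y‖} := by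
      ext v; simp [S]
    rw [this]
    refine isClosed_iInter fun x => isClosed_iInter fun y => isClosed_le ?_ continuous_const
    have c1 : Continuous fun v : BoundedContinuousFunction (Eu m) ℝ => v x :=
      continuous_eval_const _
    have c2 : Continuous fun v : BoundedContinuousFunction (Eu m) ℝ => v y :=
      continuous_eval_const _
    fun_prop
  have : CompleteSpace S := hS.completeSpace_coe
  have : Nonempty S := ⟨⟨0, fun x y => by simp; positivity⟩⟩
  have hT : ∀ v : S, ∃ u : S, ContDiff ℝ 2 (u.1 : Eu m → ℝ) ∧
      ∀ x, K * u.1 x - (1/2) * lap u.1 x + H (fderiv ℝ u.1 x) = g x + (K - ε) * v.1 x := by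
    intro v
    obtain ⟨u, hu, ⟨C, hC⟩, hl, heq⟩ := hex2 v.1 v.2 ⟨‖v.1‖, fun x => v.1.norm_coe_le_norm x⟩
    exact ⟨⟨BoundedContinuousFunction.ofNormedAddCommGroup u hu.continuous C hC, hl⟩, hu, heq⟩
  choose T hTc hTe using hT
  have hq0 : 0 ≤ (K - ε) / K := div_nonneg (sub_pos.2 hK).le hK0.le
  have hcon : ContractingWith ((K - ε) / K).toNNReal T := by
    refine ⟨?_, LipschitzWith.of_dist_le_mul fun v w => ?_⟩
    · rw [Real.toNNReal_lt_one, div_lt_one hK0]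
      linarith
    · rw [Real.coe_toNNReal _ hq0, Subtype.dist_eq, BoundedContinuousFunction.dist_le (by positivity)]
      have key : ∀ v w : S, ∀ x, (T v).1 x - (T w).1 x ≤ (K - ε) / K * dist v w := by
        intro v w x
        have := comparison (u := (T v).1) (v := (T w).1) (D := (K - ε) * dist v w)
          (C := max ‖(T v).1‖ ‖(T w).1‖) hK0 hH hΛ (hTc v) (hTc w)
          (fun x => ((T v).1.norm_coe_le_norm x).trans (le_max_left _ _))
          (fun x => ((T w).1.norm_coe_le_norm x).trans (le_max_right _ _))
          (fun x => (hTe v x).le) (fun x => (hTe w x).ge) (fun x => by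
            have h1 := BoundedContinuousFunction.dist_coe_le_dist (f := v.1) (g := w.1) x
            rw [Real.dist_eq] at h1
            have h2 := (le_abs_self _).trans h1
            have h3 := mul_le_mul_of_nonneg_left h2 (sub_pos.2 hK).le
            rw [Subtype.dist_eq]
            linarith) x
        calc _ ≤ _ := this
          _ = _ := by ring
      intro x
      rw [Real.dist_eq, abs_le]
      have h1 := key v w x
      have h2 := key w v x
      rw [dist_comm] at h2
      constructor <;> linarith
  set u := hcon.fixedPoint T with hu
  have hfix : T u = u := hcon.fixedPoint_isFixedPt
  have h1 := hTc u
  have h2 := hTe u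
  rw [hfix] at h1 h2
  refine ⟨u.1, h1, ⟨‖u.1‖, fun x => u.1.norm_coe_le_norm x⟩, u.2, fun x => ?_⟩
  have := h2 x
  linarith

lemma rpow_lip {θ N a b : ℝ} (hθ : 1 < θ) (ha : a ∈ Set.Icc 0 N) (hb : b ∈ Set.Icc 0 N) :
    |a ^ θ - b ^ θ| ≤ θ * N ^ (θ - 1) * |a - b| := by
  have := Convex.norm_image_sub_le_of_norm_hasDerivWithin_le (f := fun t : ℝ => t ^ θ)
    (f' := fun t : ℝ => θ * t ^ (θ - 1)) (s := Set.Icc 0 N) (C := θ * N ^ (θ - 1))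
    (fun x hx => (Real.hasDerivAt_rpow_const (Or.inr hθ.le)).hasDerivWithinAt)
    (fun x hx => by
      rw [Real.norm_eq_abs, abs_of_nonneg (by have := hx.1; positivity)]
      have := hx.1
      have h2 : x ^ (θ - 1) ≤ N ^ (θ - 1) := Real.rpow_le_rpow hx.1 hx.2 (by linarith)
      have : 0 ≤ θ := by linarith
      gcongr) (convex_Icc _ _) hb ha
  simpa [Real.norm_eq_abs] using this

lemma exists3 {θ ε L Mg : ℝ} (hθ : 1 < θ) (hε : 0 < ε) {g : Eu m → ℝ} (hL : 0 ≤ L)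
    (hg : ∀ x y, |g x - g y| ≤ L * ‖x - y‖) (hgb : ∀ x, |g x| ≤ Mg) :
    ∃ u, ContDiff ℝ 2 u ∧ (∀ x, ε * u x - (1/2) * lap u x + (1/θ) * ‖fderiv ℝ u x‖ ^ θ = g x) ∧
      ∀ w, ContDiff ℝ 2 w → (∃ C, ∀ x, |w x| ≤ C) →
        (∀ x, ε * w x - (1/2) * lap w x + (1/θ) * ‖fderiv ℝ w x‖ ^ θ ≤ g x) → ∀ x, w x ≤ u x := by
  set N := L / ε with hN
  have hN0 : 0 ≤ N := by positivity
  have hθ0 : 0 < θ := by linarith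
  set H : (Eu m →L[ℝ] ℝ) → ℝ := fun p => (1/θ) * (min ‖p‖ N) ^ θ with hHd
  have hH : ∀ p p', |H p - H p'| ≤ N ^ (θ - 1) * ‖p - p'‖ := by
    intro p p'
    have a1 := rpow_lip (N := N) hθ (a := min ‖p‖ N) (b := min ‖p'‖ N)
      ⟨by positivity, min_le_right _ _⟩ ⟨by positivity, min_le_right _ _⟩
    have a2 : |min ‖p‖ N - min ‖p'‖ N| ≤ ‖p - p'‖ := by
      have b1 := abs_min_sub_min_le_max ‖p‖ N ‖p'‖ N
      rw [sub_self, abs_zero, max_eq_left (abs_nonneg _)] at b1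
      exact b1.trans (abs_norm_sub_norm_le _ _)
    simp only [hHd]
    rw [← mul_sub, abs_mul, abs_of_pos (by positivity), one_div, inv_mul_le_iff₀ hθ0]
    refine a1.trans ?_
    rw [mul_assoc]
    gcongr
  obtain ⟨u, hu, ⟨C, hC⟩, hl, heq⟩ := exists2 hε (by positivity) hH hL hg hgb
  have hD : ∀ x, ‖fderiv ℝ u x‖ ≤ N := fun x => by
    refine norm_fderiv_le_of_lip' ℝ hN0 (Eventually.of_forall fun y => ?_)
    rw [Real.norm_eq_abs]
    exact hl y x
  refine ⟨u, hu, fun x => ?_, ?_⟩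
  · rw [← heq x]
    simp only [hHd, min_eq_left (hD x)]
  · rintro w hw ⟨C', hC'⟩ hs x
    have := comparison (u := w) (v := u) (D := 0) (C := max C' C) hε hH (by positivity) hw hu
      (fun x => (hC' x).trans (le_max_left _ _)) (fun x => (hC x).trans (le_max_right _ _))
      (g1 := g) (g2 := g) (fun x => by
        refine le_trans ?_ (hs x)
        simp only [hHd]
        have : (min ‖fderiv ℝ w x‖ N) ^ θ ≤ ‖fderiv ℝ w x‖ ^ θ :=
          Real.rpow_le_rpow (by positivity) (min_le_left _ _) hθ0.le
        gcongr) (fun x => (heq x).ge) (by simp) x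
    rw [zero_div] at this
    linarith
end ex
end EP

open Filter Topology MeasureTheory
namespace EP
set_option linter.unusedSectionVars false

section bern
variable {m : ℕ}

noncomputable def dq (h : ℝ) (i : Fin m) (u : Eu m → ℝ) (x : Eu m) : ℝ := (u (x + h • ev i) - u x) * h⁻¹

lemma dq_contDiff {n : WithTop ℕ∞} {u : Eu m → ℝ} (hu : ContDiff ℝ n u) (h : ℝ) (i : Fin m) :
    ContDiff ℝ n (dq h i u) :=
  ((hu.comp (contDiff_id.add contDiff_const)).sub hu).mul contDiff_const

lemma dq_fderiv {u : Eu m → ℝ} (hu : ContDiff ℝ 1 u) (h : ℝ) (i j : Fin m) (x : Eu m) :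
    pd j (dq h i u) x = dq h i (pd j u) x := by
  have d1 : DifferentiableAt ℝ u x := hu.differentiable (by norm_num) x
  have d2 : DifferentiableAt ℝ (fun y => u (y + h • ev i)) x :=
    (hu.comp (contDiff_id.add contDiff_const)).differentiable (by norm_num) x
  unfold dq pd
  rw [fderiv_mul_const (d2.fun_sub d1), fderiv_fun_sub d2 d1, fderiv_trans]
  simp [mul_comm]

lemma dq_lap {u : Eu m → ℝ} (hu : ContDiff ℝ 2 u) (h : ℝ) (i : Fin m) (x : Eu m) :
    lap (dq h i u) x = dq h i (lap u) x := by
  have d2 : ContDiff ℝ 2 (fun y => u (y + h • ev i)) := hu.comp (contDiff_id.add contDiff_const)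
  unfold dq
  rw [lap_mul (d2.sub hu).contDiffAt contDiffAt_const, lap_sub d2.contDiffAt hu.contDiffAt, lap_trans, lap_const]
  have : ∀ i, pd i (fun _ : Eu m => h⁻¹) x = 0 := fun i => by simp [pd]
  simp only [this]
  simp
  ring

lemma dq_lim {G : Eu m → ℝ} {x0 : Eu m} (hG : ContDiffAt ℝ 1 G x0) {h : ℕ → ℝ} {x : ℕ → Eu m}
    (hh : Tendsto h atTop (𝓝 0)) (hh0 : ∀ n, h n ≠ 0) (hx : Tendsto x atTop (𝓝 x0)) (i : Fin m) :
    Tendsto (fun n => dq (h n) i G (x n)) atTop (𝓝 (pd i G x0)) := by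
  have hs := hG.hasStrictFDerivAt (by norm_num)
  have h1 := hs.isLittleO
  have ht : Tendsto (fun n => (x n + h n • ev i, x n)) atTop (𝓝 (x0, x0)) := by
    have h2 : Tendsto (fun n => x n + h n • (ev i : Eu m)) atTop (𝓝 (x0 + (0:ℝ) • ev i)) :=
      hx.add (hh.smul_const _)
    rw [zero_smul, add_zero] at h2
    exact h2.prodMk_nhds hx
  have h3 := h1.comp_tendsto ht
  have h4 : (fun n => G (x n + h n • ev i) - G (x n) - fderiv ℝ G x0 (h n • ev i)) =o[atTop] h := by
    refine Asymptotics.IsLittleO.trans_isBigO (g := fun n => h n • (ev i : Eu m)) ?_ ?_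
    · refine h3.congr (fun n => ?_) fun n => ?_
      · simp
      · simp
    · refine Asymptotics.IsBigO.of_bound 1 (Eventually.of_forall fun n => ?_)
      rw [norm_smul, norm_ev]
      simp
  have h5 := h4.tendsto_div_nhds_zero
  have h6 := h5.add_const (pd i G x0)
  rw [zero_add] at h6
  refine h6.congr fun n => ?_
  have := hh0 n
  simp only [dq, pd, map_smul, smul_eq_mul]
  field_simp
  ring


lemma lap_sum {ι : Type*} (s : Finset ι) {g : ι → Eu m → ℝ} (hg : ∀ i, ContDiff ℝ 2 (g i)) (x : Eu m) :
    lap (fun y => ∑ i ∈ s, g i y) x = ∑ i ∈ s, lap (g i) x := by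
  classical
  induction s using Finset.induction_on with
  | empty => simpa using lap_const 0 x
  | insert a s ha ih =>
    simp only [Finset.sum_insert ha]
    rw [lap_add (hg a).contDiffAt (ContDiff.sum fun i _ => hg i).contDiffAt, ih]

lemma lap_sq {g : Eu m → ℝ} (hg : ContDiff ℝ 2 g) (x : Eu m) :
    lap (fun y => g y ^ 2) x = 2 * g x * lap g x + 2 * ∑ j, (pd j g x) ^ 2 := by
  have := lap_mul (x := x) hg.contDiffAt hg.contDiffAt
  simp only [← pow_two] at this
  rw [this]
  ring

lemma pd_sq {g : Eu m → ℝ} (hg : ContDiff ℝ 2 g) (x : Eu m) (j : Fin m) :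
    pd j (fun y => g y ^ 2) x = 2 * g x * pd j g x := by
  have d := hg.differentiable (by norm_num) x
  have : (fun y => g y ^ 2) = fun y => g y * g y := by ext; ring
  rw [this]
  unfold pd
  rw [fderiv_fun_mul d d]
  simp
  ring

/-- one step of the Bernstein argument, for difference quotients -/
lemma bern_step {u χ : Eu m → ℝ} (hu : ContDiff ℝ 2 u) (hχ : ContDiff ℝ 2 χ) (h : ℝ) {x : Eu m}
    (hmax : IsLocalMax (fun y => χ y * ∑ i, (dq h i u y) ^ 2) x) :
    (∀ j, χ x * (∑ i, 2 * dq h i u x * dq h i (pd j u) x) + (∑ i, (dq h i u x) ^ 2) * pd j χ x = 0) ∧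
    χ x * (∑ i, (2 * dq h i u x * dq h i (lap u) x + 2 * ∑ j, (dq h i (pd j u) x) ^ 2))
      + (∑ i, (dq h i u x) ^ 2) * lap χ x
      + 2 * ∑ j, pd j χ x * (∑ i, 2 * dq h i u x * dq h i (pd j u) x) ≤ 0 := by
  have hu1 : ContDiff ℝ 1 u := hu.of_le (by norm_num)
  have hd : ∀ i, ContDiff ℝ 2 (dq h i u) := fun i => dq_contDiff hu h i
  have hd2 : ∀ i, ContDiff ℝ 2 (fun y => dq h i u y ^ 2) := fun i => (hd i).pow 2
  have hW : ContDiff ℝ 2 (fun y => ∑ i, (dq h i u y) ^ 2) := ContDiff.sum fun i _ => hd2 i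
  have hpd : ∀ j, pd j (fun y => ∑ i, (dq h i u y) ^ 2) x = ∑ i, 2 * dq h i u x * dq h i (pd j u) x := by
    intro j
    rw [pd_sum (fun i _ => (hd2 i).differentiable (by norm_num) x)]
    refine Finset.sum_congr rfl fun i _ => ?_
    rw [← dq_fderiv hu1]
    exact pd_sq (hd i) x j
  constructor
  · intro j
    have h0 : pd j (fun y => χ y * ∑ i, (dq h i u y) ^ 2) x = 0 := by
      unfold pd
      rw [fderiv_zero_of_max hmax]
      rfl
    rw [pd_mul (hχ.differentiable (by norm_num) x) (hW.differentiable (by norm_num) x)] at h0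
    rw [← hpd j]
    exact h0
  · have h0 := lap_nonpos (hχ.mul hW).contDiffAt hmax
    rw [lap_mul hχ.contDiffAt hW.contDiffAt, lap_sum _ hd2] at h0
    simp only [lap_sq (hd _), dq_lap hu, dq_fderiv hu1, hpd] at h0
    exact h0

lemma bern_limit {u f χ : Eu m → ℝ} (hu : ContDiff ℝ 2 u) (hχ : ContDiff ℝ 2 χ) {c : Eu m} {ε θ L : ℝ}
    (hχ0 : ∀ x ∈ Metric.closedBall c 1, 0 ≤ χ x) (hχ1 : ∀ x ∈ Metric.sphere c 1, χ x = 0)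
    (hc : 0 < χ c) (hDc : fderiv ℝ u c ≠ 0)
    (heq : ∀ x ∈ Metric.ball c 2, ε * u x - (1/2) * lap u x + (1/θ) * ‖fderiv ℝ u x‖ ^ θ = f x)
    (hf : ∀ x ∈ Metric.ball c 2, ∀ y ∈ Metric.ball c 2, |f x - f y| ≤ L * ‖x - y‖) :
    ∃ x0 ∈ Metric.ball c 1, χ c * ‖fderiv ℝ u c‖ ^ 2 ≤ χ x0 * ‖fderiv ℝ u x0‖ ^ 2 ∧ 0 < χ x0 ∧
      fderiv ℝ u x0 ≠ 0 ∧
      (∀ j, χ x0 * (∑ i, 2 * pd i u x0 * pd i (pd j u) x0) + ‖fderiv ℝ u x0‖ ^ 2 * pd j χ x0 = 0) ∧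
      χ x0 * (∑ i, (4 * pd i u x0 * (pd i (fun y => ε * u y + (1/θ) * ‖fderiv ℝ u y‖ ^ θ) x0) - 4 * L * |pd i u x0|
          + 2 * ∑ j, (pd i (pd j u) x0) ^ 2)) + ‖fderiv ℝ u x0‖ ^ 2 * lap χ x0
        + 2 * ∑ j, pd j χ x0 * (∑ i, 2 * pd i u x0 * pd i (pd j u) x0) ≤ 0 := by
  have hu1 : ContDiff ℝ 1 u := hu.of_le (by norm_num)
  set F : Eu m → ℝ := fun y => ε * u y + (1/θ) * ‖fderiv ℝ u y‖ ^ θ with hF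
  set h : ℕ → ℝ := fun n => 1 / ((n:ℝ) + 2) with hh
  have hhp : ∀ n, 0 < h n := fun n => by simp only [hh]; positivity
  have hh1 : ∀ n, h n < 1 := fun n => by
    simp only [hh]
    rw [div_lt_one (by positivity)]
    have : (0:ℝ) ≤ n := Nat.cast_nonneg n
    linarith
  have hhl : Tendsto h atTop (𝓝 0) := by
    refine tendsto_const_nhds.div_atTop ?_
    exact tendsto_atTop_add_const_right _ _ tendsto_natCast_atTop_atTop
  set Z : ℝ → Eu m → ℝ := fun t y => χ y * ∑ i, (dq t i u y) ^ 2 with hZ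
  have hZc : ∀ t, Continuous (Z t) := fun t =>
    (hχ.mul (ContDiff.sum fun i _ => (dq_contDiff hu t i).pow 2)).continuous
  have hex : ∀ n, ∃ x ∈ Metric.closedBall c 1, ∀ y ∈ Metric.closedBall c 1, Z (h n) y ≤ Z (h n) x := fun n =>
    (isCompact_closedBall c 1).exists_isMaxOn ⟨c, by simp⟩ (hZc _).continuousOn
  choose x' hx' hxm' using hex
  obtain ⟨x0, hx0, σ, hσ, hlim⟩ := (isCompact_closedBall c (1:ℝ)).tendsto_subseq hx'
  set x : ℕ → Eu m := x' ∘ σ with hxd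
  set t : ℕ → ℝ := h ∘ σ with htd
  have htl : Tendsto t atTop (𝓝 0) := hhl.comp hσ.tendsto_atTop
  have htp : ∀ n, 0 < t n := fun n => hhp _
  have ht1 : ∀ n, t n < 1 := fun n => hh1 _
  have ht0 : ∀ n, t n ≠ 0 := fun n => (htp n).ne'
  have hx : ∀ n, x n ∈ Metric.closedBall c 1 := fun n => hx' _
  have hxm : ∀ n, ∀ y ∈ Metric.closedBall c 1, Z (t n) y ≤ Z (t n) (x n) := fun n => hxm' _
  have hlu : ∀ (y : ℕ → Eu m) (y0 : Eu m), Tendsto y atTop (𝓝 y0) → ∀ i,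
      Tendsto (fun n => dq (t n) i u (y n)) atTop (𝓝 (pd i u y0)) := fun y y0 hy i =>
    dq_lim hu1.contDiffAt htl ht0 hy i
  have hW : ∀ y : Eu m, ‖fderiv ℝ u y‖ ^ 2 = ∑ i, (pd i u y) ^ 2 := fun y => clm_norm_sq _
  have hlW : ∀ (y : ℕ → Eu m) (y0 : Eu m), Tendsto y atTop (𝓝 y0) →
      Tendsto (fun n => ∑ i, (dq (t n) i u (y n)) ^ 2) atTop (𝓝 (‖fderiv ℝ u y0‖ ^ 2)) := by
    intro y y0 hy
    rw [hW]
    exact tendsto_finsetSum _ fun i _ => (hlu y y0 hy i).pow 2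
  have hlZ : ∀ (y : ℕ → Eu m) (y0 : Eu m), Tendsto y atTop (𝓝 y0) →
      Tendsto (fun n => Z (t n) (y n)) atTop (𝓝 (χ y0 * ‖fderiv ℝ u y0‖ ^ 2)) := fun y y0 hy =>
    ((hχ.continuous.tendsto y0).comp hy).mul (hlW y y0 hy)
  have hZle : χ c * ‖fderiv ℝ u c‖ ^ 2 ≤ χ x0 * ‖fderiv ℝ u x0‖ ^ 2 :=
    le_of_tendsto_of_tendsto' (hlZ (fun _ => c) c tendsto_const_nhds) (hlZ x x0 hlim)
      fun n => hxm n c (by simp)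
  have hcpos : 0 < χ c * ‖fderiv ℝ u c‖ ^ 2 := by
    have := norm_pos_iff.2 hDc
    positivity
  have hpos := hcpos.trans_le hZle
  have hD0 : fderiv ℝ u x0 ≠ 0 := by
    intro h0
    rw [h0] at hpos
    simp at hpos
  have hχx0 : 0 < χ x0 := by
    rcases (hχ0 x0 hx0).lt_or_eq with h1 | h1
    · exact h1
    · rw [← h1] at hpos
      simp at hpos
  have hx0b : x0 ∈ Metric.ball c 1 := by
    rw [Metric.mem_ball]
    refine lt_of_le_of_ne hx0 fun h1 => ?_
    rw [hχ1 x0 h1] at hχx0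
    exact lt_irrefl _ hχx0
  have hev : ∀ᶠ n in atTop, x n ∈ Metric.ball c 1 := hlim (Metric.isOpen_ball.mem_nhds hx0b)
  have hstep : ∀ᶠ n in atTop, _ := hev.mono fun n hn => bern_step hu hχ (t n) (x := x n) (by
    filter_upwards [Metric.isOpen_ball.mem_nhds hn] with y hy
    exact hxm n y (Metric.ball_subset_closedBall hy))
  have hFc : ContDiffAt ℝ 1 F x0 := by
    have h1 : ContDiffAt ℝ 1 (fun y => ‖fderiv ℝ u y‖ ^ θ) x0 := by
      have e : (fun y => ‖fderiv ℝ u y‖ ^ θ) = fun y => (∑ i, (pd i u y) ^ 2) ^ (θ / 2) := by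
        ext y
        rw [← hW, ← Real.rpow_natCast, ← Real.rpow_mul (norm_nonneg _)]
        congr 1
        push_cast
        ring
      rw [e]
      refine ContDiffAt.rpow_const_of_ne (ContDiff.sum fun i _ => (pd_contDiff hu i).pow 2).contDiffAt ?_
      rw [← hW]
      have := norm_pos_iff.2 hD0
      positivity
    exact (contDiffAt_const.mul hu1.contDiffAt).add (contDiffAt_const.mul h1)
  have hlH : ∀ i j, Tendsto (fun n => dq (t n) i (pd j u) (x n)) atTop (𝓝 (pd i (pd j u) x0)) := fun i j =>
    dq_lim (pd_contDiff hu j).contDiffAt htl ht0 hlim i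
  have hlF : ∀ i, Tendsto (fun n => dq (t n) i F (x n)) atTop (𝓝 (pd i F x0)) := fun i =>
    dq_lim hFc htl ht0 hlim i
  have hpχ : ∀ j, Tendsto (fun n => pd j χ (x n)) atTop (𝓝 (pd j χ x0)) := fun j =>
    ((pd_contDiff hχ j).continuous.tendsto x0).comp hlim
  have hlχ : Tendsto (fun n => χ (x n)) atTop (𝓝 (χ x0)) := (hχ.continuous.tendsto x0).comp hlim
  have hllχ : Tendsto (fun n => lap χ (x n)) atTop (𝓝 (lap χ x0)) := ((cont_lap hχ).tendsto x0).comp hlim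
  have hlY : ∀ j, Tendsto (fun n => ∑ i, 2 * dq (t n) i u (x n) * dq (t n) i (pd j u) (x n)) atTop
      (𝓝 (∑ i, 2 * pd i u x0 * pd i (pd j u) x0)) := fun j =>
    tendsto_finsetSum _ fun i _ => ((hlu x x0 hlim i).const_mul 2).mul (hlH i j)
  refine ⟨x0, hx0b, hZle, hχx0, hD0, fun j => ?_, ?_⟩
  · have h1 := (hlχ.mul (hlY j)).add ((hlW x x0 hlim).mul (hpχ j))
    refine tendsto_nhds_unique (h1.congr' ?_) tendsto_const_nhds
    filter_upwards [hstep] with n hn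
    exact hn.1 j
  · have h1 := ((hlχ.mul (tendsto_finsetSum Finset.univ fun i _ =>
      ((((hlu x x0 hlim i).const_mul 4).mul (hlF i)).sub ((hlu x x0 hlim i).abs.const_mul (4 * L))).add
        ((tendsto_finsetSum Finset.univ fun j _ => (hlH i j).pow 2).const_mul 2))).add
        ((hlW x x0 hlim).mul hllχ)).add
        ((tendsto_finsetSum Finset.univ fun j _ => (hpχ j).mul (hlY j)).const_mul 2)
    refine le_of_tendsto h1 ?_
    filter_upwards [hstep] with n hn
    refine le_trans ?_ hn.2
    have hc0 := hχ0 _ (hx n)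
    gcongr with i
    have hin : x n ∈ Metric.ball c 2 := Metric.closedBall_subset_ball (by norm_num) (hx n)
    have hin2 : x n + t n • ev i ∈ Metric.ball c 2 := by
      have a1 := hx n
      rw [Metric.mem_closedBall, dist_eq_norm] at a1
      rw [Metric.mem_ball, dist_eq_norm]
      have a2 : x n + t n • ev i - c = (x n - c) + t n • ev i := by abel
      rw [a2]
      have a3 := norm_add_le (x n - c) (t n • ev i)
      rw [norm_smul, norm_ev, Real.norm_eq_abs, abs_of_pos (htp n)] at a3
      have := ht1 n
      linarith
    have e1 := heq _ hin
    have e2 := heq _ hin2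
    have e3 := hf _ hin2 _ hin
    rw [add_sub_cancel_left, norm_smul, norm_ev, Real.norm_eq_abs, abs_of_pos (htp n), mul_one] at e3
    have e4 : dq (t n) i (lap u) (x n) = 2 * dq (t n) i F (x n) - 2 * dq (t n) i f (x n) := by
      simp only [dq, hF]
      rw [← e1, ← e2]
      ring
    have e5 : |dq (t n) i f (x n)| ≤ L := by
      unfold dq
      rw [abs_mul, abs_of_pos (a := (t n)⁻¹) (inv_pos.2 (htp n)), ← div_eq_mul_inv, div_le_iff₀ (htp n)]
      exact e3
    rw [e4]
    have e6 : dq (t n) i u (x n) * dq (t n) i f (x n) ≤ L * |dq (t n) i u (x n)| := by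
      refine (le_abs_self _).trans ?_
      rw [abs_mul, mul_comm]
      gcongr
    linarith

end bern
end EP

open Filter Topology MeasureTheory
namespace EP
set_option linter.unusedSectionVars false

section bern
variable {m : ℕ}

noncomputable def bmp (n : ℕ) (c x : Eu m) : ℝ := (1 - ‖x - c‖ ^ 2) ^ (n + 1)

lemma bmp_cd (n : ℕ) (c : Eu m) : ContDiff ℝ 2 (bmp n c) :=
  (contDiff_const.sub (contDiff_normsq c)).pow _

lemma bmp_facts (n : ℕ) (c x : Eu m) (hx : ‖x - c‖ ≤ 1) :
    ∑ j, (pd j (bmp n c) x) ^ 2 ≤ (2 * ((n:ℝ) + 1) * (1 - ‖x - c‖ ^ 2) ^ n) ^ 2 ∧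
    -(2 * m * ((n:ℝ) + 1) * (1 - ‖x - c‖ ^ 2) ^ n) ≤ lap (bmp n c) x := by
  set t := ‖x - c‖ ^ 2 with ht
  have ht1 : t ≤ 1 := by rw [ht]; nlinarith [norm_nonneg (x - c)]
  have ht0 : 0 ≤ t := by positivity
  have hξ : 0 ≤ 1 - t := by linarith
  have hd : ∀ (l : ℕ) (s : ℝ), HasDerivAt (fun s : ℝ => (1 - s) ^ (l)) (-((l:ℝ) * (1 - s) ^ (l-1))) s := by
    intro l s
    have := ((hasDerivAt_id s).const_sub 1).pow l
    refine HasDerivAt.congr_deriv this ?_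
    simp only [id]
    ring
  have hd1 : ∀ s : ℝ, HasDerivAt (fun s : ℝ => (1 - s) ^ (n+1)) (-((n:ℝ)+1) * (1 - s) ^ n) s := by
    intro s
    have := hd (n+1) s
    refine HasDerivAt.congr_deriv this ?_
    push_cast
    ring
  have hd2 : HasDerivAt (fun s : ℝ => -((n:ℝ)+1) * (1 - s) ^ n) (-((n:ℝ)+1) * -((n:ℝ) * (1 - t) ^ (n-1))) t :=
    (hd n t).const_mul _
  constructor
  · have e : ∀ j, pd j (bmp n c) x = (-((n:ℝ)+1) * (1 - t) ^ n) * pd j (fun y : Eu m => ‖y - c‖^2) x := fun j =>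
      pd_comp (φ := fun y : Eu m => ‖y - c‖^2) (g := fun s : ℝ => (1 - s) ^ (n+1))
          ((contDiff_normsq (n := 2) c).differentiable (by norm_num) x) (hd1 t) j
    simp only [e, mul_pow _ _ 2]
    rw [← Finset.mul_sum, sum_pd_normsq, ← ht]
    have h3 : 0 ≤ ((n:ℝ)+1)^2 * ((1 - t) ^ n)^2 := by positivity
    nlinarith
  · have := lap_comp (φ := fun y : Eu m => ‖y - c‖^2) (g := fun s : ℝ => (1 - s) ^ (n+1)) (x := x)
      (contDiff_normsq c).contDiffAt (by fun_prop) (Eventually.of_forall hd1) hd2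
    rw [lap_normsq, sum_pd_normsq, ← ht] at this
    have e : lap (bmp n c) x = _ := this
    rw [e]
    have h4 : 0 ≤ -((n:ℝ)+1) * -((n:ℝ) * (1 - t) ^ (n-1)) * (4 * t) := by
      have : 0 ≤ ((n:ℝ)+1) * ((n:ℝ) * (1 - t) ^ (n-1)) * (4 * t) := by positivity
      linarith
    linarith

lemma pdF {u : Eu m → ℝ} (hu : ContDiff ℝ 2 u) {ε θ : ℝ} (hθ : 1 < θ) {x0 : Eu m} (hD0 : fderiv ℝ u x0 ≠ 0) (i : Fin m) :
    pd i (fun y => ε * u y + (1/θ) * ‖fderiv ℝ u y‖ ^ θ) x0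
      = ε * pd i u x0 + (‖fderiv ℝ u x0‖ ^ 2) ^ (θ / 2 - 1) * ∑ j, pd j u x0 * pd i (pd j u) x0 := by
  have hW : ∀ y : Eu m, ‖fderiv ℝ u y‖ ^ 2 = ∑ i, (pd i u y) ^ 2 := fun y => clm_norm_sq _
  have e : (fun y => ‖fderiv ℝ u y‖ ^ θ) = fun y => (∑ i, (pd i u y) ^ 2) ^ (θ / 2) := by
    ext y
    rw [← hW, ← Real.rpow_natCast, ← Real.rpow_mul (norm_nonneg _)]
    congr 1
    push_cast
    ring
  have hne : ∑ i, (pd i u x0) ^ 2 ≠ 0 := by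
    rw [← hW]
    have := norm_pos_iff.2 hD0
    positivity
  have hp : ∀ j, DifferentiableAt ℝ (pd j u) x0 := fun j => (pd_contDiff hu j).differentiable (by norm_num) x0
  have hp2 : ∀ j, DifferentiableAt ℝ (fun y => (pd j u y) ^ 2) x0 := fun j => (hp j).pow 2
  have hWd : DifferentiableAt ℝ (fun y => ∑ i, (pd i u y) ^ 2) x0 :=
    DifferentiableAt.fun_sum fun i _ => hp2 i
  have h1 : pd i (fun y => ‖fderiv ℝ u y‖ ^ θ) x0 =
      (θ / 2) * (‖fderiv ℝ u x0‖ ^ 2) ^ (θ / 2 - 1) * ∑ j, 2 * pd j u x0 * pd i (pd j u) x0 := by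
    rw [e, hW, pd_comp (φ := fun y => ∑ i, (pd i u y) ^ 2) (g := fun t : ℝ => t ^ (θ/2)) hWd
      (Real.hasDerivAt_rpow_const (Or.inl hne)) i, pd_sum (fun j _ => hp2 j)]
    congr 1
    refine Finset.sum_congr rfl fun j _ => ?_
    have := pd_mul (hp j) (hp j) i
    simp only [← pow_two] at this
    rw [this]
    ring
  have hGd : DifferentiableAt ℝ (fun y => ‖fderiv ℝ u y‖ ^ θ) x0 := by
    rw [e]
    exact hWd.rpow_const (Or.inl hne)
  have hud : DifferentiableAt ℝ u x0 := hu.differentiable (by norm_num) x0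
  rw [pd_add (hud.const_mul _) (hGd.const_mul _), pd_mul (differentiableAt_const _) hud,
    pd_mul (differentiableAt_const _) hGd, h1]
  have h0 : ∀ a : ℝ, pd i (fun _ : Eu m => a) x0 = 0 := fun a => by simp [pd]
  rw [h0, h0]
  have hs : ∑ j, 2 * pd j u x0 * pd i (pd j u) x0 = 2 * ∑ j, pd j u x0 * pd i (pd j u) x0 := by
    rw [Finset.mul_sum]
    exact Finset.sum_congr rfl fun j _ => by ring
  rw [hs]
  have : θ ≠ 0 := by linarith
  field_simp
  ring

lemma bern_alg (p χd : Fin m → ℝ) (Hm : Fin m → Fin m → ℝ) {w ξ a k L E T ε lapχ : ℝ} (hξ : 0 < ξ) (ha : 0 < a)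
    (hw : 0 < w) (hk : 0 ≤ k) (hL : 0 ≤ L) (hε : 0 ≤ ε) (hE : 0 ≤ E) (hET : E * w ^ 2 = T)
    (hp : ∑ i, (p i) ^ 2 = w ^ 2)
    (h1 : ∑ j, (χd j) ^ 2 ≤ (2 * k * a) ^ 2) (h2 : -(2 * m * k * a) ≤ lapχ)
    (h3 : ∀ j, a * ξ * (∑ i, 2 * p i * Hm i j) + w ^ 2 * χd j = 0)
    (h4 : a * ξ * (∑ i, (4 * p i * (ε * p i + E * ∑ j, p j * Hm i j) - 4 * L * |p i|
          + 2 * ∑ j, (Hm i j) ^ 2)) + w ^ 2 * lapχ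
        + 2 * ∑ j, χd j * (∑ i, 2 * p i * Hm i j) ≤ 0) :
    ξ ^ 2 * (∑ i, ∑ j, (Hm i j) ^ 2) ≤ 2 * L * m * ξ ^ 2 * w + 2 * k * ξ * (T * w) + m * k * ξ * w ^ 2 + 4 * k ^ 2 * w ^ 2 := by
  set Y : Fin m → ℝ := fun j => ∑ i, 2 * p i * Hm i j with hY
  set S2 := ∑ i, ∑ j, (Hm i j) ^ 2 with hS2
  set A1 := ∑ i, |p i| with hA1
  set PY := ∑ j, p j * Y j with hPY
  set CY := ∑ j, χd j * Y j with hCY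
  set PC := ∑ j, p j * χd j with hPC
  set CC := ∑ j, χd j ^ 2 with hCC
  have hT : 0 ≤ T := by rw [← hET]; positivity
  have e1 : (∑ i, (4 * p i * (ε * p i + E * ∑ j, p j * Hm i j) - 4 * L * |p i|
          + 2 * ∑ j, (Hm i j) ^ 2)) = 4 * ε * w ^ 2 + 2 * E * PY - 4 * L * A1 + 2 * S2 := by
    have : PY = 2 * ∑ i, p i * ∑ j, p j * Hm i j := by
      simp only [hPY, hY, Finset.mul_sum]
      rw [Finset.sum_comm]
      exact Finset.sum_congr rfl fun i _ => Finset.sum_congr rfl fun j _ => by ring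
    rw [this, ← hp, hA1, hS2]
    simp only [Finset.sum_add_distrib, Finset.sum_sub_distrib, Finset.mul_sum, mul_add]
    congr 1
    congr 1
    congr 1
    · exact Finset.sum_congr rfl fun i _ => by ring
    · exact Finset.sum_congr rfl fun i _ => Finset.sum_congr rfl fun j _ => by ring
  have e2 : a * ξ * PY = - (w ^ 2 * PC) := by
    have : a * ξ * PY + w ^ 2 * PC = ∑ j, p j * (a * ξ * Y j + w ^ 2 * χd j) := by
      simp only [hPY, hPC, Finset.mul_sum, ← Finset.sum_add_distrib]
      exact Finset.sum_congr rfl fun j _ => by ring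
    rw [Finset.sum_eq_zero (fun j _ => by rw [h3 j, mul_zero])] at this
    linarith
  have e3 : a * ξ * CY = - (w ^ 2 * CC) := by
    have : a * ξ * CY + w ^ 2 * CC = ∑ j, χd j * (a * ξ * Y j + w ^ 2 * χd j) := by
      simp only [hCY, hCC, Finset.mul_sum, ← Finset.sum_add_distrib]
      exact Finset.sum_congr rfl fun j _ => by ring
    rw [Finset.sum_eq_zero (fun j _ => by rw [h3 j, mul_zero])] at this
    linarith
  have e4 : PC ≤ w * (2 * k * a) := by
    refine le_of_sq_le_sq ?_ (by positivity)
    have := Finset.sum_mul_sq_le_sq_mul_sq Finset.univ p χd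
    rw [hp] at this
    calc PC ^ 2 ≤ w ^ 2 * CC := this
      _ ≤ w ^ 2 * (2 * k * a) ^ 2 := by gcongr
      _ = _ := by ring
  have e5 : A1 ≤ m * w := by
    have : A1 ≤ ∑ _i : Fin m, w := Finset.sum_le_sum fun i _ => by
      refine abs_le_of_sq_le_sq ?_ hw.le
      rw [← hp]
      exact Finset.single_le_sum (f := fun i => p i ^ 2) (fun _ _ => sq_nonneg _) (Finset.mem_univ i)
    simpa using this
  rw [e1] at h4
  have h5 := mul_le_mul_of_nonneg_left h4 (show 0 ≤ a * ξ by positivity)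
  have q1 : a * ξ * (a * ξ * (2 * E * PY)) = - (2 * a * ξ * T * PC) := by
    rw [← hET]
    linear_combination (2 * a * ξ * E) * e2
  have q2 : 2 * a * ξ * T * PC ≤ 2 * a * ξ * T * (w * (2 * k * a)) := by gcongr
  have q3 : a * ξ * (w ^ 2 * -(2 * m * k * a)) ≤ a * ξ * (w ^ 2 * lapχ) := by gcongr
  have q4 : w ^ 2 * CC ≤ w ^ 2 * (2 * k * a) ^ 2 := by gcongr
  have q5 : a * ξ * (a * ξ * (4 * L * A1)) ≤ a * ξ * (a * ξ * (4 * L * (m * w))) := by gcongr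
  have q6 : 0 ≤ a * ξ * (a * ξ * (4 * ε * w ^ 2)) := by positivity
  have q7 : (2 * a ^ 2) * (ξ ^ 2 * S2) ≤ (2 * a ^ 2) * (2 * L * m * ξ ^ 2 * w + 2 * k * ξ * (T * w) + m * k * ξ * w ^ 2 + 4 * k ^ 2 * w ^ 2) := by
    nlinarith
  exact le_of_mul_le_mul_left q7 (by positivity)


lemma bern_fin {w ξ θ L C0 M k S2 l B : ℝ} {n : ℕ} (hθ : 1 < θ) (hL : 0 ≤ L) (hM : 0 ≤ M)
    (hn : 2 / (θ - 1) ≤ n) (hk0 : 0 < k) (hC0 : 0 ≤ C0) (hS2 : 0 ≤ S2)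
    (hB : B = θ ^ 2 * M * (2 * L * M + 2 * k + M * k + 4 * k ^ 2))
    (hξ0 : 0 < ξ) (hξ1 : ξ ≤ 1) (hw0 : 0 < w)
    (key : ξ ^ 2 * S2 ≤ 2 * L * M * ξ ^ 2 * w + 2 * k * ξ * (w ^ θ * w) + M * k * ξ * w ^ 2 + 4 * k ^ 2 * w ^ 2)
    (htr : l ^ 2 ≤ M * S2) (hE : 2 * (w ^ θ / θ - C0) ≤ l) :
    ξ ^ (n+1) * w ^ 2 ≤ 1 + (2 * θ * C0) ^ (2 / θ) + (B + 1) ^ (2 / (θ - 1)) := by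
  have hθ0 : 0 < θ := by linarith
  have hθ1 : 0 < θ - 1 := by linarith
  have hB0 : 0 ≤ B := by rw [hB]; positivity
  have r1 : 0 ≤ (2 * θ * C0) ^ (2 / θ) := by positivity
  have r2 : 0 ≤ (B + 1) ^ (2 / (θ - 1)) := by positivity
  have hξn : ξ ^ (n+1) ≤ 1 := pow_le_one₀ hξ0.le hξ1
  by_cases hw1 : w < 1
  · have : ξ ^ (n+1) * w ^ 2 ≤ 1 * 1 := by
      gcongr
      exact pow_le_one₀ hw0.le hw1.le
    linarith
  push Not at hw1
  by_cases hwC : w ^ θ ≤ 2 * θ * C0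
  · have a1 : w ^ 2 ≤ (2 * θ * C0) ^ (2 / θ) := by
      have a2 := Real.rpow_le_rpow (by positivity) hwC (show 0 ≤ 2 / θ by positivity)
      rw [← Real.rpow_mul hw0.le, mul_div_cancel₀ _ hθ0.ne'] at a2
      exact_mod_cast a2
    have : ξ ^ (n+1) * w ^ 2 ≤ 1 * w ^ 2 := by gcongr
    linarith
  push Not at hwC
  set V := w ^ (θ - 1) with hV
  have hV1 : 1 ≤ V := Real.one_le_rpow hw1 hθ1.le
  have hTV : w ^ θ = w * V := by
    rw [hV]
    nth_rewrite 2 [← Real.rpow_one w]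
    rw [← Real.rpow_add hw0]
    congr 1
    ring
  have hlow : w * V / θ ≤ l := by
    have a1 : C0 ≤ w ^ θ / θ / 2 := by
      rw [div_div, le_div_iff₀ (by positivity)]
      linarith
    rw [← hTV]
    linarith
  have hVS : (w * V) ^ 2 ≤ θ ^ 2 * (M * S2) := by
    have a1 : (w * V / θ) ^ 2 ≤ l ^ 2 := by gcongr
    have a2 := a1.trans htr
    rw [div_pow, div_le_iff₀ (by positivity)] at a2
    linarith
  have hy : ξ * V ≤ B + 1 := by
    have a1 : (ξ * V) ^ 2 * w ^ 2 ≤ B * (ξ * V + 1) * w ^ 2 := by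
      have s0 : ξ ^ 2 * (w * V) ^ 2 ≤ ξ ^ 2 * (θ ^ 2 * (M * S2)) := by gcongr
      have s1 : θ ^ 2 * M * (ξ ^ 2 * S2) ≤ θ ^ 2 * M * (2 * L * M * ξ ^ 2 * w + 2 * k * ξ * (w ^ θ * w) + M * k * ξ * w ^ 2 + 4 * k ^ 2 * w ^ 2) := by
        gcongr
      have s2 : ξ ^ 2 * w ≤ (ξ * V + 1) * w ^ 2 := by
        have : ξ ^ 2 ≤ ξ * V + 1 := by
          have u1 : ξ ^ 2 ≤ 1 := pow_le_one₀ hξ0.le hξ1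
          have u2 : 0 ≤ ξ * V := by positivity
          linarith
        have : w ≤ w ^ 2 := le_self_pow₀ hw1 (by norm_num)
        gcongr
      have s3 : ξ * (w ^ θ * w) ≤ (ξ * V + 1) * w ^ 2 := by
        rw [hTV]
        have : 0 ≤ w ^ 2 := by positivity
        linarith
      have s4 : ξ * w ^ 2 ≤ (ξ * V + 1) * w ^ 2 := by
        gcongr
        have : ξ * 1 ≤ ξ * V := by gcongr
        linarith
      have s5 : w ^ 2 ≤ (ξ * V + 1) * w ^ 2 := by
        have : 0 ≤ ξ * V * w ^ 2 := by positivity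
        linarith
      have t2 := mul_le_mul_of_nonneg_left s2 (show 0 ≤ θ ^ 2 * M * (2 * L * M) by positivity)
      have t3 := mul_le_mul_of_nonneg_left s3 (show 0 ≤ θ ^ 2 * M * (2 * k) by positivity)
      have t4 := mul_le_mul_of_nonneg_left s4 (show 0 ≤ θ ^ 2 * M * (M * k) by positivity)
      have t5 := mul_le_mul_of_nonneg_left s5 (show 0 ≤ θ ^ 2 * M * (4 * k ^ 2) by positivity)
      rw [hB]
      linarith
    have a2 := le_of_mul_le_mul_right a1 (by positivity)
    by_contra hcon
    push Not at hcon
    clear * - a2 hcon hB0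
    nlinarith
  have hw2 : w ^ 2 = V ^ (2 / (θ - 1)) := by
    rw [hV, ← Real.rpow_mul hw0.le, mul_div_cancel₀ _ hθ1.ne']
    norm_cast
  have hξk : ξ ^ (n+1) ≤ ξ ^ (2 / (θ - 1)) := by
    rw [← Real.rpow_natCast ξ (n+1)]
    refine Real.rpow_le_rpow_of_exponent_ge hξ0 hξ1 ?_
    push_cast
    linarith
  have : ξ ^ (n+1) * w ^ 2 ≤ (B + 1) ^ (2 / (θ - 1)) := by
    calc ξ ^ (n+1) * w ^ 2 ≤ ξ ^ (2 / (θ - 1)) * V ^ (2 / (θ - 1)) := by rw [hw2]; gcongr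
      _ = (ξ * V) ^ (2 / (θ - 1)) := (Real.mul_rpow hξ0.le (by positivity)).symm
      _ ≤ _ := Real.rpow_le_rpow (by positivity) hy (by positivity)
  linarith


lemma bernstein {θ L C0 : ℝ} (hθ : 1 < θ) (hL : 0 ≤ L) (hC0 : 0 ≤ C0) : ∃ C, 0 ≤ C ∧ ∀ (c : Eu m) (u f : Eu m → ℝ) (ε : ℝ),
    0 ≤ ε → ContDiff ℝ 2 u →
    (∀ x ∈ Metric.ball c 2, ε * u x - (1/2) * lap u x + (1/θ) * ‖fderiv ℝ u x‖ ^ θ = f x) →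
    (∀ x ∈ Metric.ball c 2, ∀ y ∈ Metric.ball c 2, |f x - f y| ≤ L * ‖x - y‖) →
    (∀ x ∈ Metric.ball c 1, f x - ε * u x ≤ C0) → ‖fderiv ℝ u c‖ ≤ C := by
  have hθ0 : 0 < θ := by linarith
  have hθ1 : 0 < θ - 1 := by linarith
  obtain ⟨n, hn⟩ := exists_nat_ge (2 / (θ - 1))
  set k : ℝ := (n:ℝ) + 1 with hk
  have hk0 : 0 < k := by positivity
  set B : ℝ := θ ^ 2 * m * (2 * L * m + 2 * k + m * k + 4 * k ^ 2) with hB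
  have hB0 : 0 ≤ B := by positivity
  set Q : ℝ := 1 + (2 * θ * C0) ^ (2 / θ) + (B + 1) ^ (2 / (θ - 1)) with hQ
  refine ⟨√Q, by positivity, fun c u f ε hε hu heq hf hfu => ?_⟩
  refine Real.le_sqrt_of_sq_le ?_
  by_cases hDc : fderiv ℝ u c = 0
  · rw [hDc, norm_zero]
    have : 0 ≤ Q := by positivity
    simpa using this
  have hχc : bmp n c c = 1 := by simp [bmp]
  obtain ⟨x0, hx0, hle, hχ0, hD0, h3, h4⟩ := bern_limit hu (bmp_cd n c) (c := c) (fun x hx => by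
      rw [Metric.mem_closedBall, dist_eq_norm] at hx
      refine pow_nonneg (sub_nonneg.2 (pow_le_one₀ (norm_nonneg _) hx)) _) (fun x hx => by
      rw [Metric.mem_sphere, dist_eq_norm] at hx
      simp [bmp, hx]) (by rw [hχc]; norm_num) hDc heq hf
  rw [hχc, one_mul] at hle
  refine hle.trans ?_
  have hxc : ‖x0 - c‖ < 1 := by rwa [Metric.mem_ball, dist_eq_norm] at hx0
  set ξ := 1 - ‖x0 - c‖ ^ 2 with hξ
  have hξ0 : 0 < ξ := by
    rw [hξ]
    exact sub_pos.2 (pow_lt_one₀ (norm_nonneg _) hxc (by norm_num))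
  have hξ1 : ξ ≤ 1 := by
    rw [hξ]
    exact sub_le_self _ (by positivity)
  have hχx : bmp n c x0 = ξ ^ n * ξ := by rw [bmp, pow_succ]
  set w := ‖fderiv ℝ u x0‖ with hw
  have hw0 : 0 < w := norm_pos_iff.2 hD0
  have hT : (w ^ 2) ^ (θ / 2 - 1) * w ^ 2 = w ^ θ := by
    rw [← Real.rpow_natCast w 2, ← Real.rpow_mul hw0.le, ← Real.rpow_add hw0]
    congr 1
    push_cast
    ring
  obtain ⟨b1, b2⟩ := bmp_facts n c x0 hxc.le
  simp only [pdF hu hθ hD0] at h4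
  rw [hχx] at h4
  simp only [hχx] at h3
  have key := bern_alg (fun i => pd i u x0) (fun j => pd j (bmp n c) x0) (fun i j => pd i (pd j u) x0)
    (w := w) hξ0 (show 0 < ξ ^ n by positivity) hw0 hk0.le hL hε (by positivity) hT
    (clm_norm_sq _).symm b1 b2 h3 h4
  have hlap := lap_eq_pd (hu.contDiffAt (x := x0))
  set S2 := ∑ i, ∑ j, (pd i (pd j u) x0) ^ 2 with hS2
  have htr : lap u x0 ^ 2 ≤ m * S2 := by
    rw [hlap]
    have a1 := sq_sum_le_card_mul_sum_sq (s := Finset.univ) (f := fun i => pd i (pd i u) x0)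
    rw [Finset.card_univ, Fintype.card_fin] at a1
    refine a1.trans ?_
    refine mul_le_mul_of_nonneg_left (Finset.sum_le_sum fun i _ => ?_) (Nat.cast_nonneg m)
    exact Finset.single_le_sum (f := fun j => pd i (pd j u) x0 ^ 2) (fun _ _ => sq_nonneg _) (Finset.mem_univ i)
  have hE0 := heq x0 (Metric.ball_subset_ball (by norm_num) hx0)
  have hF := hfu x0 hx0
  rw [hχx, ← pow_succ]
  refine bern_fin hθ hL (Nat.cast_nonneg m) hn hk0 hC0 (by positivity) hB hξ0 hξ1 hw0 key htr ?_
  have : 1 / θ * w ^ θ = w ^ θ / θ := by ring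
  rw [← hw, this] at hE0
  linarith

end bern
end EP

open Filter Topology MeasureTheory
namespace EP
set_option linter.unusedSectionVars false

section bar
variable {m : ℕ}

lemma bar_scal {θ M s r lam Cf k S0 : ℝ} (hθ : 1 < θ) (hM : 0 ≤ M) (hk : 1 ≤ k) (hk2 : 1 / (θ - 1) ≤ k)
    (hs : 1 ≤ s) (hr0 : 0 ≤ r) (hr : r ^ 2 = 1 - 1 / s)
    (hS : 2 ≤ S0) (hS2 : (M * k + 2 * k * (k + 1)) * θ ≤ S0 ^ (θ - 1))
    (h : lam ≤ Cf + M * k * s ^ (k + 1) + 2 * k * (k + 1) * r ^ 2 * s ^ (k + 2) - (1/θ) * (2 * r * k * s ^ (k + 1)) ^ θ) :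
    lam ≤ Cf + M * k * S0 ^ (k + 1) + 2 * k * (k + 1) * S0 ^ (k + 2) := by
  have hθ0 : 0 < θ := by linarith
  have hs0 : 0 < s := by linarith
  have hr1 : r ^ 2 ≤ 1 := by
    rw [hr]
    have : 0 ≤ 1 / s := by positivity
    linarith
  have hX : 0 ≤ (2 * r * k * s ^ (k + 1)) ^ θ := by positivity
  rcases le_or_gt s S0 with hc | hc
  · have a1 : M * k * s ^ (k + 1) ≤ M * k * S0 ^ (k + 1) := by gcongr
    have a2 : 2 * k * (k + 1) * r ^ 2 * s ^ (k + 2) ≤ 2 * k * (k + 1) * 1 * S0 ^ (k + 2) := by gcongr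
    have a3 : 0 ≤ (1/θ) * (2 * r * k * s ^ (k + 1)) ^ θ := by positivity
    linarith
  · have hr2 : 1 ≤ 2 * r := by
      have : 1 / s ≤ 1 / 2 := by gcongr; linarith
      by_contra hcon
      push Not at hcon
      nlinarith
    have a1 : s ^ ((k + 1) * θ) ≤ (2 * r * k * s ^ (k + 1)) ^ θ := by
      rw [Real.rpow_mul hs0.le]
      refine Real.rpow_le_rpow (by positivity) ?_ hθ0.le
      have : 1 ≤ 2 * r * k := by nlinarith
      have h2 : 0 < s ^ (k + 1) := by positivity
      nlinarith
    have a2 : s ^ (k + 2) * s ^ (θ - 1) ≤ s ^ ((k + 1) * θ) := by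
      rw [← Real.rpow_add hs0]
      refine Real.rpow_le_rpow_of_exponent_le hs ?_
      rw [div_le_iff₀ (by linarith)] at hk2
      nlinarith
    have a3 : S0 ^ (θ - 1) ≤ s ^ (θ - 1) := Real.rpow_le_rpow (by linarith) hc.le (by linarith)
    have a4 : s ^ (k + 1) ≤ s ^ (k + 2) := Real.rpow_le_rpow_of_exponent_le hs (by linarith)
    have hs2 : 0 < s ^ (k + 2) := by positivity
    have a5 : s ^ (k + 2) * ((M * k + 2 * k * (k + 1)) * θ) ≤ (2 * r * k * s ^ (k + 1)) ^ θ := by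
      refine le_trans ?_ (a2.trans a1)
      gcongr
      exact hS2.trans a3
    have a6 : s ^ (k + 2) * (M * k + 2 * k * (k + 1)) ≤ (1/θ) * (2 * r * k * s ^ (k + 1)) ^ θ := by
      rw [one_div, le_inv_mul_iff₀ hθ0]
      linarith
    have a7 : M * k * s ^ (k + 1) ≤ M * k * s ^ (k + 2) := by gcongr
    have a8 : 2 * k * (k + 1) * r ^ 2 * s ^ (k + 2) ≤ 2 * k * (k + 1) * 1 * s ^ (k + 2) := by gcongr
    have a9 : 0 ≤ M * k * S0 ^ (k + 1) + 2 * k * (k + 1) * S0 ^ (k + 2) := by positivity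
    linarith

lemma barrier {θ Cf : ℝ} (hθ : 1 < θ) : ∃ C, ∀ (c : Eu m) (φ f : Eu m → ℝ) (lam : ℝ), ContDiff ℝ 2 φ →
    (∀ x ∈ Metric.ball c 1, f x ≤ Cf) →
    (∀ x ∈ Metric.ball c 1, -(1/2) * lap φ x + (1/θ) * ‖fderiv ℝ φ x‖ ^ θ ≤ f x - lam) → lam ≤ C := by
  obtain ⟨k', hk'⟩ := exists_nat_ge (1 / (θ - 1))
  set k : ℝ := (k':ℝ) + 1 with hkd
  have hk1 : 1 ≤ k := by simp [hkd]
  have hk2 : 1 / (θ - 1) ≤ k := by linarith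
  have hkp : 0 < k := by linarith
  set K0 := ((m * k + 2 * k * (k + 1)) * θ) with hK0
  have hK00 : 0 ≤ K0 := by positivity
  set S0 : ℝ := max 2 (K0 ^ (1 / (θ - 1))) with hS0
  have hθ1 : 0 < θ - 1 := by linarith
  have hS2 : K0 ≤ S0 ^ (θ - 1) := by
    calc K0 = (K0 ^ (1 / (θ - 1))) ^ (θ - 1) := by
          rw [← Real.rpow_mul hK00, one_div_mul_cancel hθ1.ne', Real.rpow_one]
      _ ≤ _ := Real.rpow_le_rpow (by positivity) (le_max_right _ _) hθ1.le
  refine ⟨Cf + m * k * S0 ^ (k + 1) + 2 * k * (k + 1) * S0 ^ (k + 2), fun c φ f lam hφ hf hs => ?_⟩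
  set g : ℝ → ℝ := fun t => (1 - t) ^ (-k) with hg
  set g' : ℝ → ℝ := fun t => k * (1 - t) ^ (-k - 1) with hg'
  have hd : ∀ t : ℝ, t < 1 → HasDerivAt g (g' t) t := by
    intro t ht
    have h1 := ((hasDerivAt_id t).const_sub 1).rpow_const (p := -k) (Or.inl (by simp only [id]; linarith))
    refine HasDerivAt.congr_deriv h1 ?_
    simp only [id, hg']
    ring
  have hd' : ∀ t : ℝ, t < 1 → HasDerivAt g' (k * (k + 1) * (1 - t) ^ (-k - 2)) t := by
    intro t ht
    have h1 := (((hasDerivAt_id t).const_sub 1).rpow_const (p := -k - 1) (Or.inl (by simp only [id]; linarith))).const_mul k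
    refine HasDerivAt.congr_deriv h1 ?_
    simp only [id]
    have : -k - 1 - 1 = -k - 2 := by ring
    rw [this]
    ring
  set ψ : Eu m → ℝ := fun x => g (‖x - c‖ ^ 2) with hψ
  have hgc : ∀ t : ℝ, t < 1 → ContDiffAt ℝ 2 g t := fun t ht => by
    refine ContDiffAt.rpow_const_of_ne (contDiffAt_const.sub contDiffAt_id) ?_
    exact (by linarith : (0:ℝ) < 1 - t).ne'
  have hlt : ∀ x ∈ Metric.ball c 1, ‖x - c‖ ^ 2 < 1 := fun x hx => by
    rw [Metric.mem_ball, dist_eq_norm] at hx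
    exact pow_lt_one₀ (norm_nonneg _) hx (by norm_num)
  have hψc : ∀ x ∈ Metric.ball c 1, ContDiffAt ℝ 2 ψ x := fun x hx =>
    (hgc _ (hlt x hx)).comp x (contDiff_normsq c).contDiffAt
  obtain ⟨M, hM⟩ := (isCompact_closedBall c 1).exists_bound_of_continuousOn hφ.continuous.continuousOn
  have hM0 : 0 ≤ M := (norm_nonneg _).trans (hM c (by simp))
  obtain ⟨ρ, hρ0, hρ1, hρ⟩ : ∃ ρ : ℝ, 0 < ρ ∧ ρ < 1 ∧ 1 - ρ ^ 2 = (2 * M + 2)⁻¹ := by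
    have a1 : (2 * M + 2)⁻¹ ≤ 1 / 2 := by
      rw [← one_div]
      gcongr
      linarith
    have a2 : 0 < (2 * M + 2)⁻¹ := by positivity
    refine ⟨√(1 - (2 * M + 2)⁻¹), Real.sqrt_pos.2 (by linarith), ?_, ?_⟩
    · rw [Real.sqrt_lt' (by norm_num)]
      linarith
    · rw [Real.sq_sqrt (by linarith)]
      ring
  have hsub : Metric.closedBall c ρ ⊆ Metric.ball c 1 := Metric.closedBall_subset_ball hρ1
  have hwc : ContinuousOn (fun x => φ x - ψ x) (Metric.closedBall c ρ) := fun x hx =>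
    (hφ.continuous.continuousAt.sub (hψc x (hsub hx)).continuousAt).continuousWithinAt
  obtain ⟨x0, hx0, hmax⟩ := (isCompact_closedBall c ρ).exists_isMaxOn ⟨c, by simp [hρ0.le]⟩ hwc
  have hx1 := hsub hx0
  have hIntg : x0 ∈ Metric.ball c ρ := by
    rw [Metric.mem_ball]
    refine lt_of_le_of_ne hx0 fun heq => ?_
    have a1 : φ c - ψ c ≤ φ x0 - ψ x0 := hmax (show c ∈ Metric.closedBall c ρ by simp [hρ0.le])
    have a2 : ψ c = 1 := by simp [hψ, hg]
    have a3 : 2 * M + 2 ≤ ψ x0 := by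
      rw [dist_eq_norm] at heq
      simp only [hψ, hg, heq, hρ]
      rw [Real.rpow_neg (by positivity), ← Real.inv_rpow (by positivity), inv_inv]
      nth_rewrite 1 [← Real.rpow_one (2 * M + 2)]
      exact Real.rpow_le_rpow_of_exponent_le (by linarith) hk1
    have a4 := (abs_le.1 (hM c (by simp))).1
    have a5 := (abs_le.1 (hM x0 (Metric.ball_subset_closedBall hx1))).2
    linarith
  have hloc : IsLocalMax (fun x => φ x - ψ x) x0 := by
    filter_upwards [Metric.isOpen_ball.mem_nhds hIntg] with y hy
    exact hmax (Metric.ball_subset_closedBall hy)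
  have hψ0 := hψc x0 hx1
  have hl := lap_nonpos (hφ.contDiffAt.sub hψ0) hloc
  rw [lap_sub hφ.contDiffAt hψ0] at hl
  have hD := fderiv_zero_of_max hloc
  rw [fderiv_fun_sub (hφ.differentiable (by norm_num) x0) (hψ0.differentiableAt (by norm_num)), sub_eq_zero] at hD
  set t := ‖x0 - c‖ ^ 2 with ht
  have ht1 : t < 1 := hlt x0 hx1
  have ht0 : 0 ≤ t := by positivity
  have hξ : 0 < 1 - t := by linarith
  have hlap : lap ψ x0 = g' t * (2 * m) + (k * (k + 1) * (1 - t) ^ (-k - 2)) * (4 * t) := by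
    have := lap_comp (φ := fun y : Eu m => ‖y - c‖^2) (g := g) (g' := g') (x := x0)
      (contDiff_normsq c).contDiffAt (hgc t ht1) ?_ (hd' t ht1)
    · rwa [lap_normsq, sum_pd_normsq, ← ht] at this
    · filter_upwards [gt_mem_nhds ht1] with s hs using hd s hs
  have hDn : ‖fderiv ℝ ψ x0‖ = 2 * ‖x0 - c‖ * g' t := by
    have e : ∀ i, fderiv ℝ ψ x0 (ev i) = g' t * pd i (fun y : Eu m => ‖y - c‖^2) x0 := fun i =>
        pd_comp (φ := fun y : Eu m => ‖y - c‖^2) (g := g)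
          ((contDiff_normsq (n := 2) c).differentiable (by norm_num) x0) (hd t ht1) i
    have h2 := clm_norm_sq (fderiv ℝ ψ x0)
    simp only [e, mul_pow] at h2
    rw [← Finset.mul_sum, sum_pd_normsq] at h2
    have h3 : 0 ≤ g' t := by simp only [hg']; positivity
    rw [← sq_eq_sq₀ (norm_nonneg _) (by positivity), h2]
    ring
  have hfin := hs x0 hx1
  have hfx := hf x0 hx1
  rw [hD, hDn] at hfin
  refine bar_scal (s := (1 - t)⁻¹) (r := ‖x0 - c‖) (Cf := Cf) hθ (Nat.cast_nonneg m) hk1 hk2 ?_ (norm_nonneg _) ?_ (le_max_left _ _) hS2 ?_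
  · exact (one_le_inv₀ hξ).2 (by linarith)
  · rw [one_div, inv_inv, ← ht]
    ring
  · have r1 : (1 - t)⁻¹ ^ (k + 1) = (1 - t) ^ (-k - 1) := by
      rw [Real.inv_rpow hξ.le, ← Real.rpow_neg hξ.le]
      congr 1
      ring
    have r2 : (1 - t)⁻¹ ^ (k + 2) = (1 - t) ^ (-k - 2) := by
      rw [Real.inv_rpow hξ.le, ← Real.rpow_neg hξ.le]
      congr 1
      ring
    rw [r1, r2, ← ht]
    have r3 : 2 * ‖x0 - c‖ * g' t = 2 * ‖x0 - c‖ * k * (1 - t) ^ (-k - 1) := by simp only [hg']; ring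
    rw [r3] at hfin
    rw [hlap] at hl
    simp only [hg'] at hl
    linarith
end bar
end EP

open Filter Topology MeasureTheory
namespace EP
set_option linter.unusedSectionVars false

section app
variable {m : ℕ}

lemma lip_ball {f : Eu m → ℝ} (hf : LocallyLipschitz f) (R : ℝ) : ∃ K : NNReal,
    LipschitzOnWith K f (Metric.closedBall 0 R) := by
  exact LocallyLipschitzOn.exists_lipschitzOnWith_of_compact (isCompact_closedBall (0 : Eu m) R)
    hf.locallyLipschitzOn

lemma lip_LH {f : Eu m → ℝ} (hf : LocallyLipschitz f) : LH f := by
  intro r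
  obtain ⟨K, hK⟩ := lip_ball hf r
  refine ⟨K * (2 * |r|) ^ (1/2:ℝ), by positivity, fun x y hx hy => ?_⟩
  have h1 : |f x - f y| ≤ K * ‖x - y‖ := by
    have := hK.dist_le_mul x (by simpa using hx) y (by simpa using hy)
    rwa [Real.dist_eq, dist_eq_norm] at this
  refine h1.trans ?_
  rw [mul_assoc]
  refine mul_le_mul_of_nonneg_left ?_ K.2
  have h2 : ‖x - y‖ ≤ 2 * |r| := by
    have := norm_sub_le x y
    linarith [le_abs_self r]
  calc ‖x - y‖ = ‖x - y‖ ^ (1/2:ℝ) * ‖x - y‖ ^ (1/2:ℝ) := by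
        rw [← Real.rpow_add_of_nonneg (norm_nonneg _) (by norm_num) (by norm_num)]
        norm_num
    _ ≤ _ := by gcongr

lemma lap_LH {θ ε : ℝ} (hθ : 1 < θ) {u g : Eu m → ℝ} (hu : ContDiff ℝ 2 u) (hg : LocallyLipschitz g)
    (heq : ∀ x, ε * u x - (1/2) * lap u x + (1/θ) * ‖fderiv ℝ u x‖ ^ θ = g x) : LH (lap u) := by
  have h1 : LocallyLipschitz (fun x => 2 * ε * u x) :=
    ContDiff.locallyLipschitz (𝕂 := ℝ) (contDiff_const.mul (hu.of_le (by norm_num)))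
  have h2 : LocallyLipschitz (fderiv ℝ u) :=
    ContDiff.locallyLipschitz (𝕂 := ℝ) (hu.fderiv_right (by norm_num))
  have h3 : LocallyLipschitz (fun t : ℝ => (2/θ) * t ^ θ) :=
    ContDiff.locallyLipschitz (𝕂 := ℝ) (contDiff_const.mul
      (by simpa using Real.contDiff_rpow_const_of_le (p := θ) (n := 1) (by simpa using hθ.le)))
  have h4 : LocallyLipschitz (fun t : ℝ => -2 * t) :=
    ContDiff.locallyLipschitz (𝕂 := ℝ) (contDiff_const.mul contDiff_id)
  have h5 : LocallyLipschitz (fun p : Eu m →L[ℝ] ℝ => ‖p‖) := lipschitzWith_one_norm.locallyLipschitz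
  have h6 := (h1.add (h3.comp (h5.comp h2))).add (h4.comp hg)
  have e : lap u = ((fun x => 2 * ε * u x) + (fun t : ℝ => (2/θ) * t ^ θ) ∘ (fun p : Eu m →L[ℝ] ℝ => ‖p‖) ∘ fderiv ℝ u)
      + (fun t : ℝ => -2 * t) ∘ g := by
    funext x
    have := heq x
    simp only [Pi.add_apply, Function.comp]
    rw [← this]
    ring
  rw [e]
  exact lip_LH h6

lemma approx {θ : ℝ} (hθ : 1 < θ) {f : Eu m → ℝ} (hf : LocallyLipschitz f) {lam : ℝ} {φ : Eu m → ℝ}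
    (hφ : ContDiff ℝ 2 φ) (hs : ∀ x, -(1/2) * lap φ x + (1/θ) * ‖fderiv ℝ φ x‖ ^ θ ≤ f x - lam)
    {R δ : ℝ} (hR : 0 < R) (hδ : 0 < δ) :
    ∃ ε u, 0 < ε ∧ ε ≤ δ ∧ ContDiff ℝ 2 u ∧ LH (lap u) ∧
      (∀ x ∈ Metric.closedBall (0 : Eu m) R, ε * u x - (1/2) * lap u x + (1/θ) * ‖fderiv ℝ u x‖ ^ θ = f x) ∧
      ∀ x, lam - δ ≤ ε * u x := by
  have hθ0 : 0 < θ := by linarith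
  let χ : ContDiffBump (0 : Eu m) := ⟨R + 1, R + 2, by linarith, by linarith⟩
  set Φ : Eu m → ℝ := fun x => χ x * φ x with hΦ
  have hΦc : ContDiff ℝ 2 Φ := χ.contDiff.mul hφ
  have hin : ∀ x ∈ Metric.ball (0 : Eu m) (R + 1), Φ =ᶠ[𝓝 x] φ := fun x hx => by
    filter_upwards [Metric.isOpen_ball.mem_nhds hx] with y hy
    have : χ y = 1 := χ.one_of_mem_closedBall (Metric.ball_subset_closedBall hy)
    simp [hΦ, this]
  have hout : ∀ x : Eu m, R + 2 ≤ ‖x‖ → Φ x = 0 := fun x hx => by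
    have : χ x = 0 := χ.zero_of_le_dist (by simpa using hx)
    simp [hΦ, this]
  have hout2 : ∀ x : Eu m, R + 2 < ‖x‖ → Φ =ᶠ[𝓝 x] fun _ => (0:ℝ) := fun x hx => by
    have ho : IsOpen {y : Eu m | R + 2 < ‖y‖} := isOpen_lt continuous_const continuous_norm
    filter_upwards [ho.mem_nhds hx] with y hy
    exact hout y (le_of_lt hy)
  set G : Eu m → ℝ := fun x => -(1/2) * lap Φ x + (1/θ) * ‖fderiv ℝ Φ x‖ ^ θ with hG
  have hGc : Continuous G := by
    have c1 := cont_lap hΦc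
    have c2 : Continuous (fderiv ℝ Φ) := hΦc.continuous_fderiv (by norm_num)
    have c3 : Continuous fun x => ‖fderiv ℝ Φ x‖ ^ θ := c2.norm.rpow_const fun x => Or.inr hθ0.le
    fun_prop
  have hGin : ∀ x ∈ Metric.ball (0 : Eu m) (R + 1), G x ≤ f x - lam := fun x hx => by
    simp only [hG]
    rw [(hin x hx).fderiv_eq, lap_congr (hin x hx)]
    exact hs x
  obtain ⟨M1, hM1⟩ : ∃ M1, ∀ x, G x ≤ M1 := by
    obtain ⟨C, hC⟩ := (isCompact_closedBall (0 : Eu m) (R + 2)).exists_bound_of_continuousOn hGc.continuousOn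
    refine ⟨max C 0, fun x => ?_⟩
    by_cases hx : ‖x‖ ≤ R + 2
    · exact ((le_abs_self _).trans (hC x (by simpa using hx))).trans (le_max_left _ _)
    · push Not at hx
      have e := hout2 x hx
      simp only [hG]
      rw [e.fderiv_eq, lap_congr e, lap_const]
      simp [Real.zero_rpow hθ0.ne']
  obtain ⟨B, hB0, hB⟩ : ∃ B, 0 ≤ B ∧ ∀ x, |Φ x| ≤ B := by
    obtain ⟨C, hC⟩ := (isCompact_closedBall (0 : Eu m) (R + 2)).exists_bound_of_continuousOn hΦc.continuous.continuousOn
    refine ⟨max C 0, le_max_right _ _, fun x => ?_⟩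
    by_cases hx : ‖x‖ ≤ R + 2
    · exact (hC x (by simpa using hx)).trans (le_max_left _ _)
    · push Not at hx
      rw [hout x hx.le]
      simp
  obtain ⟨K, hK⟩ := lip_ball hf (R + 1)
  obtain ⟨F, hF, hFf⟩ := hK.extend_real
  obtain ⟨M2, hM20, hM2⟩ : ∃ M2, 0 ≤ M2 ∧ ∀ x ∈ Metric.closedBall (0 : Eu m) (R + 1), |f x| ≤ M2 := by
    obtain ⟨C, hC⟩ := (isCompact_closedBall (0 : Eu m) (R + 1)).exists_bound_of_continuousOn hf.continuous.continuousOn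
    exact ⟨max C 0, le_max_right _ _, fun x hx => (hC x hx).trans (le_max_left _ _)⟩
  set M : ℝ := |M1| + M2 + |lam| with hM
  have hM0 : 0 ≤ M := by positivity
  set a : Eu m → ℝ := fun x => max (-M2) (min M2 (F x)) with ha
  set b : Eu m → ℝ := fun x => max 0 (min 1 (‖x‖ - R)) with hb
  set g : Eu m → ℝ := fun x => a x + M * b x with hg
  have hal : ∀ x y, |a x - a y| ≤ K * ‖x - y‖ := fun x y => by
    have := ((hF.const_min M2).const_max (-M2)).dist_le_mul x y
    rwa [Real.dist_eq, dist_eq_norm] at this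
  have hbl : ∀ x y, |b x - b y| ≤ ‖x - y‖ := fun x y => by
    have h1 : LipschitzWith 1 (fun x : Eu m => ‖x‖ - R) := LipschitzWith.of_dist_le_mul fun x y => by
      rw [Real.dist_eq, dist_eq_norm]
      simpa using abs_norm_sub_norm_le x y
    have := ((h1.const_min 1).const_max 0).dist_le_mul x y
    rw [Real.dist_eq, dist_eq_norm] at this
    simpa using this
  have hgl : ∀ x y, |g x - g y| ≤ (K + M) * ‖x - y‖ := fun x y => by
    have e : g x - g y = (a x - a y) + M * (b x - b y) := by simp only [hg]; ring
    rw [e]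
    have h1 := abs_add_le (a x - a y) (M * (b x - b y))
    rw [abs_mul, abs_of_nonneg hM0] at h1
    have h2 := hal x y
    have h3 := mul_le_mul_of_nonneg_left (hbl x y) hM0
    linarith
  have ha1 : ∀ x, -M2 ≤ a x ∧ a x ≤ M2 := fun x =>
    ⟨le_max_left _ _, max_le (by linarith) (min_le_left _ _)⟩
  have hb1 : ∀ x, 0 ≤ b x ∧ b x ≤ 1 := fun x => ⟨le_max_left _ _, max_le (by linarith) (min_le_left _ _)⟩
  have haf : ∀ x ∈ Metric.closedBall (0 : Eu m) (R + 1), a x = f x := fun x hx => by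
    have h1 := abs_le.1 (hM2 x hx)
    simp only [ha]
    rw [← hFf hx, min_eq_right h1.2, max_eq_right h1.1]
  have hgb : ∀ x, |g x| ≤ M2 + M := fun x => by
    have h1 := ha1 x
    have h2 := hb1 x
    have h3 := mul_le_mul_of_nonneg_left h2.2 hM0
    have h4 := mul_nonneg hM0 h2.1
    simp only [hg]
    rw [abs_le]
    constructor <;> linarith
  have hGg : ∀ x, G x ≤ g x - lam := fun x => by
    by_cases hx : ‖x‖ < R + 1
    · have hx1 : x ∈ Metric.ball (0 : Eu m) (R + 1) := by simpa using hx
      have h1 := hGin x hx1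
      have h2 := haf x (Metric.ball_subset_closedBall hx1)
      have h4 := mul_nonneg hM0 (hb1 x).1
      simp only [hg]
      linarith
    · push Not at hx
      have h1 : b x = 1 := by
        simp only [hb]
        rw [min_eq_left (by linarith), max_eq_right (by norm_num)]
      have h2 := hM1 x
      have h3 := (ha1 x).1
      have h4 := le_abs_self M1
      have h5 := le_abs_self lam
      simp only [hg, h1]
      linarith
  set ε := δ / (2 * B + 1) with hε
  have hε0 : 0 < ε := by positivity
  obtain ⟨u, hu, heq, hcmp⟩ := exists3 hθ hε0 (show 0 ≤ (K:ℝ) + M by positivity) hgl hgb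
  have hgL : LocallyLipschitz g :=
    (LipschitzWith.of_dist_le_mul (K := ⟨(K:ℝ) + M, by positivity⟩) fun x y => by
      rw [Real.dist_eq, dist_eq_norm]
      exact hgl x y).locallyLipschitz
  refine ⟨ε, u, hε0, div_le_self hδ.le (by linarith), hu, lap_LH hθ hu hgL heq, fun x hx => ?_, fun x => ?_⟩
  · rw [heq x]
    have h1 : b x = 0 := by
      have : ‖x‖ ≤ R := by simpa using hx
      simp only [hb]
      exact max_eq_left ((min_le_right _ _).trans (by linarith))
    simp only [hg, h1]
    rw [haf x (Metric.closedBall_subset_closedBall (by linarith) hx)]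
    ring
  · have h1 := hcmp (fun y => Φ y + (lam / ε - B)) (hΦc.add contDiff_const)
      ⟨B + |lam / ε - B|, fun y => (abs_add_le _ _).trans (add_le_add (hB y) le_rfl)⟩ (fun y => by
        rw [lap_add hΦc.contDiffAt contDiffAt_const, lap_const, fderiv_add_const]
        have h2 := hGg y
        simp only [hG] at h2
        have h3 := (abs_le.1 (hB y)).2
        have h4 : ε * (Φ y + (lam / ε - B)) = ε * (Φ y - B) + lam := by
          field_simp
          ring
        rw [h4]
        have h5 : ε * (Φ y - B) ≤ 0 := mul_nonpos_of_nonneg_of_nonpos hε0.le (by linarith)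
        linarith) x
    have h3 := (abs_le.1 (hB x)).1
    have h4 : lam / ε - 2 * B ≤ u x := by linarith
    have h5 := mul_le_mul_of_nonneg_left h4 hε0.le
    have h6 : ε * (lam / ε - 2 * B) = lam - 2 * B * ε := by
      field_simp
    have h7 : ε * (2 * B + 1) = δ := by
      rw [hε]
      field_simp
    linarith
end app
end EP

open Filter Topology MeasureTheory
namespace EP
set_option linter.unusedSectionVars false

section est
variable {m : ℕ}

lemma half1 {E : Type*} [NormedAddCommGroup E] [NormedSpace ℝ E] (a b : E) :
    ‖a - (1/2 : ℝ) • b‖ ≤ ‖a‖ + 1/2 * ‖b‖ := by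
  refine (norm_sub_le _ _).trans ?_
  rw [norm_smul, Real.norm_eq_abs, abs_of_pos (by norm_num : (0:ℝ) < 1/2)]

lemma half2 {E : Type*} [NormedAddCommGroup E] [NormedSpace ℝ E] (a b a' b' : E) :
    ‖(a - (1/2 : ℝ) • b) - (a' - (1/2 : ℝ) • b')‖ ≤ ‖a - a'‖ + 1/2 * ‖b - b'‖ := by
  rw [sub_sub_sub_comm, ← smul_sub]
  exact half1 _ _

lemma Pair.D1 {η ρ : Eu m → ℝ} (h : Pair η ρ) {v : Eu m → ℝ} (hv : ContDiff ℝ 2 v) (hl : LH (lap v)) :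
    fderiv ℝ v = fun x => A (fun _ => -(2 / (1:ℝ) ^ 2)) (fderiv ℝ ρ) 1 v x
      - (1/2 : ℝ) • A (fun s => -bG 1 s) (fderiv ℝ η) 1 (lap v) x := by
  have hvl : LH v := LH_of_C1 (hv.of_le (by norm_num))
  have a1 := A_C2 (continuous_const (y := 2 / (1:ℝ) ^ 2)) h.kρ h.cρ hvl one_pos
  have a2 := A_C2 (bG_cont 1) h.kη h.cη hl one_pos
  funext x
  have e : v = fun x => A (fun s => s * (2 / (1:ℝ) ^ 2)) ρ 1 v x
      - (1/2) * A (fun s => s * bG 1 s) η 1 (lap v) x := funext fun x => h.repr one_pos hv x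
  have d1 := a1.1.differentiable (by norm_num) x
  have d2 := a2.1.differentiable (by norm_num) x
  conv_lhs => rw [e]
  rw [fderiv_fun_sub d1 (d2.const_mul _), fderiv_const_mul d2, a1.2.1, a2.2.1]

lemma Pair.D2 {η ρ : Eu m → ℝ} (h : Pair η ρ) {v : Eu m → ℝ} (hv : ContDiff ℝ 2 v) (hl : LH (lap v))
    (x : Eu m) :
    fderiv ℝ (fderiv ℝ v) x = A (fun s => s⁻¹ * (2 / (1:ℝ) ^ 2)) (fderiv ℝ (fderiv ℝ ρ)) 1 v x
      - (1/2 : ℝ) • A (fun s => s⁻¹ * bG 1 s) (fderiv ℝ (fderiv ℝ η)) 1 (lap v) x := by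
  have hvl : LH v := LH_of_C1 (hv.of_le (by norm_num))
  have a1 := A_C2 (continuous_const (y := 2 / (1:ℝ) ^ 2)) h.kρ h.cρ hvl one_pos
  have a2 := A_C2 (bG_cont 1) h.kη h.cη hl one_pos
  have e : fderiv ℝ v = fun x => fderiv ℝ (A (fun s => s * (2 / (1:ℝ) ^ 2)) ρ 1 v) x
      - (1/2 : ℝ) • fderiv ℝ (A (fun s => s * bG 1 s) η 1 (lap v)) x := by
    rw [h.D1 hv hl]
    funext x
    rw [a1.2.1, a2.2.1]
  have d1 := (a1.1.fderiv_right (m := 1) (by norm_num)).differentiable (by norm_num) x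
  have d2 := (a2.1.fderiv_right (m := 1) (by norm_num)).differentiable (by norm_num) x
  conv_lhs => rw [e]
  rw [← a1.2.2, ← a2.2.2]
  exact (d1.hasFDerivAt.sub (d2.hasFDerivAt.const_smul (1/2 : ℝ))).fderiv

lemma hol1 (m : ℕ) : ∃ C, 0 ≤ C ∧ ∀ (v : Eu m → ℝ) (r M : ℝ), ContDiff ℝ 2 v → LH (lap v) → 0 ≤ M →
    (∀ z ∈ Metric.closedBall (0 : Eu m) (r + 1), |v z| ≤ M) →
    (∀ z ∈ Metric.closedBall (0 : Eu m) (r + 1), |lap v z| ≤ M) →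
    ∀ x ∈ Metric.closedBall (0 : Eu m) r, ∀ y ∈ Metric.closedBall (0 : Eu m) r,
      ‖fderiv ℝ v x - fderiv ℝ v y‖ ≤ C * M * ‖x - y‖ ^ (1/2 : ℝ) := by
  obtain ⟨η, ρ, h⟩ := exists_pair m
  obtain ⟨C1, h10, h1⟩ := A_hol1 (F := Eu m →L[ℝ] ℝ) (continuous_const (y := -(2 / (1:ℝ) ^ 2)))
    (h.kρ.fderiv (h.cρ.of_le (by norm_num))) (h.cρ.fderiv_right (by norm_num)) one_pos
  obtain ⟨C2, h20, h2⟩ := A_hol1 (F := Eu m →L[ℝ] ℝ) (bG_cont 1).neg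
    (h.kη.fderiv (h.cη.of_le (by norm_num))) (h.cη.fderiv_right (by norm_num)) one_pos
  refine ⟨C1 + (1/2) * C2, by positivity, fun v r M hv hl hM hb1 hb2 x hx y hy => ?_⟩
  rw [h.D1 hv hl]
  have i1 := h1 v hv.continuous 0 r M hM hb1 x hx y hy
  have i2 := h2 (lap v) hl.continuous 0 r M hM hb2 x hx y hy
  generalize hX : ‖x - y‖ ^ (1/2 : ℝ) = X at *
  rw [sub_sub_sub_comm, ← smul_sub]
  refine (norm_sub_le _ _).trans ?_
  rw [norm_smul, Real.norm_eq_abs, abs_of_pos (by norm_num : (0:ℝ) < 1/2)]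
  have i3 := mul_le_mul_of_nonneg_left i2 (by norm_num : (0:ℝ) ≤ 1/2)
  refine (add_le_add i1 i3).trans (le_of_eq ?_)
  ring

lemma hol2 (m : ℕ) : ∃ C, 0 ≤ C ∧ ∀ (v : Eu m → ℝ) (r M : ℝ), ContDiff ℝ 2 v → LH (lap v) → 0 ≤ M →
    (∀ z ∈ Metric.closedBall (0 : Eu m) (r + 1), ∀ z' ∈ Metric.closedBall (0 : Eu m) (r + 1),
      |v z - v z'| ≤ M * ‖z - z'‖ ^ (1/2 : ℝ)) →
    (∀ z ∈ Metric.closedBall (0 : Eu m) (r + 1), ∀ z' ∈ Metric.closedBall (0 : Eu m) (r + 1),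
      |lap v z - lap v z'| ≤ M * ‖z - z'‖ ^ (1/2 : ℝ)) →
    ∀ x ∈ Metric.closedBall (0 : Eu m) r, ‖fderiv ℝ (fderiv ℝ v) x‖ ≤ C * M ∧
      ∀ y ∈ Metric.closedBall (0 : Eu m) r,
      ‖fderiv ℝ (fderiv ℝ v) x - fderiv ℝ (fderiv ℝ v) y‖ ≤ C * M * ‖x - y‖ ^ (1/4 : ℝ) := by
  obtain ⟨η, ρ, h⟩ := exists_pair m
  have hρ1 : ContDiff ℝ 1 ρ := h.cρ.of_le (by norm_num)
  have hρ2 : ContDiff ℝ 1 (fderiv ℝ ρ) := h.cρ.fderiv_right (by norm_num)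
  have hη1 : ContDiff ℝ 1 η := h.cη.of_le (by norm_num)
  have hη2 : ContDiff ℝ 1 (fderiv ℝ η) := h.cη.fderiv_right (by norm_num)
  have kρ := (h.kρ.fderiv hρ1).fderiv hρ2
  have kη := (h.kη.fderiv hη1).fderiv hη2
  have zρ := integral_fderiv_zero (h.kρ.fderiv hρ1) hρ2
  have zη := integral_fderiv_zero (h.kη.fderiv hη1) hη2
  have hc : Continuous (fun _ : ℝ => 2 / (1:ℝ) ^ 2) := continuous_const
  obtain ⟨C1, h10, h1⟩ := A_hol2 (F := Eu m →L[ℝ] Eu m →L[ℝ] ℝ) hc kρ zρ one_pos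
  obtain ⟨C2, h20, h2⟩ := A_hol2 (F := Eu m →L[ℝ] Eu m →L[ℝ] ℝ) (bG_cont 1) kη zη one_pos
  obtain ⟨B1, hB10, hB1⟩ := b_bound hc 1
  obtain ⟨B2, hB20, hB2⟩ := b_bound (bG_cont 1) 1
  have n1 := nrm_nonneg (fderiv ℝ (fderiv ℝ ρ))
  have n2 := nrm_nonneg (fderiv ℝ (fderiv ℝ η))
  set C3 := B1 * nrm (fderiv ℝ (fderiv ℝ ρ)) * 2 with hC3
  set C4 := B2 * nrm (fderiv ℝ (fderiv ℝ η)) * 2 with hC4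
  have h30 : 0 ≤ C3 := by positivity
  have h40 : 0 ≤ C4 := by positivity
  refine ⟨(C1 + (1/2) * C2) + (C3 + (1/2) * C4), by positivity, fun v r M hv hl hM hb1 hb2 x hx => ?_⟩
  have hsub : Metric.closedBall x 1 ⊆ Metric.closedBall (0 : Eu m) (r + 1) := by
    refine Metric.closedBall_subset_closedBall' ?_
    rw [Metric.mem_closedBall] at hx
    linarith
  have hx1 := hsub (Metric.mem_closedBall_self one_pos.le)
  have hh : (0:ℝ) ≤ 1/2 := by norm_num
  constructor
  · have j1 := (A_bd2 (F := Eu m →L[ℝ] Eu m →L[ℝ] ℝ) hc kρ zρ one_pos hB1 hv.continuous (x := x) hM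
      fun z hz => hb1 z (hsub hz) x hx1).2
    have j2 := (A_bd2 (F := Eu m →L[ℝ] Eu m →L[ℝ] ℝ) (bG_cont 1) kη zη one_pos hB2 hl.continuous (x := x) hM
      fun z hz => hb2 z (hsub hz) x hx1).2
    rw [h.D2 hv hl]
    refine (half1 (E := Eu m →L[ℝ] Eu m →L[ℝ] ℝ) _ _).trans ?_
    refine (add_le_add j1 (mul_le_mul_of_nonneg_left j2 hh)).trans ?_
    rw [Real.one_rpow]
    have e : B1 * (M * nrm (fderiv ℝ (fderiv ℝ ρ))) * (2 * 1) + 1/2 * (B2 * (M * nrm (fderiv ℝ (fderiv ℝ η))) * (2 * 1))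
      = (C3 + (1/2) * C4) * M := by rw [hC3, hC4]; ring
    rw [e]
    refine mul_le_mul_of_nonneg_right ?_ hM
    linarith
  · intro y hy
    have i1 := h1 v hv.continuous 0 r M hM hb1 x hx y hy
    have i2 := h2 (lap v) hl.continuous 0 r M hM hb2 x hx y hy
    have hX0 : 0 ≤ ‖x - y‖ ^ (1/4 : ℝ) := by positivity
    rw [h.D2 hv hl, h.D2 hv hl]
    generalize hX : ‖x - y‖ ^ (1/4 : ℝ) = X at *
    refine (half2 (E := Eu m →L[ℝ] Eu m →L[ℝ] ℝ) _ _ _ _).trans ?_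
    refine (add_le_add i1 (mul_le_mul_of_nonneg_left i2 hh)).trans ?_
    have e : C1 * M * X + 1/2 * (C2 * M * X) = (C1 + 1/2 * C2) * M * X := by ring
    rw [e]
    refine mul_le_mul_of_nonneg_right (mul_le_mul_of_nonneg_right ?_ hM) hX0
    linarith

lemma le_half {s r : ℝ} (hs : 0 ≤ s) (h : s ≤ r) : s ≤ r ^ (1/2:ℝ) * s ^ (1/2:ℝ) := by
  calc s = s ^ (1/2:ℝ) * s ^ (1/2:ℝ) := by
        rw [← Real.rpow_add_of_nonneg hs (by norm_num) (by norm_num)]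
        norm_num
    _ ≤ _ := by gcongr

lemma est {θ : ℝ} (hθ : 1 < θ) {f : Eu m → ℝ} (hf : LocallyLipschitz f) {r K : ℝ} (hr : 0 ≤ r) (hK : 0 ≤ K) :
    ∃ C, 0 ≤ C ∧ ∀ (v : Eu m → ℝ) (ε lam : ℝ), ContDiff ℝ 2 v → LH (lap v) → v 0 = 0 → 0 ≤ ε → ε ≤ 1 → |lam| ≤ K →
    (∀ x ∈ Metric.closedBall (0 : Eu m) (r + 2),
      ε * v x + lam - (1/2) * lap v x + (1/θ) * ‖fderiv ℝ v x‖ ^ θ = f x) →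
    (∀ x ∈ Metric.closedBall (0 : Eu m) (r + 2), ‖fderiv ℝ v x‖ ≤ K) →
    ∀ x ∈ Metric.closedBall (0 : Eu m) r, ‖fderiv ℝ (fderiv ℝ v) x‖ ≤ C ∧
      ∀ y ∈ Metric.closedBall (0 : Eu m) r,
      ‖fderiv ℝ (fderiv ℝ v) x - fderiv ℝ (fderiv ℝ v) y‖ ≤ C * ‖x - y‖ ^ (1/4 : ℝ) := by
  have hθ0 : 0 < θ := by linarith
  obtain ⟨C1, h10, h1⟩ := hol1 m
  obtain ⟨C2, h20, h2⟩ := hol2 m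
  obtain ⟨Lf, hLf⟩ := lip_ball hf (r + 2)
  obtain ⟨Ff, hFf⟩ := (isCompact_closedBall (0 : Eu m) (r + 2)).exists_bound_of_continuousOn
    hf.continuous.continuousOn
  set Q := K * (r + 2) + 2 * (K * (r + 2) + K + (1/θ) * K ^ θ + |Ff|) with hQ
  have hQ0 : 0 ≤ Q := by positivity
  set S := (2 * (r + 1)) ^ (1/2 : ℝ) with hS
  have hS0 : 0 ≤ S := by positivity
  set T := K * S + 2 * (K * S + K ^ (θ - 1) * (C1 * Q) + Lf * S) with hT
  have hT0 : 0 ≤ T := by positivity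
  refine ⟨C2 * T, by positivity, fun v ε lam hv hl hv0 hε0 hε1 hlam heq hD => ?_⟩
  have hvl : ∀ x ∈ Metric.closedBall (0 : Eu m) (r + 2), ∀ y ∈ Metric.closedBall (0 : Eu m) (r + 2),
      |v x - v y| ≤ K * ‖x - y‖ := fun x hx y hy =>
    (convex_closedBall (0 : Eu m) (r + 2)).norm_image_sub_le_of_norm_fderiv_le
      (fun z _ => hv.differentiable (by norm_num) z) hD hy hx
  have hvb : ∀ x ∈ Metric.closedBall (0 : Eu m) (r + 2), |v x| ≤ K * (r + 2) := fun x hx => by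
    have h := hvl x hx 0 (Metric.mem_closedBall_self (by linarith))
    rw [hv0, sub_zero, sub_zero] at h
    refine h.trans (mul_le_mul_of_nonneg_left (by simpa using hx) hK)
  have hlap : ∀ x ∈ Metric.closedBall (0 : Eu m) (r + 2), lap v x
      = 2 * (ε * v x + lam + (1/θ) * ‖fderiv ℝ v x‖ ^ θ - f x) := fun x hx => by
    rw [← heq x hx]; ring
  have hεv : ∀ t : ℝ, |ε * t| ≤ |t| := fun t => by
    rw [abs_mul, abs_of_nonneg hε0]
    exact mul_le_of_le_one_left (abs_nonneg _) hε1
  have hKr : 0 ≤ K * (r + 2) := by positivity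
  have hlb : ∀ x ∈ Metric.closedBall (0 : Eu m) (r + 2), |lap v x| ≤ Q := fun x hx => by
    rw [hlap x hx, abs_mul, abs_two]
    have b1 := (hεv (v x)).trans (hvb x hx)
    have b2 : ‖fderiv ℝ v x‖ ^ θ ≤ K ^ θ := Real.rpow_le_rpow (norm_nonneg _) (hD x hx) hθ0.le
    have b3 : 0 ≤ (1/θ) * ‖fderiv ℝ v x‖ ^ θ := by positivity
    have b4 : (1/θ) * ‖fderiv ℝ v x‖ ^ θ ≤ (1/θ) * K ^ θ := mul_le_mul_of_nonneg_left b2 (by positivity)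
    have b5 := (hFf x hx).trans (le_abs_self Ff)
    rw [Real.norm_eq_abs] at b5
    have b6 : |ε * v x + lam + (1/θ) * ‖fderiv ℝ v x‖ ^ θ - f x| ≤ K * (r + 2) + K + (1/θ) * K ^ θ + |Ff| := by
      rw [abs_le] at *
      constructor <;> linarith
    linarith
  have hsub : Metric.closedBall (0 : Eu m) (r + 1) ⊆ Metric.closedBall (0 : Eu m) (r + 2) :=
    Metric.closedBall_subset_closedBall (by linarith)
  have e2 : r + 1 + 1 = r + 2 := by ring
  have hD1 := h1 v (r + 1) Q hv hl hQ0
    (by rw [e2]; exact fun z hz => (hvb z hz).trans (by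
          have : 0 ≤ 2 * (K * (r + 2) + K + (1/θ) * K ^ θ + |Ff|) := by positivity
          linarith))
    (by rw [e2]; exact hlb)
  have hs : ∀ z ∈ Metric.closedBall (0 : Eu m) (r + 1), ∀ z' ∈ Metric.closedBall (0 : Eu m) (r + 1),
      ‖z - z'‖ ≤ S * ‖z - z'‖ ^ (1/2 : ℝ) := fun z hz z' hz' => by
    refine le_half (norm_nonneg _) ?_
    have := norm_sub_le z z'
    rw [mem_closedBall_zero_iff] at hz hz'
    linarith
  refine h2 v r T hv hl hT0 (fun z hz z' hz' => ?_) (fun z hz z' hz' => ?_)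
  · refine (hvl z (hsub hz) z' (hsub hz')).trans ?_
    have a1 := mul_le_mul_of_nonneg_left (hs z hz z' hz') hK
    refine a1.trans ?_
    rw [← mul_assoc]
    refine mul_le_mul_of_nonneg_right ?_ (by positivity)
    have : 0 ≤ 2 * (K * S + K ^ (θ - 1) * (C1 * Q) + Lf * S) := by positivity
    linarith
  · rw [hlap z (hsub hz), hlap z' (hsub hz')]
    have a0 := hs z hz z' hz'
    have a1 := (hεv (v z - v z')).trans (hvl z (hsub hz) z' (hsub hz'))
    have a2 := rpow_lip hθ (N := K) (a := ‖fderiv ℝ v z‖) (b := ‖fderiv ℝ v z'‖)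
      ⟨norm_nonneg _, hD z (hsub hz)⟩ ⟨norm_nonneg _, hD z' (hsub hz')⟩
    have a3 := (abs_norm_sub_norm_le (fderiv ℝ v z) (fderiv ℝ v z')).trans (hD1 z hz z' hz')
    have a4 : |f z - f z'| ≤ Lf * ‖z - z'‖ := by
      have := hLf.dist_le_mul z (hsub hz) z' (hsub hz')
      rwa [Real.dist_eq, dist_eq_norm] at this
    have hX0 : 0 ≤ ‖z - z'‖ ^ (1/2 : ℝ) := by positivity
    have a5 : |(1/θ) * (‖fderiv ℝ v z‖ ^ θ - ‖fderiv ℝ v z'‖ ^ θ)|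
        ≤ K ^ (θ - 1) * (C1 * Q * ‖z - z'‖ ^ (1/2 : ℝ)) := by
      rw [abs_mul, abs_of_pos (by positivity : 0 < 1/θ)]
      refine (mul_le_mul_of_nonneg_left a2 (by positivity)).trans ?_
      have e : 1/θ * (θ * K ^ (θ - 1) * |‖fderiv ℝ v z‖ - ‖fderiv ℝ v z'‖|)
        = K ^ (θ - 1) * |‖fderiv ℝ v z‖ - ‖fderiv ℝ v z'‖| := by field_simp
      rw [e]
      exact mul_le_mul_of_nonneg_left a3 (by positivity)
    have a6 := mul_le_mul_of_nonneg_left a0 hK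
    have a7 := mul_le_mul_of_nonneg_left a0 Lf.2
    have e3 : 2 * (ε * v z + lam + (1/θ) * ‖fderiv ℝ v z‖ ^ θ - f z)
        - 2 * (ε * v z' + lam + (1/θ) * ‖fderiv ℝ v z'‖ ^ θ - f z')
        = 2 * (ε * (v z - v z') + (1/θ) * (‖fderiv ℝ v z‖ ^ θ - ‖fderiv ℝ v z'‖ ^ θ) - (f z - f z')) := by ring
    rw [e3, abs_mul, abs_two]
    have a8 : |ε * (v z - v z') + (1/θ) * (‖fderiv ℝ v z‖ ^ θ - ‖fderiv ℝ v z'‖ ^ θ) - (f z - f z')|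
        ≤ K * ‖z - z'‖ + K ^ (θ - 1) * (C1 * Q * ‖z - z'‖ ^ (1/2 : ℝ)) + Lf * ‖z - z'‖ := by
      refine (abs_sub _ _).trans (add_le_add ((abs_add_le _ _).trans (add_le_add a1 a5)) a4)
    have a9 : 0 ≤ K * S * ‖z - z'‖ ^ (1/2 : ℝ) := by positivity
    have e4 : T * ‖z - z'‖ ^ (1/2 : ℝ) = K * S * ‖z - z'‖ ^ (1/2 : ℝ) + 2 * (K * (S * ‖z - z'‖ ^ (1/2 : ℝ))
      + K ^ (θ - 1) * (C1 * Q * ‖z - z'‖ ^ (1/2 : ℝ)) + Lf * (S * ‖z - z'‖ ^ (1/2 : ℝ))) := by rw [hT]; ring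
    rw [e4]
    have a7' : (Lf:ℝ) * ‖z - z'‖ ≤ Lf * (S * ‖z - z'‖ ^ (1/2 : ℝ)) := a7
    linarith
end est
end EP

open Filter Topology MeasureTheory
namespace EP
set_option linter.unusedSectionVars false

section lim
variable {m : ℕ} {F : Type*} [NormedAddCommGroup F] [NormedSpace ℝ F]

lemma ulim [ProperSpace F] (U : Ultrafilter ℕ) (hU : (U : Filter ℕ) ≤ atTop) {a : ℕ → F} {C : ℝ}
    (h : ∀ᶠ n in atTop, ‖a n‖ ≤ C) : ∃ b, Tendsto a U (𝓝 b) := by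
  have h1 : ∀ᶠ n in (U : Filter ℕ), a n ∈ Metric.closedBall (0 : F) C := by
    filter_upwards [hU h] with n hn
    simpa using hn
  obtain ⟨b, -, hb⟩ := (isCompact_closedBall (0 : F) C).ultrafilter_le_nhds (U.map a)
    (by rw [le_principal_iff]; exact h1)
  exact ⟨b, hb⟩

lemma taylor1 {u : Eu m → F} (hu : Differentiable ℝ u) {r C e : ℝ} (hC : 0 ≤ C) (he : 0 ≤ e)
    (h : ∀ x ∈ Metric.closedBall (0 : Eu m) r, ∀ y ∈ Metric.closedBall (0 : Eu m) r,
      ‖fderiv ℝ u x - fderiv ℝ u y‖ ≤ C * ‖x - y‖ ^ e)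
    {x y : Eu m} (hx : x ∈ Metric.closedBall (0 : Eu m) r) (hy : y ∈ Metric.closedBall (0 : Eu m) r) :
    ‖u y - u x - fderiv ℝ u x (y - x)‖ ≤ C * ‖y - x‖ ^ e * ‖y - x‖ := by
  refine (convex_segment x y).norm_image_sub_le_of_norm_hasFDerivWithin_le' (f' := fderiv ℝ u)
    (fun z _ => (hu z).hasFDerivAt.hasFDerivWithinAt) (fun z hz => ?_) (left_mem_segment ℝ x y)
    (right_mem_segment ℝ x y)
  have hz1 := (convex_closedBall (0 : Eu m) r).segment_subset hx hy hz
  refine (h z hz1 x hx).trans ?_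
  have : ‖z - x‖ ≤ ‖y - x‖ := norm_sub_le_of_mem_segment hz
  gcongr

lemma hasF_of {w : Eu m → F} {L : Eu m →L[ℝ] F} {x : Eu m} {C e : ℝ} (he : 0 < e)
    (h : ∀ y ∈ Metric.closedBall (0 : Eu m) (‖x‖ + 1), ‖w y - w x - L (y - x)‖ ≤ C * ‖y - x‖ ^ e * ‖y - x‖) :
    HasFDerivAt w L x := by
  rw [hasFDerivAt_iff_tendsto]
  have ht : Tendsto (fun y => C * ‖y - x‖ ^ e) (𝓝 x) (𝓝 0) := by
    have : Continuous (fun y => C * ‖y - x‖ ^ e) :=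
      continuous_const.mul ((continuous_id.sub continuous_const).norm.rpow_const
        fun _ => Or.inr he.le)
    have h2 := this.tendsto x
    simpa [Real.zero_rpow he.ne'] using h2
  refine squeeze_zero' (Eventually.of_forall fun y => by positivity) ?_ ht
  filter_upwards [Metric.ball_mem_nhds x one_pos] with y hy
  have hy1 : y ∈ Metric.closedBall (0 : Eu m) (‖x‖ + 1) := by
    rw [mem_closedBall_zero_iff]
    rw [mem_ball_iff_norm] at hy
    have := norm_le_norm_add_norm_sub' y x
    linarith
  have h1 := h y hy1
  by_cases hyx : ‖y - x‖ = 0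
  · rw [hyx]
    simp [Real.zero_rpow he.ne']
  · have hp : 0 < ‖y - x‖ := lt_of_le_of_ne (norm_nonneg _) (Ne.symm hyx)
    rw [inv_mul_le_iff₀ hp]
    linarith

lemma lim_fderiv {U : Filter ℕ} [U.NeBot] (hU : U ≤ atTop) {u : ℕ → Eu m → F} (hu : ∀ n, Differentiable ℝ (u n))
    {e : ℝ} (he : 0 < e)
    (h : ∀ r : ℝ, ∃ C, 0 ≤ C ∧ ∀ᶠ n in atTop, ∀ x ∈ Metric.closedBall (0 : Eu m) r,
      ∀ y ∈ Metric.closedBall (0 : Eu m) r, ‖fderiv ℝ (u n) x - fderiv ℝ (u n) y‖ ≤ C * ‖x - y‖ ^ e)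
    {w : Eu m → F} {w' : Eu m → Eu m →L[ℝ] F} (hw : ∀ x, Tendsto (fun n => u n x) U (𝓝 (w x)))
    (hw' : ∀ x, Tendsto (fun n => fderiv ℝ (u n) x) U (𝓝 (w' x))) (x : Eu m) :
    HasFDerivAt w (w' x) x := by
  obtain ⟨C, hC0, hC⟩ := h (‖x‖ + 1)
  refine hasF_of (C := C) he fun y hy => ?_
  have ht : Tendsto (fun n => ‖u n y - u n x - fderiv ℝ (u n) x (y - x)‖) U
      (𝓝 ‖w y - w x - w' x (y - x)‖) :=
    (((hw y).sub (hw x)).sub (((ContinuousLinearMap.apply ℝ F (y - x)).continuous.tendsto _).comp (hw' x))).norm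
  refine le_of_tendsto ht ?_
  filter_upwards [hU hC] with n hn
  exact taylor1 (hu n) hC0 he.le hn (by simp) hy

lemma lim_dist_le {E : Type*} [NormedAddCommGroup E] {U : Filter ℕ} [U.NeBot] {a b : ℕ → E} {x y : E} {C : ℝ}
    (ha : Tendsto a U (𝓝 x)) (hb : Tendsto b U (𝓝 y)) (h : ∀ᶠ n in U, ‖a n - b n‖ ≤ C) : ‖x - y‖ ≤ C :=
  le_of_tendsto (ha.sub hb).norm h

lemma limit_C2 (v : ℕ → Eu m → ℝ) (hv : ∀ n, ContDiff ℝ 2 (v n)) (U : Ultrafilter ℕ)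
    (hU : (U : Filter ℕ) ≤ atTop)
    (H : ∀ r : ℝ, ∃ C, 0 ≤ C ∧ ∀ᶠ n in atTop, ∀ x ∈ Metric.closedBall (0 : Eu m) r,
      ‖v n x‖ ≤ C ∧ ‖fderiv ℝ (v n) x‖ ≤ C ∧ ‖fderiv ℝ (fderiv ℝ (v n)) x‖ ≤ C ∧
      ∀ y ∈ Metric.closedBall (0 : Eu m) r,
        ‖fderiv ℝ (fderiv ℝ (v n)) x - fderiv ℝ (fderiv ℝ (v n)) y‖ ≤ C * ‖x - y‖ ^ (1/4 : ℝ)) :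
    ∃ w, ContDiff ℝ 2 w ∧ ∀ x, Tendsto (fun n => v n x) U (𝓝 (w x)) ∧
      Tendsto (fun n => fderiv ℝ (v n) x) U (𝓝 (fderiv ℝ w x)) ∧
      Tendsto (fun n => lap (v n) x) U (𝓝 (lap w x)) := by
  have p1 : ProperSpace (Eu m →L[ℝ] ℝ) := FiniteDimensional.proper_real _
  have p2 : ProperSpace (Eu m →L[ℝ] Eu m →L[ℝ] ℝ) :=
    FiniteDimensional.proper_real (Eu m →L[ℝ] Eu m →L[ℝ] ℝ)
  have e0 : ∀ x, ∃ b, Tendsto (fun n => v n x) U (𝓝 b) := fun x => by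
    obtain ⟨C, -, hC⟩ := H ‖x‖
    exact ulim U hU (C := C) (hC.mono fun n hn => (hn x (by simp)).1)
  have e1 : ∀ x, ∃ b, Tendsto (fun n => fderiv ℝ (v n) x) U (𝓝 b) := fun x => by
    obtain ⟨C, -, hC⟩ := H ‖x‖
    exact ulim U hU (C := C) (hC.mono fun n hn => (hn x (by simp)).2.1)
  have e2 : ∀ x, ∃ b, Tendsto (fun n => fderiv ℝ (fderiv ℝ (v n)) x) U (𝓝 b) := fun x => by
    obtain ⟨C, -, hC⟩ := H ‖x‖
    exact ulim (F := Eu m →L[ℝ] Eu m →L[ℝ] ℝ) U hU (C := C) (hC.mono fun n hn => (hn x (by simp)).2.2.1)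
  choose w hw using e0
  choose w1 hw1 using e1
  choose w2 hw2 using e2
  have hv1 : ∀ n, Differentiable ℝ (v n) := fun n => (hv n).differentiable (by norm_num)
  have hv2 : ∀ n, Differentiable ℝ (fderiv ℝ (v n)) := fun n =>
    ((hv n).fderiv_right (m := 1) (by norm_num)).differentiable (by norm_num)
  have d1 : ∀ x, HasFDerivAt w (w1 x) x := lim_fderiv (e := 1) hU hv1 one_pos (fun r => by
    obtain ⟨C, hC0, hC⟩ := H r
    refine ⟨C, hC0, hC.mono fun n hn x hx y hy => ?_⟩
    rw [Real.rpow_one]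
    exact (convex_closedBall (0 : Eu m) r).norm_image_sub_le_of_norm_fderiv_le
      (fun z _ => hv2 n z) (fun z hz => (hn z hz).2.2.1) hy hx) hw hw1
  have d2 : ∀ x, HasFDerivAt w1 (w2 x) x := lim_fderiv (e := 1/4) hU hv2 (by norm_num) (fun r => by
    obtain ⟨C, hC0, hC⟩ := H r
    exact ⟨C, hC0, hC.mono fun n hn x hx y hy => (hn x hx).2.2.2 y hy⟩) hw1 hw2
  have hc : Continuous w2 := by
    refine cont_of_hol (F := Eu m →L[ℝ] Eu m →L[ℝ] ℝ) (e := 1/4) (by norm_num) fun r => ?_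
    obtain ⟨C, hC0, hC⟩ := H r
    refine ⟨C, fun x hx y hy => ?_⟩
    refine lim_dist_le (E := Eu m →L[ℝ] Eu m →L[ℝ] ℝ) (hw2 x) (hw2 y) ?_
    filter_upwards [hU hC] with n hn
    exact (hn x hx).2.2.2 y hy
  have f1 : fderiv ℝ w = w1 := funext fun x => (d1 x).fderiv
  have f2 : fderiv ℝ w1 = w2 := funext fun x => (d2 x).fderiv
  refine ⟨w, C2_of d1 d2 hc, fun x => ⟨hw x, by rw [f1]; exact hw1 x, ?_⟩⟩
  simp only [lap_tr]
  rw [f1, f2]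
  exact ((tr (m := m)).continuous.tendsto _).comp (hw2 x)

end lim
end EP

open Filter Topology MeasureTheory
namespace EP
set_option linter.unusedSectionVars false

section main
variable {m : ℕ}

lemma bd_ball {f : Eu m → ℝ} (hf : Continuous f) (R : ℝ) : ∃ B, 0 ≤ B ∧
    ∀ x ∈ Metric.closedBall (0 : Eu m) R, |f x| ≤ B := by
  obtain ⟨C, hC⟩ := (isCompact_closedBall (0 : Eu m) R).exists_bound_of_continuousOn hf.continuousOn
  exact ⟨max C 0, le_max_right _ _, fun x hx => (hC x hx).trans (le_max_left _ _)⟩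

lemma grad_bd {θ : ℝ} (hθ : 1 < θ) {f : Eu m → ℝ} (hf : LocallyLipschitz f) (r c0 : ℝ) :
    ∃ K, 0 ≤ K ∧ ∀ (ε : ℝ) (u : Eu m → ℝ), 0 ≤ ε → ContDiff ℝ 2 u →
      (∀ x ∈ Metric.closedBall (0 : Eu m) (r + 2), ε * u x - (1/2) * lap u x + (1/θ) * ‖fderiv ℝ u x‖ ^ θ = f x) →
      (∀ x, -c0 ≤ ε * u x) → ∀ x ∈ Metric.closedBall (0 : Eu m) r, ‖fderiv ℝ u x‖ ≤ K := by
  obtain ⟨L, hL⟩ := lip_ball hf (r + 2)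
  obtain ⟨B, hB0, hB⟩ := bd_ball hf.continuous (r + 2)
  obtain ⟨K, hK0, hK⟩ := bernstein (m := m) hθ L.2 (show 0 ≤ B + |c0| by positivity)
  refine ⟨K, hK0, fun ε u hε hu heq hl c hc => ?_⟩
  rw [mem_closedBall_zero_iff] at hc
  have hsub : ∀ x ∈ Metric.ball c 2, x ∈ Metric.closedBall (0 : Eu m) (r + 2) := fun x hx => by
    rw [mem_closedBall_zero_iff]
    rw [mem_ball_iff_norm] at hx
    have := norm_le_norm_add_norm_sub' x c
    linarith
  refine hK c u f ε hε hu (fun x hx => heq x (hsub x hx)) (fun x hx y hy => ?_) fun x hx => ?_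
  · have := hL.dist_le_mul x (hsub x hx) y (hsub y hy)
    rwa [Real.dist_eq, dist_eq_norm] at this
  · have h1 := (abs_le.1 (hB x (hsub x (Metric.ball_subset_ball (by norm_num) hx)))).2
    have h2 := hl x
    have h3 := le_abs_self c0
    linarith

lemma exists_lim {θ : ℝ} (hθ : 1 < θ) {f : Eu m → ℝ} (hf : LocallyLipschitz f) {lamS : ℝ}
    (hsub : ∀ n : ℕ, ∃ lam φ, lamS - 1 / ((n:ℝ) + 1) ≤ lam ∧ ContDiff ℝ 2 φ ∧
      ∀ x, -(1/2) * lap φ x + (1/θ) * ‖fderiv ℝ φ x‖ ^ θ ≤ f x - lam) :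
    ∃ lam w, lamS ≤ lam ∧ ContDiff ℝ 2 w ∧
      ∀ x, -(1/2) * lap w x + (1/θ) * ‖fderiv ℝ w x‖ ^ θ = f x - lam := by
  have hθ0 : 0 < θ := by linarith
  have happ : ∀ n : ℕ, ∃ ε u, 0 < ε ∧ ε ≤ 1 / ((n:ℝ) + 1) ∧ ContDiff ℝ 2 u ∧ LH (lap u) ∧
      (∀ x ∈ Metric.closedBall (0 : Eu m) ((n:ℝ) + 1),
        ε * u x - (1/2) * lap u x + (1/θ) * ‖fderiv ℝ u x‖ ^ θ = f x) ∧
      ∀ x, lamS - 2 * (1 / ((n:ℝ) + 1)) ≤ ε * u x := fun n => by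
    obtain ⟨lam, φ, h1, h2, h3⟩ := hsub n
    obtain ⟨ε, u, a1, a2, a3, a4, a5, a6⟩ := approx hθ hf h2 h3 (show (0:ℝ) < (n:ℝ) + 1 by positivity)
      (show (0:ℝ) < 1 / ((n:ℝ) + 1) by positivity)
    exact ⟨ε, u, a1, a2, a3, a4, a5, fun x => by linarith [a6 x]⟩
  choose ε u hε0 hεn hu hlu heq hlow using happ
  have hn1 : ∀ n : ℕ, 1 / ((n:ℝ) + 1) ≤ 1 := fun n => by
    rw [div_le_one (by positivity)]
    linarith [(Nat.cast_nonneg n : (0:ℝ) ≤ n)]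
  have hε1 : ∀ n, ε n ≤ 1 := fun n => (hεn n).trans (hn1 n)
  have hlow2 : ∀ n x, -(2 - lamS) ≤ ε n * u n x := fun n x => by linarith [hlow n x, hn1 n]
  have hgrad : ∀ r : ℝ, ∃ K, 0 ≤ K ∧ ∀ᶠ n in atTop, ∀ x ∈ Metric.closedBall (0 : Eu m) r,
      ‖fderiv ℝ (u n) x‖ ≤ K := fun r => by
    obtain ⟨K, hK0, hK⟩ := grad_bd hθ hf r (2 - lamS)
    refine ⟨K, hK0, ?_⟩
    obtain ⟨N, hN⟩ := exists_nat_ge (r + 2)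
    filter_upwards [eventually_ge_atTop N] with n hn
    have hn' : (N:ℝ) ≤ n := by exact_mod_cast hn
    exact hK (ε n) (u n) (hε0 n).le (hu n)
      (fun x hx => heq n x (Metric.closedBall_subset_closedBall (by linarith) hx)) (hlow2 n)
  set lam : ℕ → ℝ := fun n => ε n * u n 0 with hlam
  obtain ⟨Λ, hΛ0, hΛ⟩ : ∃ Λ, 0 ≤ Λ ∧ ∀ᶠ n in atTop, |lam n| ≤ Λ := by
    obtain ⟨K1, hK10, hK1⟩ := hgrad 1
    obtain ⟨B, hB0, hB⟩ := bd_ball hf.continuous 1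
    obtain ⟨Cb, hCb⟩ := barrier (m := m) (Cf := B) hθ
    refine ⟨|Cb + K1| + |2 - lamS|, by positivity, ?_⟩
    filter_upwards [hK1] with n hn
    have h1 := hlow2 n 0
    have h2 := hCb 0 (u n) f (lam n - K1) (hu n)
      (fun x hx => (abs_le.1 (hB x (Metric.ball_subset_closedBall hx))).2) (fun x hx => by
        have hx1 := Metric.ball_subset_closedBall hx
        have e := heq n x (Metric.closedBall_subset_closedBall
          (by linarith [(Nat.cast_nonneg n : (0:ℝ) ≤ n)]) hx1)
        have h3 : |u n x - u n 0| ≤ K1 * ‖x - 0‖ :=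
          (convex_closedBall (0 : Eu m) 1).norm_image_sub_le_of_norm_fderiv_le
            (fun z _ => (hu n).differentiable (by norm_num) z) hn (Metric.mem_closedBall_self (by norm_num)) hx1
        have h4 : K1 * ‖x - 0‖ ≤ K1 := by
          refine mul_le_of_le_one_right hK10 ?_
          rw [sub_zero]
          simpa using hx1
        have h5 := (abs_le.1 (h3.trans h4)).1
        have h6 : ε n * (-K1) ≤ ε n * (u n x - u n 0) := mul_le_mul_of_nonneg_left h5 (hε0 n).le
        have h7 : ε n * K1 ≤ K1 := mul_le_of_le_one_left hK10 (hε1 n)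
        simp only [hlam]
        linarith)
    have h3 := le_abs_self (Cb + K1)
    have h4 := le_abs_self (2 - lamS)
    have h5 := abs_nonneg (Cb + K1)
    have h6 := abs_nonneg (2 - lamS)
    rw [abs_le]
    constructor
    · simp only [hlam]; linarith
    · linarith
  set v : ℕ → Eu m → ℝ := fun n x => u n x + (-u n 0) with hv
  have hvc : ∀ n, ContDiff ℝ 2 (v n) := fun n => (hu n).add contDiff_const
  have hvf : ∀ n, fderiv ℝ (v n) = fderiv ℝ (u n) := fun n => funext fun x => fderiv_add_const _
  have hvl : ∀ n, lap (v n) = lap (u n) := fun n => funext fun x => by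
    simp only [hv]
    rw [lap_add (hu n).contDiffAt contDiffAt_const, lap_const, add_zero]
  have hv0 : ∀ n, v n 0 = 0 := fun n => by simp [hv]
  have hveq : ∀ n : ℕ, ∀ x ∈ Metric.closedBall (0 : Eu m) ((n:ℝ) + 1),
      ε n * v n x + lam n - (1/2) * lap (v n) x + (1/θ) * ‖fderiv ℝ (v n) x‖ ^ θ = f x := fun n x hx => by
    rw [hvf, hvl, ← heq n x hx]
    simp only [hv, hlam]
    ring
  set U : Ultrafilter ℕ := hyperfilter ℕ with hUd
  have hU : (U : Filter ℕ) ≤ atTop := Nat.hyperfilter_le_atTop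
  have hH : ∀ r : ℝ, ∃ C, 0 ≤ C ∧ ∀ᶠ n in atTop, ∀ x ∈ Metric.closedBall (0 : Eu m) r,
      ‖v n x‖ ≤ C ∧ ‖fderiv ℝ (v n) x‖ ≤ C ∧ ‖fderiv ℝ (fderiv ℝ (v n)) x‖ ≤ C ∧
      ∀ y ∈ Metric.closedBall (0 : Eu m) r,
        ‖fderiv ℝ (fderiv ℝ (v n)) x - fderiv ℝ (fderiv ℝ (v n)) y‖ ≤ C * ‖x - y‖ ^ (1/4 : ℝ) := by
    intro r
    obtain ⟨K, hK0, hK⟩ := hgrad (|r| + 2)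
    obtain ⟨Ce, hCe0, hCe⟩ := est hθ hf (abs_nonneg r) (show 0 ≤ K + Λ by positivity)
    obtain ⟨N, hN⟩ := exists_nat_ge (|r| + 2)
    refine ⟨Ce + K + K * |r|, by positivity, ?_⟩
    filter_upwards [hK, hΛ, eventually_ge_atTop N] with n hn1 hn2 hn3 x hx
    have hn' : (N:ℝ) ≤ n := by exact_mod_cast hn3
    have hs1 : Metric.closedBall (0 : Eu m) r ⊆ Metric.closedBall 0 |r| :=
      Metric.closedBall_subset_closedBall (le_abs_self r)
    have hs2 : Metric.closedBall (0 : Eu m) |r| ⊆ Metric.closedBall 0 (|r| + 2) :=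
      Metric.closedBall_subset_closedBall (by linarith)
    have hKr : 0 ≤ K * |r| := by positivity
    have E := hCe (v n) (ε n) (lam n) (hvc n) (by rw [hvl]; exact hlu n) (hv0 n) (hε0 n).le (hε1 n)
      (by linarith)
      (fun z hz => hveq n z (Metric.closedBall_subset_closedBall (by linarith) hz))
      (fun z hz => by rw [hvf]; linarith [hn1 z hz]) x (hs1 hx)
    refine ⟨?_, ?_, ?_, fun y hy => ?_⟩
    · have h3 : |v n x - v n 0| ≤ K * ‖x - 0‖ :=
          (convex_closedBall (0 : Eu m) (|r| + 2)).norm_image_sub_le_of_norm_fderiv_le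
            (fun z _ => (hvc n).differentiable (by norm_num) z) (fun z hz => by rw [hvf]; exact hn1 z hz)
            (Metric.mem_closedBall_self (by positivity)) (hs2 (hs1 hx))
      rw [hv0, sub_zero, sub_zero] at h3
      have h4 : ‖x‖ ≤ |r| := by simpa using hs1 hx
      have h5 := mul_le_mul_of_nonneg_left h4 hK0
      rw [Real.norm_eq_abs]
      linarith
    · rw [hvf]
      linarith [hn1 x (hs2 (hs1 hx))]
    · linarith [E.1]
    · refine (E.2 y (hs1 hy)).trans (mul_le_mul_of_nonneg_right (by linarith) (by positivity))
  obtain ⟨w, hw, hlim⟩ := limit_C2 v hvc U hU hH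
  obtain ⟨l, hl⟩ := ulim (F := ℝ) U hU (a := lam) (C := Λ) hΛ
  have hone : Tendsto (fun n : ℕ => 1 / ((n:ℝ) + 1)) (U : Filter ℕ) (𝓝 0) :=
    tendsto_one_div_add_atTop_nhds_zero_nat.mono_left hU
  have hεt : Tendsto ε (U : Filter ℕ) (𝓝 0) :=
    squeeze_zero (fun n => (hε0 n).le) hεn hone
  refine ⟨l, w, ?_, hw, fun x => ?_⟩
  · have ht : Tendsto (fun n : ℕ => lamS - 2 * (1 / ((n:ℝ) + 1))) (U : Filter ℕ) (𝓝 (lamS - 2 * 0)) :=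
      tendsto_const_nhds.sub (hone.const_mul 2)
    have := le_of_tendsto_of_tendsto' ht hl fun n => hlow n 0
    linarith
  · obtain ⟨t1, t2, t3⟩ := hlim x
    have T := (((hεt.mul t1).add hl).sub (t3.const_mul (1/2))).add
      ((t2.norm.rpow_const (p := θ) (Or.inr hθ0.le)).const_mul (1/θ))
    have T2 : Tendsto (fun n => ε n * v n x + lam n - (1/2) * lap (v n) x + (1/θ) * ‖fderiv ℝ (v n) x‖ ^ θ)
        (U : Filter ℕ) (𝓝 (f x)) := by
      refine tendsto_const_nhds.congr' ?_
      obtain ⟨N, hN⟩ := exists_nat_ge ‖x‖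
      filter_upwards [hU (eventually_ge_atTop N)] with n hn
      have hn' : (N:ℝ) ≤ n := by exact_mod_cast hn
      exact (hveq n x (by rw [mem_closedBall_zero_iff]; linarith)).symm
    have := tendsto_nhds_unique T T2
    linarith

end main
end EP

open Filter Topology MeasureTheory
theorem stmt3 (m : ℕ) (hm : 1 ≤ m) (θ : ℝ) (hθ : 1 < θ)
    (f : EuclideanSpace ℝ (Fin m) → ℝ) (hf : LocallyLipschitz f) (hbd : BddBelow (Set.range f)) :
    {lam : ℝ | ∃ φ, IsSubsolution θ f lam φ}.Nonempty ∧
    BddAbove {lam : ℝ | ∃ φ, IsSubsolution θ f lam φ} ∧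
    sInf (Set.range f) ≤ lambdaStar θ f ∧
    ∃ φ, IsSolution θ f (lambdaStar θ f) φ := by
  have hθ0 : 0 < θ := by linarith
  have hmem : sInf (Set.range f) ∈ {lam : ℝ | ∃ φ, IsSubsolution θ f lam φ} := by
    refine ⟨fun _ => 0, contDiff_const, fun y => ?_⟩
    rw [EP.lap_const, EP.norm_grad]
    have := csInf_le hbd (Set.mem_range_self y)
    simpa [Real.zero_rpow hθ0.ne'] using this
  have hbdd : BddAbove {lam : ℝ | ∃ φ, IsSubsolution θ f lam φ} := by
    obtain ⟨B, hB0, hB⟩ := EP.bd_ball hf.continuous 1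
    obtain ⟨C, hC⟩ := EP.barrier (m := m) (Cf := B) hθ
    refine ⟨C, ?_⟩
    rintro lam ⟨φ, h1, h2⟩
    refine hC 0 φ f lam h1 (fun x hx => (abs_le.1 (hB x (Metric.ball_subset_closedBall hx))).2) fun x _ => ?_
    rw [← EP.norm_grad]
    exact h2 x
  refine ⟨⟨_, hmem⟩, hbdd, le_csSup hbdd hmem, ?_⟩
  obtain ⟨lam, w, h1, h2, h3⟩ := EP.exists_lim hθ hf (lamS := lambdaStar θ f) (fun n => by
    have hp : (0:ℝ) < 1 / ((n:ℝ) + 1) := by positivity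
    obtain ⟨lam, ⟨φ, a1, a2⟩, a3⟩ := exists_lt_of_lt_csSup
      (s := {lam : ℝ | ∃ φ, IsSubsolution θ f lam φ}) (b := lambdaStar θ f - 1 / ((n:ℝ) + 1)) ⟨_, hmem⟩ (sub_lt_self _ hp)
    refine ⟨lam, φ, a3.le, a1, fun x => ?_⟩
    rw [← EP.norm_grad]
    exact a2 x)
  have h4 : lam ≤ lambdaStar θ f := le_csSup hbdd ⟨w, h2, fun y => by
    rw [EP.norm_grad]
    exact (h3 y).le⟩
  have h5 : lam = lambdaStar θ f := le_antisymm h4 h1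
  refine ⟨w, h2, fun y => ?_⟩
  rw [EP.norm_grad, ← h5]
  exact h3 y
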